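/- Strong comparison principle: Let Ω be a domain (open connected set) in ℝ^N with N ≥ 2 and let H : Ω → ℝ be locally Lipschitz continuous. Let u be a lower semicontinuous viscosity supersolution of M(u) = NH in Ω and let v be an upper semicontinuous viscosity subsolution of M(v) = NH in Ω. If u ≥ v in Ω and u(x₀) = v(x₀) at some point x₀ ∈ Ω, then u ≡ v in Ω. -/

import Mathlib

open Metric Set Filter Topology MeasureTheory

/-- The mean curvature operator `M(w) = div (Dw / sqrt (1 + |Dw|²))`,
computed as the sum of the partial derivatives of the components of the
normalized gradient field. -/
noncomputable def mcOp {N : ℕ} (w : EuclideanSpace ℝ (Fin N) → ℝ)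
    (x : EuclideanSpace ℝ (Fin N)) : ℝ :=
  ∑ i : Fin N,
    fderiv ℝ (fun y => (Real.sqrt (1 + ‖gradient w y‖ ^ 2))⁻¹ * gradient w y i) x
      (EuclideanSpace.single i 1)

/-- `f` is locally Lipschitz continuous on the set `s`. -/
def LocLipschitzOn {N : ℕ} (s : Set (EuclideanSpace ℝ (Fin N)))
    (f : EuclideanSpace ℝ (Fin N) → ℝ) : Prop :=
  ∀ x ∈ s, ∃ K : NNReal, ∃ t ∈ 𝓝[s] x, LipschitzOnWith K f t

/-- `u` is a viscosity supersolution of `M(u) = N H` on the open set `U`. -/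
def IsViscositySupersol {N : ℕ} (U : Set (EuclideanSpace ℝ (Fin N)))
    (H u : EuclideanSpace ℝ (Fin N) → ℝ) : Prop :=
  ∀ φ : EuclideanSpace ℝ (Fin N) → ℝ, ContDiffOn ℝ 2 φ U →
    ∀ x ∈ U, IsLocalMinOn (fun y => u y - φ y) U x → mcOp φ x ≤ N * H x

/-- `v` is a viscosity subsolution of `M(v) = N H` on the open set `U`. -/
def IsViscositySubsol {N : ℕ} (U : Set (EuclideanSpace ℝ (Fin N)))
    (H v : EuclideanSpace ℝ (Fin N) → ℝ) : Prop :=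
  ∀ φ : EuclideanSpace ℝ (Fin N) → ℝ, ContDiffOn ℝ 2 φ U →
    ∀ x ∈ U, IsLocalMaxOn (fun y => v y - φ y) U x → mcOp φ x ≥ N * H x


section JJ
variable {F : Type*} [NormedAddCommGroup F] [InnerProductSpace ℝ F]

lemma jl_lower {f : F → ℝ} {C : ℝ} (hC : 0 ≤ C)
    (hconv : ConvexOn ℝ univ (fun z => f z + C / 2 * ‖z‖ ^ 2)) {k s : F} {ρ : ℝ}
    (hk : ‖k‖ < ρ) (hs : ∀ z, ‖z‖ ≤ ρ → f z ≤ f k + inner ℝ s (z - k)) (z : F) :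
    f k + inner ℝ s (z - k) - C / 2 * ‖z - k‖ ^ 2 ≤ f z := by
  obtain ⟨ζ, rfl⟩ : ∃ ζ, z = k + ζ := ⟨z - k, by abel⟩
  rw [add_sub_cancel_left]
  have key : ∀ t : ℝ, 0 < t → t * ‖ζ‖ ≤ ρ - ‖k‖ →
      f k + inner ℝ s ζ - C / 2 * ‖ζ‖ ^ 2 ≤ f (k + ζ) + t * (C / 2 * ‖ζ‖ ^ 2) := by
    intro t ht h1
    have h2 := hconv.2 (mem_univ (k + ζ)) (mem_univ (k - t • ζ))
      (show 0 ≤ t / (1 + t) by positivity) (show 0 ≤ 1 / (1 + t) by positivity)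
      (by field_simp; ring)
    have e1 : (t / (1 + t)) • (k + ζ) + (1 / (1 + t)) • (k - t • ζ) = k := by
      have h3 : (1:ℝ) + t ≠ 0 := by positivity
      have : (t / (1 + t)) • (k + ζ) + (1 / (1 + t)) • (k - t • ζ)
        = (t / (1 + t) + 1 / (1 + t)) • k + (t / (1 + t) - 1 / (1 + t) * t) • ζ := by
          module
      rw [this]
      have h4 : t / (1 + t) + 1 / (1 + t) = 1 := by field_simp; ring
      have h5 : t / (1 + t) - 1 / (1 + t) * t = 0 := by field_simp; ring
      rw [h4, h5]; simp
    rw [e1] at h2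
    simp only [smul_eq_mul] at h2
    have h3 := hs (k - t • ζ) (by
      calc ‖k - t • ζ‖ ≤ ‖k‖ + ‖t • ζ‖ := norm_sub_le _ _
        _ = ‖k‖ + t * ‖ζ‖ := by rw [norm_smul, Real.norm_of_nonneg ht.le]
        _ ≤ ρ := by linarith)
    have e2 : k - t • ζ - k = -(t • ζ) := by abel
    rw [e2, inner_neg_right, inner_smul_right] at h3
    rw [norm_add_sq_real, norm_sub_sq_real, inner_smul_right, norm_smul, Real.norm_of_nonneg ht.le] at h2
    have h6 : (1 + t) * (f k + C / 2 * ‖k‖ ^ 2) ≤ t * (f (k + ζ) + C / 2 * (‖k‖ ^ 2 + 2 * inner ℝ k ζ + ‖ζ‖ ^ 2))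
        + (f (k - t • ζ) + C / 2 * (‖k‖ ^ 2 - 2 * (t * inner ℝ k ζ) + (t * ‖ζ‖) ^ 2)) := by
      have := mul_le_mul_of_nonneg_left h2 (show 0 ≤ 1 + t by positivity)
      refine this.trans (le_of_eq ?_)
      field_simp
    have h7 : t * (f k + inner ℝ s ζ - C / 2 * ‖ζ‖ ^ 2) ≤ t * (f (k + ζ) + t * (C / 2 * ‖ζ‖ ^ 2)) := by
      nlinarith
    exact le_of_mul_le_mul_left h7 ht
  refine le_of_forall_pos_le_add fun ε hε => ?_
  set A := C / 2 * ‖ζ‖ ^ 2 with hA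
  have hA0 : 0 ≤ A := by positivity
  have hd : 0 < ρ - ‖k‖ := by linarith
  set t := min ((ρ - ‖k‖) / (‖ζ‖ + 1)) (ε / (A + 1)) with ht
  have ht0 : 0 < t := lt_min (by positivity) (by positivity)
  have h1 : t * ‖ζ‖ ≤ ρ - ‖k‖ := by
    have : t * (‖ζ‖ + 1) ≤ ρ - ‖k‖ := by
      have := min_le_left ((ρ - ‖k‖) / (‖ζ‖ + 1)) (ε / (A + 1))
      rwa [← ht, le_div_iff₀ (by positivity)] at this
    nlinarith
  have h2 : t * A ≤ ε := by
    have : t * (A + 1) ≤ ε := by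
      have := min_le_right ((ρ - ‖k‖) / (‖ζ‖ + 1)) (ε / (A + 1))
      rwa [← ht, le_div_iff₀ (by positivity)] at this
    nlinarith
  have := key t ht0 h1
  linarith

lemma jl_lip {f : F → ℝ} {C : ℝ} (hC : 0 ≤ C)
    (hconv : ConvexOn ℝ univ (fun z => f z + C / 2 * ‖z‖ ^ 2)) {k₁ s₁ k₂ s₂ : F} {σ ρ : ℝ}
    (hσ : 0 < σ) (hρ : 3 * σ ≤ ρ)
    (hk₁ : ‖k₁‖ < σ) (hs₁ : ∀ z, ‖z‖ ≤ ρ → f z ≤ f k₁ + inner ℝ s₁ (z - k₁))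
    (hk₂ : ‖k₂‖ < σ) (hs₂ : ∀ z, ‖z‖ ≤ ρ → f z ≤ f k₂ + inner ℝ s₂ (z - k₂)) :
    ‖s₁ - s₂‖ ≤ 2 * C * ‖k₁ - k₂‖ := by
  have key : ∀ t : ℝ, 0 < t → t ≤ 2 * σ →
      t * ‖s₁ - s₂‖ ≤ C / 2 * (t + ‖k₁ - k₂‖) ^ 2 := by
    intro t ht ht2
    rcases eq_or_ne (s₁ - s₂) 0 with h0 | h0
    · rw [h0]; simp; positivity
    have hn : 0 < ‖s₁ - s₂‖ := norm_pos_iff.2 h0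
    set ξ := (t / ‖s₁ - s₂‖) • (s₁ - s₂) with hξ
    have hξn : ‖ξ‖ = t := by
      rw [hξ, norm_smul, Real.norm_of_nonneg (by positivity)]; field_simp
    have hz : ‖k₂ + ξ‖ ≤ ρ := (norm_add_le _ _).trans (by rw [hξn]; linarith)
    have h1 := jl_lower hC hconv (lt_of_lt_of_le hk₁ (by linarith)) hs₁ (k₂ + ξ)
    have h2 := hs₂ _ hz
    have h3 := hs₁ k₂ (by linarith)
    have h4 : ‖k₂ + ξ - k₁‖ ≤ t + ‖k₁ - k₂‖ := by
      have : k₂ + ξ - k₁ = ξ - (k₁ - k₂) := by abel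
      rw [this]; exact (norm_sub_le _ _).trans (by rw [hξn])
    have h5 : C / 2 * ‖k₂ + ξ - k₁‖ ^ 2 ≤ C / 2 * (t + ‖k₁ - k₂‖) ^ 2 := by gcongr
    have e1 : (inner ℝ s₁ (k₂ + ξ - k₁) : ℝ) = inner ℝ s₁ (k₂ - k₁) + inner ℝ s₁ ξ := by
      rw [← inner_add_right]; congr 1; abel
    rw [add_sub_cancel_left] at h2
    have e2 : (inner ℝ s₁ ξ : ℝ) - inner ℝ s₂ ξ = t * ‖s₁ - s₂‖ := by
      rw [← inner_sub_left, hξ, inner_smul_right, real_inner_self_eq_norm_sq]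
      field_simp
    linarith
  rcases eq_or_ne k₁ k₂ with h | h
  · subst h
    simp only [sub_self, norm_zero, add_zero, mul_zero] at key ⊢
    refine le_of_forall_pos_le_add fun ε hε => ?_
    set t := min (2 * σ) (ε / (C / 2 + 1)) with ht
    have ht0 : 0 < t := lt_min (by positivity) (by positivity)
    have h1 := key t ht0 (min_le_left _ _)
    have h2 : t * (C / 2 + 1) ≤ ε := by
      have := min_le_right (2 * σ) (ε / (C / 2 + 1))
      rwa [← ht, le_div_iff₀ (by positivity)] at this
    have h3 : t * ‖s₁ - s₂‖ ≤ t * (t * (C / 2)) := by nlinarith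
    have := le_of_mul_le_mul_left h3 ht0
    nlinarith
  · have hp : 0 < ‖k₁ - k₂‖ := norm_pos_iff.2 (sub_ne_zero.2 h)
    have h1 := key _ hp ((norm_sub_le _ _).trans (by linarith))
    have h3 : ‖k₁ - k₂‖ * ‖s₁ - s₂‖ ≤ ‖k₁ - k₂‖ * (2 * C * ‖k₁ - k₂‖) := by nlinarith
    exact le_of_mul_le_mul_left h3 hp

/-- density points are approximable -/
lemma density_near [FiniteDimensional ℝ F] [MeasurableSpace F] [BorelSpace F]
    (μ : Measure F) [μ.IsAddHaarMeasure] {K : Set F} {k : F}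
    (h : Tendsto (fun r => μ (K ∩ closedBall k r) / μ (closedBall k r)) (𝓝[>] 0) (𝓝 1))
    {ε : ℝ} (hε : 0 < ε) (hε1 : ε ≤ 1) :
    ∃ R₀ > 0, ∀ R, 0 < R → R < R₀ → ∀ z, ‖z - k‖ ≤ R → ∃ k' ∈ K, ‖k' - z‖ ≤ ε * R := by
  set c : ENNReal := 1 - ENNReal.ofReal ((ε / 2) ^ Module.finrank ℝ F) with hc
  have hpos : 0 < ENNReal.ofReal ((ε / 2) ^ Module.finrank ℝ F) := by
    rw [ENNReal.ofReal_pos]; positivity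
  have hc1 : c < 1 := ENNReal.sub_lt_self ENNReal.one_ne_top one_ne_zero hpos.ne'
  have h1 := h.eventually (lt_mem_nhds hc1)
  rw [eventually_nhdsWithin_iff, Metric.eventually_nhds_iff] at h1
  obtain ⟨δ, hδ, h1⟩ := h1
  refine ⟨δ / 2, by positivity, fun R hR hR2 z hz => ?_⟩
  by_contra! hcon
  have h2 := h1 (y := 2 * R) (by rw [Real.dist_eq, sub_zero, abs_of_pos (by positivity)]; linarith)
    (by show 0 < 2 * R; positivity)
  have hsub : closedBall z (ε * R) ⊆ closedBall k (2 * R) := by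
    apply closedBall_subset_closedBall'
    rw [dist_eq_norm]; nlinarith
  have h3 : K ∩ closedBall k (2 * R) ⊆ closedBall k (2 * R) \ closedBall z (ε * R) := by
    rintro w ⟨hw1, hw2⟩
    refine ⟨hw2, fun hw3 => ?_⟩
    have := hcon w hw1
    rw [mem_closedBall, dist_eq_norm] at hw3
    linarith
  have h4 : μ (K ∩ closedBall k (2 * R)) ≤ μ (closedBall k (2 * R)) - μ (closedBall z (ε * R)) := by
    refine (measure_mono h3).trans (le_of_eq ?_)
    exact measure_sdiff hsub measurableSet_closedBall.nullMeasurableSet measure_closedBall_lt_top.ne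
  have hb0 : μ (closedBall k (2 * R)) ≠ 0 := (measure_closedBall_pos μ k (by positivity)).ne'
  have hbt : μ (closedBall k (2 * R)) ≠ ⊤ := measure_closedBall_lt_top.ne
  have h5 : μ (closedBall z (ε * R)) = ENNReal.ofReal ((ε / 2) ^ Module.finrank ℝ F) * μ (closedBall k (2 * R)) := by
    have : ε * R = (ε / 2) * (2 * R) := by ring
    rw [this, Measure.addHaar_closedBall_mul μ z (by positivity) (by positivity),
      Measure.addHaar_closedBall_center μ k]
  have h6 : μ (K ∩ closedBall k (2 * R)) ≤ c * μ (closedBall k (2 * R)) := by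
    rw [hc, ENNReal.sub_mul (fun _ _ => hbt), one_mul, ← h5]; exact h4
  have h7 : μ (K ∩ closedBall k (2 * R)) / μ (closedBall k (2 * R)) ≤ c :=
    ENNReal.div_le_of_le_mul h6
  exact absurd h2 (not_lt.2 h7)
end JJ


section JJ2
variable {F : Type*} [NormedAddCommGroup F] [InnerProductSpace ℝ F]

lemma tele_bound (a : ℕ → ℝ) (c : ℝ) (M : ℕ) (h : ∀ i < M, |a (i + 1) - a i| ≤ c) :
    |a M - a 0| ≤ M * c := by
  induction M with
  | zero => simp
  | succ n ih =>
    have h1 := ih (fun i hi => h i (by omega))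
    have h2 := h n (by omega)
    have : a (n + 1) - a 0 = (a (n + 1) - a n) + (a n - a 0) := by ring
    rw [this]
    refine (abs_add_le _ _).trans ?_
    push_cast; linarith

lemma jl_taylor {f : F → ℝ} {C : ℝ} (hC : 0 ≤ C)
    (hconv : ConvexOn ℝ univ (fun z => f z + C / 2 * ‖z‖ ^ 2)) {K : Set F} {G : F → F} {σ ρ : ℝ}
    (hσρ : σ ≤ ρ)
    (hK : ∀ k ∈ K, ‖k‖ < σ ∧ ∀ z, ‖z‖ ≤ ρ → f z ≤ f k + inner ℝ (G k) (z - k))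
    {k₀ : F} (hk₀ : k₀ ∈ K) {D : F →L[ℝ] F} (hD : HasFDerivWithinAt G D K k₀)
    (hdens : ∀ ε, 0 < ε → ε ≤ 1 → ∃ R₀ > 0, ∀ R, 0 < R → R < R₀ → ∀ z, ‖z - k₀‖ ≤ R →
      ∃ k' ∈ K, ‖k' - z‖ ≤ ε * R) (ε : ℝ) (hε : 0 < ε) :
    ∀ᶠ ζ in 𝓝 (0 : F),
      |f (k₀ + ζ) - f k₀ - inner ℝ (G k₀) ζ - 1 / 2 * inner ℝ (D ζ) ζ| ≤ ε * ‖ζ‖ ^ 2 := by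
  obtain ⟨M, hM⟩ := exists_nat_gt ((2 * C + 2 * ‖D‖ + 1) / (ε / 2))
  have hM0 : (0:ℝ) < M := lt_trans (by positivity) hM
  have hM1 : (1:ℝ) ≤ M := by
    have : 0 < M := by exact_mod_cast hM0
    exact_mod_cast this
  have hMC : (2 * C + 2 * ‖D‖) / M ≤ ε / 2 := by
    rw [div_lt_iff₀ (by positivity)] at hM
    rw [div_le_iff₀ hM0]; linarith
  obtain ⟨R₀, hR₀, hd⟩ := hdens (1 / M) (by positivity) (by rw [div_le_one hM0]; exact hM1)
  rw [hasFDerivWithinAt_iff_isLittleO] at hD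
  have hD2 := hD.def (show 0 < ε / 4 by positivity)
  rw [eventually_nhdsWithin_iff, Metric.eventually_nhds_iff] at hD2
  obtain ⟨R₁, hR₁, hD2⟩ := hD2
  have hkρ : 0 < ρ - ‖k₀‖ := by have := (hK _ hk₀).1; linarith
  rw [Metric.eventually_nhds_iff]
  refine ⟨min R₀ (min (R₁ / 2) (ρ - ‖k₀‖)), by positivity, fun ζ hζ => ?_⟩
  rw [dist_zero_right, lt_min_iff, lt_min_iff] at hζ
  obtain ⟨hζ0, hζ1, hζ2⟩ := hζ
  rcases eq_or_ne ζ 0 with h0 | h0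
  · subst h0; simp
  have hR : 0 < ‖ζ‖ := norm_pos_iff.2 h0
  set R := ‖ζ‖ with hRdef
  set z : ℕ → F := fun i => k₀ + ((i:ℝ) / M) • ζ with hz
  set a : ℕ → ℝ := fun i => f (z i) - inner ℝ (G k₀) (z i - k₀) - 1 / 2 * inner ℝ (D (z i - k₀)) (z i - k₀) with ha
  have hzk : ∀ i ≤ M, ‖z i - k₀‖ ≤ R := by
    intro i hi
    simp only [hz, add_sub_cancel_left, norm_smul]
    rw [Real.norm_of_nonneg (by positivity)]
    have : (i:ℝ) / M ≤ 1 := by rw [div_le_one hM0]; exact_mod_cast hi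
    nlinarith
  have hzρ : ∀ i ≤ M, ‖z i‖ ≤ ρ := by
    intro i hi
    have : z i = k₀ + (z i - k₀) := by abel
    rw [this]
    exact (norm_add_le _ _).trans (by have := hzk i hi; linarith)
  have step : ∀ i < M, |a (i + 1) - a i| ≤ (2 * C * R ^ 2 / M ^ 2 + (2 * ‖D‖ * R ^ 2 / M ^ 2 + ε / 2 * R ^ 2 / M)) := by
    intro i hi
    obtain ⟨k, hkK, hkz⟩ := hd R hR hζ0 (z i) (hzk i hi.le)
    obtain ⟨hkσ, hkt⟩ := hK k hkK
    have low := jl_lower hC hconv (lt_of_lt_of_le hkσ hσρ) hkt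
    have hkk : ‖k - k₀‖ ≤ 2 * R := by
      have : k - k₀ = (k - z i) + (z i - k₀) := by abel
      rw [this]
      refine (norm_add_le _ _).trans ?_
      have h1 := hzk i hi.le
      have : 1 / (M:ℝ) ≤ 1 := by rw [div_le_one hM0]; exact hM1
      nlinarith
    have hGk := hD2 (y := k) (by rw [dist_eq_norm]; linarith) hkK
    have hw : z (i + 1) - z i = (1 / (M:ℝ)) • ζ := by
      simp only [hz]
      have : (((i + 1 : ℕ) : ℝ)) / M = (i:ℝ) / M + 1 / M := by push_cast; ring
      rw [this, add_smul]; abel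
    set w := (1 / (M:ℝ)) • ζ with hwdef
    have hwn : ‖w‖ = R / M := by
      rw [hwdef, norm_smul, Real.norm_of_nonneg (by positivity)]; ring
    have hz1 : ‖z (i + 1) - k‖ ≤ 2 * (R / M) := by
      have : z (i + 1) - k = w - (k - z i) := by rw [← hw]; abel
      rw [this]
      refine (norm_sub_le _ _).trans ?_
      rw [hwn]; have : 1 / (M:ℝ) * R = R / M := by ring
      linarith
    have hz0 : ‖z i - k‖ ≤ R / M := by
      rw [norm_sub_rev]; have : 1 / (M:ℝ) * R = R / M := by ring
      linarith
    have u1 := hkt (z (i + 1)) (hzρ _ hi)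
    have u0 := hkt (z i) (hzρ _ hi.le)
    have l1 := low (z (i + 1))
    have l0 := low (z i)
    have e1 : (inner ℝ (G k) (z (i + 1) - k) : ℝ) = inner ℝ (G k) (z i - k) + inner ℝ (G k) w := by
      rw [← inner_add_right, ← hw]; congr 1; abel
    have q1 : C / 2 * ‖z (i + 1) - k‖ ^ 2 ≤ 2 * C * R ^ 2 / M ^ 2 := by
      calc C / 2 * ‖z (i + 1) - k‖ ^ 2 ≤ C / 2 * (2 * (R / M)) ^ 2 := by gcongr
        _ = _ := by field_simp
    have q0 : C / 2 * ‖z i - k‖ ^ 2 ≤ 2 * C * R ^ 2 / M ^ 2 := by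
      calc C / 2 * ‖z i - k‖ ^ 2 ≤ C / 2 * (2 * (R / M)) ^ 2 := by
            gcongr
            have : 0 ≤ R / M := by positivity
            linarith
        _ = _ := by field_simp
    have main1 : |f (z (i + 1)) - f (z i) - inner ℝ (G k) w| ≤ 2 * C * R ^ 2 / M ^ 2 := by
      rw [abs_le]; constructor <;> linarith
    -- the quadratic increments
    have e2 : a (i + 1) - a i = (f (z (i + 1)) - f (z i) - inner ℝ (G k) w)
        + (inner ℝ (G k - G k₀ - D (k - k₀)) w + inner ℝ (D (k - z i)) w
          - 1 / 2 * inner ℝ (D w) w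
          + (1 / 2 * inner ℝ (D (z i - k₀)) w - 1 / 2 * inner ℝ (D w) (z i - k₀))) := by
      have h1 : z (i + 1) - k₀ = (z i - k₀) + w := by rw [← hw]; abel
      have h2 : k - k₀ = (k - z i) + (z i - k₀) := by abel
      simp only [ha]
      rw [h1, h2]
      simp only [map_add, inner_add_left, inner_add_right, inner_sub_left]
      ring
    have e3 : (1 / 2 * inner ℝ (D (z i - k₀)) w - 1 / 2 * inner ℝ (D w) (z i - k₀) : ℝ) = 0 := by
      have : z i - k₀ = (i:ℝ) • w := by
        simp only [hz, hwdef, add_sub_cancel_left, smul_smul]; congr 1; ring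
      rw [this]; simp only [map_smul, inner_smul_left, inner_smul_right]; simp
    rw [e2, e3, add_zero]
    refine (abs_add_le _ _).trans (add_le_add main1 ?_)
    have b1 : |(inner ℝ (G k - G k₀ - D (k - k₀)) w : ℝ)| ≤ ε / 2 * R ^ 2 / M := by
      refine (abs_real_inner_le_norm _ _).trans ?_
      rw [hwn]
      calc ‖G k - G k₀ - D (k - k₀)‖ * (R / M) ≤ (ε / 4 * ‖k - k₀‖) * (R / M) := by gcongr
        _ ≤ (ε / 4 * (2 * R)) * (R / M) := by gcongr
        _ = _ := by ring
    have b2 : |(inner ℝ (D (k - z i)) w : ℝ)| ≤ ‖D‖ * R ^ 2 / M ^ 2 := by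
      refine (abs_real_inner_le_norm _ _).trans ?_
      rw [hwn]
      calc ‖D (k - z i)‖ * (R / M) ≤ (‖D‖ * ‖k - z i‖) * (R / M) := by
            gcongr; exact D.le_opNorm _
        _ ≤ (‖D‖ * (1 / M * R)) * (R / M) := by gcongr
        _ = _ := by field_simp
    have b3 : |(inner ℝ (D w) w : ℝ)| ≤ ‖D‖ * R ^ 2 / M ^ 2 := by
      refine (abs_real_inner_le_norm _ _).trans ?_
      calc ‖D w‖ * ‖w‖ ≤ (‖D‖ * ‖w‖) * ‖w‖ := by gcongr; exact D.le_opNorm _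
        _ = _ := by rw [hwn]; field_simp
    have hpos : 0 ≤ ‖D‖ * R ^ 2 / M ^ 2 := by positivity
    rw [abs_le] at b1 b2 b3 ⊢
    have : 2 * ‖D‖ * R ^ 2 / M ^ 2 = 2 * (‖D‖ * R ^ 2 / M ^ 2) := by ring
    rw [this]
    constructor <;> linarith [b1.1, b1.2, b2.1, b2.2, b3.1, b3.2]
  have tot := tele_bound a _ M step
  have eM : z M = k₀ + ζ := by simp only [hz]; rw [div_self hM0.ne', one_smul]
  have e0 : z 0 = k₀ := by simp [hz]
  have e4 : a M - a 0 = f (k₀ + ζ) - f k₀ - inner ℝ (G k₀) ζ - 1 / 2 * inner ℝ (D ζ) ζ := by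
    simp only [ha]; rw [eM, e0]; simp; ring
  rw [e4] at tot
  refine tot.trans ?_
  have : (M:ℝ) * (2 * C * R ^ 2 / M ^ 2 + (2 * ‖D‖ * R ^ 2 / M ^ 2 + ε / 2 * R ^ 2 / M))
    = ((2 * C + 2 * ‖D‖) / M + ε / 2) * R ^ 2 := by field_simp; ring
  rw [this]
  have : (0:ℝ) ≤ R ^ 2 := by positivity
  nlinarith

/-- Jensen--Alexandrov lemma -/
lemma jensen_alex [FiniteDimensional ℝ F] [MeasurableSpace F] [BorelSpace F]
    {f : F → ℝ} {C : ℝ} (hC : 0 ≤ C)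
    (hconv : ConvexOn ℝ univ (fun z => f z + C / 2 * ‖z‖ ^ 2)) {σ ρ μ₀ τ : ℝ} (hσ : 0 < σ)
    (hρ : 3 * σ ≤ ρ) (hμ : 0 < μ₀) (hτ : 0 < τ)
    (hf : ∀ z, σ ≤ ‖z‖ → ‖z‖ ≤ ρ → f z ≤ f 0 - μ₀) :
    ∃ k s : F, ∃ D : F →L[ℝ] F, ‖k‖ < σ ∧ ‖s‖ ≤ τ ∧
      (∀ z, ‖z‖ ≤ ρ → f z ≤ f k + inner ℝ s (z - k)) ∧
      ∀ ε, 0 < ε → ∀ᶠ ζ in 𝓝 (0 : F),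
        |f (k + ζ) - f k - inner ℝ s ζ - 1 / 2 * inner ℝ (D ζ) ζ| ≤ ε * ‖ζ‖ ^ 2 := by
  have hρ0 : 0 < ρ := by linarith
  have hcont : Continuous f := by
    have h1 : Continuous (fun z => f z + C / 2 * ‖z‖ ^ 2) :=
      continuousOn_univ.1 (hconv.continuousOn isOpen_univ)
    have : f = fun z => (f z + C / 2 * ‖z‖ ^ 2) - C / 2 * ‖z‖ ^ 2 := by ext z; ring
    rw [this]
    exact h1.sub (by fun_prop)
  set τ' := min τ (μ₀ / (2 * ρ)) with hτ'
  have hτ'0 : 0 < τ' := lt_min hτ (by positivity)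
  have hτρ : τ' * ρ < μ₀ := by
    have h1 := min_le_right τ (μ₀ / (2 * ρ))
    rw [← hτ', le_div_iff₀ (by positivity)] at h1
    linarith
  set K : Set F := {k | ‖k‖ < σ ∧ ∃ s : F, ‖s‖ ≤ τ' ∧ ∀ z, ‖z‖ ≤ ρ → f z ≤ f k + inner ℝ s (z - k)} with hKdef
  have hch : ∀ k : F, ∃ s : F, k ∈ K → (‖s‖ ≤ τ' ∧ ∀ z, ‖z‖ ≤ ρ → f z ≤ f k + inner ℝ s (z - k)) := by
    intro k
    by_cases hk : k ∈ K
    · obtain ⟨s, hs⟩ := hk.2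
      exact ⟨s, fun _ => hs⟩
    · exact ⟨0, fun h => absurd h hk⟩
  choose G hG using hch
  have hlip : LipschitzOnWith (Real.toNNReal (2 * C)) G K := by
    apply LipschitzOnWith.of_dist_le_mul
    intro x hx y hy
    rw [dist_eq_norm, dist_eq_norm, Real.coe_toNNReal _ (by positivity)]
    exact jl_lip hC hconv hσ hρ hx.1 (hG x hx).2 hy.1 (hG y hy).2
  have hsurj : closedBall (0:F) τ' ⊆ G '' K := by
    intro s hs
    rw [mem_closedBall_zero_iff] at hs
    obtain ⟨k, hkm, hk⟩ := (isCompact_closedBall (0:F) ρ).exists_isMaxOn ⟨0, by simp [hρ0.le]⟩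
      (f := fun z => f z - inner ℝ s z) (by fun_prop)
    rw [isMaxOn_iff] at hk
    rw [mem_closedBall_zero_iff] at hkm
    have h0 := hk 0 (by simp [hρ0.le])
    simp only [inner_zero_right, sub_zero] at h0
    have hin : |(inner ℝ s k : ℝ)| ≤ τ' * ρ := by
      refine (abs_real_inner_le_norm _ _).trans ?_
      gcongr
    rw [abs_le] at hin
    have hkσ : ‖k‖ < σ := by
      by_contra! hcon
      have := hf k hcon hkm
      linarith [hin.1]
    have htouch : ∀ z, ‖z‖ ≤ ρ → f z ≤ f k + inner ℝ s (z - k) := by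
      intro z hz
      have := hk z (by simpa using hz)
      rw [inner_sub_right]; linarith
    have hkK : k ∈ K := ⟨hkσ, s, hs, htouch⟩
    refine ⟨k, hkK, ?_⟩
    have := jl_lip hC hconv hσ hρ hkσ (hG k hkK).2 hkσ htouch
    simp only [sub_self, norm_zero, mul_zero] at this
    exact sub_eq_zero.1 (norm_le_zero_iff.1 this)
  let μ : Measure F := Measure.hausdorffMeasure (Module.finrank ℝ F)
  haveI : μ.IsAddHaarMeasure := isAddHaarMeasure_hausdorffMeasure
  have hKpos : μ K ≠ 0 := by
    intro h0
    have h1 := hlip.hausdorffMeasure_image_le (d := (Module.finrank ℝ F : ℝ)) (by positivity)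
    have h2 : μ (closedBall (0:F) τ') ≤ 0 := by
      refine (measure_mono hsurj).trans (h1.trans ?_)
      change _ * μ K ≤ 0
      rw [h0, mul_zero]
    exact absurd (measure_closedBall_pos μ (0:F) hτ'0) (not_lt.2 h2)
  have hae1 := hlip.ae_differentiableWithinAt_of_mem (μ := μ)
  have hae2 := Besicovitch.ae_tendsto_measure_inter_div μ K
  have hae1' := ae_restrict_of_ae (s := K) hae1
  have hex : ∃ x, x ∈ K ∧ DifferentiableWithinAt ℝ G K x ∧
      Tendsto (fun r => μ (K ∩ closedBall x r) / μ (closedBall x r)) (𝓝[>] 0) (𝓝 1) := by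
    by_contra! hcon
    have hall : ∀ᵐ x ∂(μ.restrict K), x ∉ K := by
      filter_upwards [hae1', hae2] with x h1 h2 hx
      exact hcon x hx (h1 hx) h2
    have h3 : μ.restrict K K = 0 := by
      have := (ae_iff.1 hall)
      simpa using this
    rw [Measure.restrict_apply_self] at h3
    exact hKpos h3
  obtain ⟨k, hkK, hdiff, hdens⟩ := hex
  refine ⟨k, G k, fderivWithin ℝ G K k, hkK.1, (hG k hkK).1.trans (min_le_left _ _), (hG k hkK).2, ?_⟩
  intro ε hε
  exact jl_taylor hC hconv (by linarith : σ ≤ ρ) (fun k hk => ⟨hk.1, (hG k hk).2⟩) hkK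
    hdiff.hasFDerivWithinAt (fun ε h1 h2 => density_near μ hdens h1 h2) ε hε
end JJ2


set_option linter.unusedSectionVars false
section SS
variable {F : Type*} [NormedAddCommGroup F] [InnerProductSpace ℝ F]

/-- `√(1+|p|²)` -/
noncomputable def sq1 (p : F) : ℝ := Real.sqrt (1 + ‖p‖ ^ 2)

/-- square root of the coefficient matrix -/
noncomputable def Sop (p h : F) : F := h - (inner ℝ p h / (sq1 p * (sq1 p + 1))) • p

lemma sq1_sq (p : F) : sq1 p ^ 2 = 1 + ‖p‖ ^ 2 := Real.sq_sqrt (by positivity)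
lemma sq1_ge (p : F) : 1 ≤ sq1 p := by
  unfold sq1; rw [Real.one_le_sqrt]; nlinarith [sq_nonneg ‖p‖]
lemma sq1_pos (p : F) : 0 < sq1 p := lt_of_lt_of_le one_pos (sq1_ge p)

lemma sq1_cont : Continuous (sq1 : F → ℝ) := by unfold sq1; fun_prop

lemma Sop_trace {N : ℕ} (b : OrthonormalBasis (Fin N) ℝ F) (X : F →L[ℝ] F) (p : F)
    (hX : ∀ a b, inner ℝ (X a) b = (inner ℝ a (X b) : ℝ)) :
    ∑ i, (inner ℝ (X (Sop p (b i))) (Sop p (b i)) : ℝ)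
      = ∑ i, (inner ℝ (X (b i)) (b i) : ℝ) - inner ℝ (X p) p / (sq1 p) ^ 2 := by
  set c := 1 / (sq1 p * (sq1 p + 1)) with hc
  have hp := sq1_pos p
  have h1 : ∀ i, (inner ℝ (X (Sop p (b i))) (Sop p (b i)) : ℝ) =
      inner ℝ (X (b i)) (b i) - 2 * c * (inner ℝ (X p) (b i) * inner ℝ (b i) p)
        + c ^ 2 * inner ℝ (X p) p * (inner ℝ p (b i) * inner ℝ (b i) p) := by
    intro i
    unfold Sop
    rw [div_eq_mul_one_div, ← hc]
    simp only [map_sub, map_smul, inner_sub_left, inner_sub_right, inner_smul_left, inner_smul_right]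
    have e1 : (inner ℝ (X (b i)) p : ℝ) = inner ℝ (X p) (b i) := by
      rw [hX, real_inner_comm]
    rw [e1, real_inner_comm (b i) p]
    simp; ring
  rw [Finset.sum_congr rfl (fun i _ => h1 i), Finset.sum_add_distrib, Finset.sum_sub_distrib,
    ← Finset.mul_sum, ← Finset.mul_sum, b.sum_inner_mul_inner, b.sum_inner_mul_inner,
    real_inner_self_eq_norm_sq]
  have h2 : ‖p‖ ^ 2 = sq1 p ^ 2 - 1 := by rw [sq1_sq]; ring
  rw [h2, hc]
  have h3 : sq1 p + 1 ≠ 0 := by positivity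
  field_simp
  ring
end SS

section MC
variable {N : ℕ}
local notation "EE" => EuclideanSpace ℝ (Fin N)

lemma grad_quad (p x : EE) (X : EE →L[ℝ] EE)
    (hX : ∀ a b, inner ℝ (X a) b = (inner ℝ a (X b) : ℝ)) (y : EE) :
    gradient (fun y => inner ℝ p (y - x) + 1 / 2 * inner ℝ (X (y - x)) (y - x)) y = p + X (y - x) := by
  apply HasGradientAt.gradient
  rw [hasGradientAt_iff_hasFDerivAt]
  have h0 : HasFDerivAt (fun y : EE => y - x) (ContinuousLinearMap.id ℝ EE) y :=
    (hasFDerivAt_id y).sub_const x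
  have h1 : HasFDerivAt (fun y : EE => (inner ℝ p (y - x) : ℝ)) _ y :=
    (hasFDerivAt_const p y).inner ℝ h0
  have h2 : HasFDerivAt (fun y : EE => X (y - x)) (X.comp (ContinuousLinearMap.id ℝ EE)) y :=
    X.hasFDerivAt.comp y h0
  have h3 := h1.add ((h2.inner ℝ h0).const_mul (1/2))
  refine h3.congr_fderiv ?_
  ext h
  simp [fderivInnerCLM_apply]
  rw [hX h (y - x)]
  simp only [inner_sub_left, map_sub, inner_sub_right]
  rw [real_inner_comm (X y) h, real_inner_comm (X x) h]
  ring

lemma mcOp_quad (p x : EE) (X : EE →L[ℝ] EE)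
    (hX : ∀ a b, inner ℝ (X a) b = (inner ℝ a (X b) : ℝ)) (b : OrthonormalBasis (Fin N) ℝ EE) :
    sq1 p * mcOp (fun y => inner ℝ p (y - x) + 1 / 2 * inner ℝ (X (y - x)) (y - x)) x
      = ∑ i, (inner ℝ (X (Sop p (b i))) (Sop p (b i)) : ℝ) := by
  rw [Sop_trace b X p hX]
  have htr : ∑ i, (inner ℝ (X (b i)) (b i) : ℝ) = ∑ i, X (EuclideanSpace.single i 1) i := by
    have h1 := LinearMap.trace_eq_sum_inner (X : EE →ₗ[ℝ] EE) b
    have h2 := LinearMap.trace_eq_sum_inner (X : EE →ₗ[ℝ] EE) (EuclideanSpace.basisFun (Fin N) ℝ)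
    rw [h1] at h2
    simp only [ContinuousLinearMap.coe_coe, EuclideanSpace.basisFun_apply] at h2
    calc _ = ∑ i, (inner ℝ (b i) (X (b i)) : ℝ) := by
          apply Finset.sum_congr rfl; intro i _; rw [real_inner_comm]
      _ = _ := by
          rw [h2]; apply Finset.sum_congr rfl; intro i _
          simp [EuclideanSpace.inner_single_left]
  rw [htr]
  unfold mcOp
  have hder : ∀ i : Fin N, fderiv ℝ (fun y => (Real.sqrt (1 + ‖gradient (fun y => inner ℝ p (y - x) + 1 / 2 * inner ℝ (X (y - x)) (y - x)) y‖ ^ 2))⁻¹ *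
      gradient (fun y => inner ℝ p (y - x) + 1 / 2 * inner ℝ (X (y - x)) (y - x)) y i) x
      (EuclideanSpace.single i 1) = (sq1 p)⁻¹ * X (EuclideanSpace.single i 1) i
        - (sq1 p)⁻¹ ^ 3 * (inner ℝ (X p) (EuclideanSpace.single i 1) * p i) := by
    intro i
    simp_rw [grad_quad p x X hX]
    have h0 : HasFDerivAt (fun y : EE => y - x) (ContinuousLinearMap.id ℝ EE) x :=
      (hasFDerivAt_id x).sub_const x
    have h2 : HasFDerivAt (fun y : EE => p + X (y - x)) (X.comp (ContinuousLinearMap.id ℝ EE)) x :=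
      (X.hasFDerivAt.comp x h0).const_add p
    have h3 : HasFDerivAt (fun y : EE => 1 + ‖p + X (y - x)‖ ^ 2) _ x := (h2.norm_sq).const_add 1
    have hpos : (1 + ‖p + X (x - x)‖ ^ 2) ≠ 0 := by positivity
    have h4 := h3.sqrt hpos
    have h5 := (hasDerivAt_inv (x := Real.sqrt (1 + ‖p + X (x - x)‖ ^ 2)) (by positivity)).comp_hasFDerivAt x h4
    have h6 : HasFDerivAt (fun y : EE => (p + X (y - x)) i) _ x :=
      (EuclideanSpace.proj (𝕜 := ℝ) i : EE →L[ℝ] ℝ).hasFDerivAt.comp x h2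
    have h7 := h5.mul h6
    have h8 := h7.fderiv
    change fderiv ℝ (fun y => (Real.sqrt (1 + ‖p + X (y - x)‖ ^ 2))⁻¹ * (p + X (y - x)) i) x = _ at h8
    rw [h8]
    have hs : Real.sqrt (1 + ‖p‖ ^ 2) = sq1 p := rfl
    have hsq := sq1_sq p
    have hp := sq1_pos p
    simp [hs]
    rw [hX p]
    field_simp
    ring
  rw [Finset.sum_congr rfl (fun i _ => hder i), Finset.sum_sub_distrib, ← Finset.mul_sum, ← Finset.mul_sum]
  have e5 : ∑ i, (inner ℝ (X p) (EuclideanSpace.single i (1:ℝ)) * p i : ℝ) = inner ℝ (X p) p := by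
    rw [PiLp.inner_apply]
    apply Finset.sum_congr rfl; intro i _
    rw [EuclideanSpace.inner_single_right]
    simp [mul_comm]
  rw [e5]
  have hp := sq1_pos p
  field_simp
end MC


section VS
variable {N : ℕ}
local notation "EE" => EuclideanSpace ℝ (Fin N)

lemma Sop_norm_sq_add {F : Type*} [NormedAddCommGroup F] [InnerProductSpace ℝ F] (p h : F) :
    ‖Sop p h‖ ^ 2 ≤ ‖h‖ ^ 2 := by
  have hp := sq1_pos p
  have hsq : ‖p‖ ^ 2 = sq1 p ^ 2 - 1 := by rw [sq1_sq]; ring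
  unfold Sop
  rw [norm_sub_sq_real, inner_smul_right, norm_smul, mul_pow, Real.norm_eq_abs, sq_abs, hsq,
    real_inner_comm]
  rw [real_inner_comm]
  set t := (inner ℝ p h : ℝ)
  have : ‖h‖ ^ 2 - 2 * (t / (sq1 p * (sq1 p + 1)) * t)
    + (t / (sq1 p * (sq1 p + 1))) ^ 2 * (sq1 p ^ 2 - 1) = ‖h‖ ^ 2 - t ^ 2 / sq1 p ^ 2 := by
    field_simp; ring
  rw [this]
  have : 0 ≤ t ^ 2 / sq1 p ^ 2 := by positivity
  linarith

lemma Sop_norm_le {F : Type*} [NormedAddCommGroup F] [InnerProductSpace ℝ F] (p h : F) :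
    ‖Sop p h‖ ≤ ‖h‖ := by
  have := Sop_norm_sq_add p h
  exact (pow_le_pow_iff_left₀ (norm_nonneg _) (norm_nonneg _) two_ne_zero).1 this

lemma quad_symm {F : Type*} [NormedAddCommGroup F] [InnerProductSpace ℝ F] [CompleteSpace F]
    (X : F →L[ℝ] F) :
    ∃ Y : F →L[ℝ] F, (∀ a b, inner ℝ (Y a) b = (inner ℝ a (Y b) : ℝ)) ∧
      ∀ a, inner ℝ (Y a) a = (inner ℝ (X a) a : ℝ) := by
  refine ⟨(1/2 : ℝ) • (X + ContinuousLinearMap.adjoint X), ?_, ?_⟩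
  · intro a b
    simp only [_root_.smul_apply, _root_.add_apply, inner_smul_left,
      inner_smul_right, inner_add_left, inner_add_right, ContinuousLinearMap.adjoint_inner_left,
      ContinuousLinearMap.adjoint_inner_right]
    simp; ring
  · intro a
    simp only [_root_.smul_apply, _root_.add_apply, inner_smul_left,
      inner_add_left, ContinuousLinearMap.adjoint_inner_left]
    rw [real_inner_comm a (X a)]
    simp; ring

lemma quad_contDiff (p x : EE) (X : EE →L[ℝ] EE) :
    ContDiff ℝ 2 (fun y : EE => (inner ℝ p (y - x) + 1 / 2 * inner ℝ (X (y - x)) (y - x) : ℝ)) := by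
  have h0 : ContDiff ℝ 2 (fun y : EE => y - x) := contDiff_id.sub contDiff_const
  exact (contDiff_const.inner ℝ h0).add (contDiff_const.mul ((X.contDiff.comp h0).inner ℝ h0))

lemma visc_sub {Ω : Set EE} {H v : EE → ℝ} (hv : IsViscositySubsol Ω H v)
    (b : OrthonormalBasis (Fin N) ℝ EE) {x p : EE} (hx : x ∈ Ω) (X : EE →L[ℝ] EE)
    (h : ∀ ε, 0 < ε → ∀ᶠ ζ in 𝓝 (0 : EE),
      v (x + ζ) ≤ v x + inner ℝ p ζ + 1 / 2 * inner ℝ (X ζ) ζ + ε * ‖ζ‖ ^ 2) :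
    sq1 p * (N * H x) ≤ ∑ i, (inner ℝ (X (Sop p (b i))) (Sop p (b i)) : ℝ) := by
  obtain ⟨Y, hY, hYX⟩ := quad_symm X
  simp_rw [← hYX] at h ⊢
  refine le_of_forall_pos_le_add fun ε hε => ?_
  set η := ε / (2 * (N + 1)) with hη
  have hη0 : 0 < η := by positivity
  set Z : EE →L[ℝ] EE := Y + (2 * η) • ContinuousLinearMap.id ℝ EE with hZ
  have hZs : ∀ a b, inner ℝ (Z a) b = (inner ℝ a (Z b) : ℝ) := by
    intro a b
    simp [hZ, inner_add_left, inner_add_right, inner_smul_left, inner_smul_right, hY]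
  have hZq : ∀ a, (inner ℝ (Z a) a : ℝ) = inner ℝ (Y a) a + 2 * η * ‖a‖ ^ 2 := by
    intro a
    simp [hZ, inner_add_left, inner_smul_left]
  have hmax : IsLocalMaxOn (fun y => v y - (fun y => (inner ℝ p (y - x) + 1 / 2 * inner ℝ (Z (y - x)) (y - x) : ℝ)) y) Ω x := by
    apply IsLocalMax.on
    have h1 := h η hη0
    have h2 : Tendsto (fun y : EE => y - x) (𝓝 x) (𝓝 0) := by
      have : Continuous (fun y : EE => y - x) := by fun_prop
      simpa using this.tendsto x
    filter_upwards [h2.eventually h1] with y hy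
    simp only [add_sub_cancel] at hy
    simp only [sub_self, hZq]
    simp [-map_sub]
    linarith
  have h3 := hv _ (quad_contDiff p x Z).contDiffOn x hx hmax
  have h4 := mul_le_mul_of_nonneg_left h3 (sq1_pos p).le
  rw [mcOp_quad p x Z hZs b] at h4
  refine h4.trans ?_
  simp_rw [hZq]
  rw [Finset.sum_add_distrib]
  have h5 : ∑ i : Fin N, 2 * η * ‖Sop p (b i)‖ ^ 2 ≤ ∑ i : Fin N, 2 * η := by
    apply Finset.sum_le_sum
    intro i _
    have := Sop_norm_sq_add p (b i)
    rw [b.norm_eq_one] at this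
    nlinarith
  have h6 : ∑ i : Fin N, 2 * η ≤ ε := by
    simp only [Finset.sum_const, Finset.card_univ, Fintype.card_fin, nsmul_eq_mul, hη]
    rw [show (N:ℝ) * (2 * (ε / (2 * (N + 1)))) = ε * (N / (N + 1)) by field_simp]
    have : (N:ℝ) / (N + 1) ≤ 1 := by rw [div_le_one (by positivity)]; linarith
    nlinarith
  linarith

lemma visc_super {Ω : Set EE} {H u : EE → ℝ} (hu : IsViscositySupersol Ω H u)
    (b : OrthonormalBasis (Fin N) ℝ EE) {x q : EE} (hx : x ∈ Ω) (Y : EE →L[ℝ] EE)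
    (h : ∀ ε, 0 < ε → ∀ᶠ ζ in 𝓝 (0 : EE),
      - u (x + ζ) ≤ - u x - inner ℝ q ζ + 1 / 2 * inner ℝ (Y ζ) ζ + ε * ‖ζ‖ ^ 2) :
    - (sq1 q * (N * H x)) ≤ ∑ i, (inner ℝ (Y (Sop q (b i))) (Sop q (b i)) : ℝ) := by
  obtain ⟨X, hY, hYX⟩ := quad_symm Y
  simp_rw [← hYX] at h ⊢
  refine le_of_forall_pos_le_add fun ε hε => ?_
  set η := ε / (2 * (N + 1)) with hη
  have hη0 : 0 < η := by positivity
  set Z : EE →L[ℝ] EE := - X - (2 * η) • ContinuousLinearMap.id ℝ EE with hZ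
  have hZs : ∀ a b, inner ℝ (Z a) b = (inner ℝ a (Z b) : ℝ) := by
    intro a b
    simp [hZ, inner_sub_left, inner_sub_right, inner_smul_left, inner_smul_right, hY]
  have hZq : ∀ a, (inner ℝ (Z a) a : ℝ) = - inner ℝ (X a) a - 2 * η * ‖a‖ ^ 2 := by
    intro a
    simp [hZ, inner_sub_left, inner_smul_left]
  have hmin : IsLocalMinOn (fun y => u y - (fun y => (inner ℝ q (y - x) + 1 / 2 * inner ℝ (Z (y - x)) (y - x) : ℝ)) y) Ω x := by
    apply IsLocalMin.on
    have h1 := h η hη0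
    have h2 : Tendsto (fun y : EE => y - x) (𝓝 x) (𝓝 0) := by
      have : Continuous (fun y : EE => y - x) := by fun_prop
      simpa using this.tendsto x
    filter_upwards [h2.eventually h1] with y hy
    simp only [add_sub_cancel] at hy
    simp only [sub_self, hZq]
    simp [-map_sub]
    linarith
  have h3 := hu _ (quad_contDiff q x Z).contDiffOn x hx hmin
  have h4 := mul_le_mul_of_nonneg_left h3 (sq1_pos q).le
  rw [mcOp_quad q x Z hZs b] at h4
  simp_rw [hZq] at h4
  rw [Finset.sum_sub_distrib, Finset.sum_neg_distrib] at h4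
  have h5 : ∑ i : Fin N, 2 * η * ‖Sop q (b i)‖ ^ 2 ≤ ∑ i : Fin N, 2 * η := by
    apply Finset.sum_le_sum
    intro i _
    have := Sop_norm_sq_add q (b i)
    rw [b.norm_eq_one] at this
    nlinarith
  have h6 : ∑ i : Fin N, 2 * η ≤ ε := by
    simp only [Finset.sum_const, Finset.card_univ, Fintype.card_fin, nsmul_eq_mul, hη]
    rw [show (N:ℝ) * (2 * (ε / (2 * (N + 1)))) = ε * (N / (N + 1)) by field_simp]
    have : (N:ℝ) / (N + 1) ≤ 1 := by rw [div_le_one (by positivity)]; linarith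
    nlinarith
  linarith
end VS


section DL1
variable {E : Type*} [NormedAddCommGroup E] [InnerProductSpace ℝ E]

lemma quad_convex {F : Type*} [NormedAddCommGroup F] [InnerProductSpace ℝ F] (S : F →L[ℝ] F)
    (hS : ∀ z, 0 ≤ (inner ℝ (S z) z : ℝ)) : ConvexOn ℝ univ (fun z => (inner ℝ (S z) z : ℝ)) := by
  refine ⟨convex_univ, fun x _ y _ a b ha hb hab => ?_⟩
  have h := hS (x - y)
  simp only [map_add, map_sub, map_smul, inner_add_left, inner_add_right, inner_sub_left,
    inner_sub_right, inner_smul_left, inner_smul_right, smul_eq_mul] at h ⊢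
  simp only [conj_trivial]
  have hb' : b = 1 - a := by linarith
  subst hb'
  nlinarith [mul_nonneg ha hb]

lemma supconv {A : Set E} (hA : IsCompact A) (hne : A.Nonempty) {w : E → ℝ}
    (hw : UpperSemicontinuousOn w A) (n : ℝ) :
    ∃ wn : E → ℝ, (∀ h, ∀ h' ∈ A, w h' - n / 2 * ‖h - h'‖ ^ 2 ≤ wn h) ∧
      (∀ h, ∃ h' ∈ A, wn h = w h' - n / 2 * ‖h - h'‖ ^ 2) ∧
      ConvexOn ℝ univ (fun h => wn h + n / 2 * ‖h‖ ^ 2) := by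
  have h1 : ∀ h : E, ∃ h' ∈ A, IsMaxOn (fun h' => w h' - n / 2 * ‖h - h'‖ ^ 2) A h' := by
    intro h
    have : UpperSemicontinuousOn (fun h' => w h' + (- (n / 2 * ‖h - h'‖ ^ 2))) A := by
      apply hw.add
      apply ContinuousOn.upperSemicontinuousOn
      fun_prop
    simpa [sub_eq_add_neg] using this.exists_isMaxOn hne hA
  choose m hmA hm using h1
  have hi : ∀ h, ∀ h' ∈ A, w h' - n / 2 * ‖h - h'‖ ^ 2 ≤ w (m h) - n / 2 * ‖h - m h‖ ^ 2 :=
    fun h h' hh' => hm h hh'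
  refine ⟨fun h => w (m h) - n / 2 * ‖h - m h‖ ^ 2, hi, fun h => ⟨m h, hmA h, rfl⟩,
    convex_univ, fun x _ y _ a b ha hb hab => ?_⟩
  set z := a • x + b • y with hz
  have hx := hi x (m z) (hmA z)
  have hy := hi y (m z) (hmA z)
  simp only [smul_eq_mul]
  have e : ∀ t : E, w (m z) - n / 2 * ‖t - m z‖ ^ 2 + n / 2 * ‖t‖ ^ 2
      = w (m z) + n * inner ℝ t (m z) - n / 2 * ‖m z‖ ^ 2 := by
    intro t; rw [norm_sub_sq_real]; ring
  rw [e z]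
  have ez : (inner ℝ z (m z) : ℝ) = a * inner ℝ x (m z) + b * inner ℝ y (m z) := by
    conv_lhs => rw [hz]
    rw [inner_add_left, inner_smul_left, inner_smul_left, ← hz]; simp
  rw [ez]
  have hx' := mul_le_mul_of_nonneg_left (add_le_add_left hx (n / 2 * ‖x‖ ^ 2)) ha
  have hy' := mul_le_mul_of_nonneg_left (add_le_add_left hy (n / 2 * ‖y‖ ^ 2)) hb
  rw [e x] at hx'
  rw [e y] at hy'
  have hb' : b = 1 - a := by linarith
  subst hb'
  linarith

lemma hom2_nonpos {F : Type*} [NormedAddCommGroup F] [NormedSpace ℝ F] {q : F → ℝ}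
    (hq : ∀ (t : ℝ) z, q (t • z) = t ^ 2 * q z) {c : ℝ} 
    (h : ∀ ε, 0 < ε → ∀ᶠ z in 𝓝 (0 : F), q z ≤ c * ε * ‖z‖ ^ 2) (z : F) : q z ≤ 0 := by
  have key : ∀ ε, 0 < ε → q z ≤ c * ε * ‖z‖ ^ 2 := by
    intro ε hε
    have h1 : Tendsto (fun t : ℝ => t • z) (𝓝[>] 0) (𝓝 0) := by
      have : Continuous (fun t : ℝ => t • z) := by fun_prop
      have := this.tendsto 0
      rw [zero_smul] at this
      exact this.mono_left nhdsWithin_le_nhds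
    have h2 := (h1.eventually (h ε hε)).and self_mem_nhdsWithin
    obtain ⟨t, ht, ht0⟩ := h2.exists
    have ht0 : 0 < t := ht0
    rw [hq, norm_smul, mul_pow, Real.norm_eq_abs, sq_abs] at ht
    have : 0 < t ^ 2 := by positivity
    have h3 : t ^ 2 * q z ≤ t ^ 2 * (c * ε * ‖z‖ ^ 2) := by linarith
    exact le_of_mul_le_mul_left h3 this
  refine le_of_forall_pos_le_add fun ε hε => ?_
  have h1 := key (ε / (|c| * ‖z‖ ^ 2 + 1)) (by positivity)
  have h2 : c * (ε / (|c| * ‖z‖ ^ 2 + 1)) * ‖z‖ ^ 2 ≤ ε := by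
    have h3 : c * (ε / (|c| * ‖z‖ ^ 2 + 1)) * ‖z‖ ^ 2 = (c * ‖z‖ ^ 2) * ε / (|c| * ‖z‖ ^ 2 + 1) := by ring
    rw [h3, div_le_iff₀ (by positivity)]
    have := le_abs_self c
    have h4 : c * ‖z‖ ^ 2 ≤ |c| * ‖z‖ ^ 2 := by gcongr
    nlinarith
  linarith

/-- coordinate maps on the L2 product -/
noncomputable def i1 : E →L[ℝ] WithLp 2 (E × E) :=
  ((WithLp.prodContinuousLinearEquiv 2 ℝ E E).symm : (E × E) →L[ℝ] WithLp 2 (E × E)).comp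
    (ContinuousLinearMap.inl ℝ E E)
noncomputable def i2 : E →L[ℝ] WithLp 2 (E × E) :=
  ((WithLp.prodContinuousLinearEquiv 2 ℝ E E).symm : (E × E) →L[ℝ] WithLp 2 (E × E)).comp
    (ContinuousLinearMap.inr ℝ E E)
noncomputable def pr1 : WithLp 2 (E × E) →L[ℝ] E :=
  (ContinuousLinearMap.fst ℝ E E).comp
   ((WithLp.prodContinuousLinearEquiv 2 ℝ E E) : WithLp 2 (E × E) →L[ℝ] (E × E)) 
noncomputable def pr2 : WithLp 2 (E × E) →L[ℝ] E :=
  (ContinuousLinearMap.snd ℝ E E).comp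
   ((WithLp.prodContinuousLinearEquiv 2 ℝ E E) : WithLp 2 (E × E) →L[ℝ] (E × E)) 

@[simp] lemma pr1_i1 (a : E) : pr1 (i1 a) = a := rfl
@[simp] lemma pr2_i2 (a : E) : pr2 (i2 a) = a := rfl
@[simp] lemma pr1_i2 (a : E) : pr1 (i2 a) = (0:E) := rfl
@[simp] lemma pr2_i1 (a : E) : pr2 (i1 a) = (0:E) := rfl
lemma pr_norm (z : WithLp 2 (E × E)) : ‖z‖ ^ 2 = ‖pr1 z‖ ^ 2 + ‖pr2 z‖ ^ 2 :=
  WithLp.prod_norm_sq_eq_of_L2 z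
lemma pr_inner (z w : WithLp 2 (E × E)) :
    (inner ℝ z w : ℝ) = inner ℝ (pr1 z) (pr1 w) + inner ℝ (pr2 z) (pr2 w) :=
  WithLp.prod_inner_apply z w
lemma pr_ext {z w : WithLp 2 (E × E)} (h1 : pr1 z = pr1 w) (h2 : pr2 z = pr2 w) : z = w := by
  have := (WithLp.prodContinuousLinearEquiv 2 ℝ E E).injective
  exact this (Prod.ext h1 h2)
lemma i1_norm (a : E) : ‖i1 a‖ = ‖a‖ := by
  have := pr_norm (i1 a)
  simpa using this
lemma i2_norm (a : E) : ‖i2 a‖ = ‖a‖ := by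
  have := pr_norm (i2 a)
  simpa using this
lemma pr_sum (z : WithLp 2 (E × E)) : i1 (pr1 z) + i2 (pr2 z) = z := by
  apply pr_ext <;> simp [map_add]
lemma pr1_le (z : WithLp 2 (E × E)) : ‖pr1 z‖ ≤ ‖z‖ := by
  have := pr_norm z
  exact (pow_le_pow_iff_left₀ (norm_nonneg _) (norm_nonneg _) two_ne_zero).1 (by nlinarith [sq_nonneg ‖pr2 z‖])
lemma pr2_le (z : WithLp 2 (E × E)) : ‖pr2 z‖ ≤ ‖z‖ := by
  have := pr_norm z
  exact (pow_le_pow_iff_left₀ (norm_nonneg _) (norm_nonneg _) two_ne_zero).1 (by nlinarith [sq_nonneg ‖pr1 z‖])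
lemma pr_le (z : WithLp 2 (E × E)) : ‖z‖ ≤ ‖pr1 z‖ + ‖pr2 z‖ := by
  conv_lhs => rw [← pr_sum z]
  exact (norm_add_le _ _).trans (by rw [i1_norm, i2_norm])
end DL1


section DL2
variable {E : Type*} [NormedAddCommGroup E] [InnerProductSpace ℝ E] [FiniteDimensional ℝ E]

set_option maxHeartbeats 2000000 in
/-- abstract Jensen--Ishii lemma for `a (ζ₁) + c (ζ₂)` -/
lemma jensen_ishii {a c : E → ℝ} {r : ℝ} (hr : 0 < r)
    (ha : UpperSemicontinuousOn a (closedBall 0 r)) (hc : UpperSemicontinuousOn c (closedBall 0 r))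
    (g : WithLp 2 (E × E)) (T : WithLp 2 (E × E) →L[ℝ] WithLp 2 (E × E))
    (hT : ∀ z w, inner ℝ (T z) w = (inner ℝ z (T w) : ℝ)) {η δ : ℝ} (hη : 0 < η) (hδ : 0 < δ)
    (h : ∀ z, ‖pr1 z‖ ≤ r → ‖pr2 z‖ ≤ r → a (pr1 z) + c (pr2 z) ≤ a 0 + c 0 + inner ℝ g z
      + 1 / 2 * inner ℝ (T z) z + η / 2 * ‖z‖ ^ 2) :
    ∃ k' g' : WithLp 2 (E × E), ∃ X Y : E →L[ℝ] E, ‖k'‖ < δ ∧ ‖k'‖ < r ∧ ‖g' - g‖ < δ ∧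
      (∀ ε, 0 < ε → ∀ᶠ ζ in 𝓝 (0:E), a (pr1 k' + ζ) ≤ a (pr1 k') + inner ℝ (pr1 g') ζ
        + 1 / 2 * inner ℝ (X ζ) ζ + ε * ‖ζ‖ ^ 2) ∧
      (∀ ε, 0 < ε → ∀ᶠ ζ in 𝓝 (0:E), c (pr2 k' + ζ) ≤ c (pr2 k') + inner ℝ (pr2 g') ζ
        + 1 / 2 * inner ℝ (Y ζ) ζ + ε * ‖ζ‖ ^ 2) ∧
      ∀ z, inner ℝ (X (pr1 z)) (pr1 z) + inner ℝ (Y (pr2 z)) (pr2 z) ≤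
        (inner ℝ (T z) z + 2 * η * ‖z‖ ^ 2 : ℝ) := by
  classical
  set P : WithLp 2 (E × E) → ℝ := fun z => inner ℝ g z + 1 / 2 * inner ℝ (T z) z + η * ‖z‖ ^ 2 with hP
  have hP0 : P 0 = 0 := by simp [hP]
  have hPexp : ∀ k z, P (k + z) = P k + inner ℝ (g + T k + (2 * η) • k) z
      + 1 / 2 * inner ℝ (T z) z + η * ‖z‖ ^ 2 := by
    intro k z
    simp only [hP, map_add, inner_add_left, inner_add_right, inner_smul_left]
    rw [norm_add_sq_real, hT z k, real_inner_comm z (T k)]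
    simp; ring
  set L := ‖g‖ + (‖T‖ + 2 * η) * (4 * r) with hL
  have hL0 : 0 ≤ L := by positivity
  have hTin : ∀ z w, |(inner ℝ (T z) w : ℝ)| ≤ ‖T‖ * ‖z‖ * ‖w‖ := by
    intro z w
    refine (abs_real_inner_le_norm _ _).trans ?_
    gcongr; exact T.le_opNorm z
  have hPL : ∀ k k', ‖k‖ ≤ 2 * r → ‖k'‖ ≤ 2 * r → P k' - P k ≤ L * ‖k - k'‖ := by
    intro k k' hk hk'
    have e := hPexp k (k' - k)
    rw [add_sub_cancel] at e
    set z := k' - k with hz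
    have hzn : ‖k - k'‖ = ‖z‖ := by rw [hz, norm_sub_rev]
    have hz4 : ‖z‖ ≤ 4 * r := (norm_sub_le _ _).trans (by linarith)
    rw [hzn, e]
    have e1 : (inner ℝ (g + T k + (2 * η) • k) z : ℝ) ≤ (‖g‖ + (‖T‖ + 2 * η) * (2 * r)) * ‖z‖ := by
      refine (real_inner_le_norm _ _).trans ?_
      gcongr
      refine (norm_add_le _ _).trans ?_
      refine (add_le_add_left (norm_add_le _ _) _).trans ?_
      have h1 : ‖T k‖ ≤ ‖T‖ * (2 * r) := (T.le_opNorm k).trans (by gcongr)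
      have h2 : ‖(2 * η) • k‖ ≤ 2 * η * (2 * r) := by
        rw [norm_smul, Real.norm_of_nonneg (by positivity)]; gcongr
      linarith
    have e2 := (abs_le.1 (hTin z z)).2
    have e3 : ‖z‖ * ‖z‖ ≤ 4 * r * ‖z‖ := by gcongr
    have hTn := norm_nonneg T
    rw [hL]
    nlinarith [mul_le_mul_of_nonneg_left e3 hTn, mul_le_mul_of_nonneg_left e3 hη.le]
  set σ := min (r / 3) (δ / (‖T‖ + 3 * η + 2)) with hσ
  have hσ0 : 0 < σ := by positivity
  have hσr : 3 * σ ≤ r := by have := min_le_left (r / 3) (δ / (‖T‖ + 3 * η + 2)); linarith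
  have hσδ : σ * (‖T‖ + 3 * η + 2) ≤ δ := by
    have := min_le_right (r / 3) (δ / (‖T‖ + 3 * η + 2))
    rwa [← hσ, le_div_iff₀ (by positivity)] at this
  set n := η + 1 + 4 * L ^ 2 / (η * σ ^ 2) with hn
  have hn0 : 0 < n - η := by rw [hn]; have : 0 ≤ 4 * L ^ 2 / (η * σ ^ 2) := by positivity
                             linarith
  have hnL : 4 * L ^ 2 ≤ (n - η) * (η * σ ^ 2) := by
    have : (n - η) * (η * σ ^ 2) = η * σ ^ 2 + 4 * L ^ 2 := by rw [hn]; field_simp; ring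
    rw [this]; have : 0 ≤ η * σ ^ 2 := by positivity
    linarith
  have hne : (closedBall (0:E) r).Nonempty := ⟨0, by simp [hr.le]⟩
  obtain ⟨an, han1, han2, han3⟩ := supconv (isCompact_closedBall (0:E) r) hne ha n
  obtain ⟨cn, hcn1, hcn2, hcn3⟩ := supconv (isCompact_closedBall (0:E) r) hne hc n
  set f : WithLp 2 (E × E) → ℝ := fun z => an (pr1 z) + cn (pr2 z) - P z with hf
  have hf0 : a 0 + c 0 ≤ f 0 := by
    have h1 := han1 0 0 (by simp [hr.le])
    have h2 := hcn1 0 0 (by simp [hr.le])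
    simp only [hf, hP0, map_zero]
    simp at h1 h2
    linarith
  -- maximizers
  have hmx : ∀ z : WithLp 2 (E × E), ‖z‖ ≤ r → ∃ z' : WithLp 2 (E × E), ‖pr1 z'‖ ≤ r ∧ ‖pr2 z'‖ ≤ r ∧
      an (pr1 z) = a (pr1 z') - n / 2 * ‖pr1 z - pr1 z'‖ ^ 2 ∧
      cn (pr2 z) = c (pr2 z') - n / 2 * ‖pr2 z - pr2 z'‖ ^ 2 ∧
      f z - f 0 ≤ L * ‖z - z'‖ - n / 2 * ‖z - z'‖ ^ 2 - η / 2 * ‖z'‖ ^ 2 := by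
    intro z hz
    obtain ⟨h1, hh1, he1⟩ := han2 (pr1 z)
    obtain ⟨h2, hh2, he2⟩ := hcn2 (pr2 z)
    rw [mem_closedBall_zero_iff] at hh1 hh2
    refine ⟨i1 h1 + i2 h2, by simpa using hh1, by simpa using hh2, by simpa using he1, by simpa using he2, ?_⟩
    set z' := i1 h1 + i2 h2 with hz'
    have p1 : pr1 z' = h1 := by simp [hz']
    have p2 : pr2 z' = h2 := by simp [hz']
    have hz'n : ‖z'‖ ≤ 2 * r := (pr_le z').trans (by rw [p1, p2]; linarith)
    have h3 := h z' (by rw [p1]; exact hh1) (by rw [p2]; exact hh2)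
    have h4 := hPL z z' (by linarith) hz'n
    have h5 := pr_norm (z - z')
    rw [map_sub, map_sub, p1, p2] at h5
    rw [p1, p2] at h3
    rw [h5]
    have h6 : P z' = inner ℝ g z' + 1 / 2 * inner ℝ (T z') z' + η * ‖z'‖ ^ 2 := rfl
    have h7 : f z = an (pr1 z) + cn (pr2 z) - P z := rfl
    rw [h7, he1, he2]
    linarith
  have hconv : ConvexOn ℝ univ (fun z => f z + (n + 2 * η + ‖T‖) / 2 * ‖z‖ ^ 2) := by
    have c1 : ConvexOn ℝ univ (fun z : WithLp 2 (E × E) => an (pr1 z) + n / 2 * ‖pr1 z‖ ^ 2) :=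
      han3.comp_linearMap (pr1 : WithLp 2 (E × E) →L[ℝ] E).toLinearMap
    have c2 : ConvexOn ℝ univ (fun z : WithLp 2 (E × E) => cn (pr2 z) + n / 2 * ‖pr2 z‖ ^ 2) :=
      hcn3.comp_linearMap (pr2 : WithLp 2 (E × E) →L[ℝ] E).toLinearMap
    have c3 := quad_convex ((1 / 2 : ℝ) • (‖T‖ • ContinuousLinearMap.id ℝ (WithLp 2 (E × E)) - T)) (by
      intro z
      have := (abs_le.1 (hTin z z)).2
      simp only [_root_.smul_apply, _root_.sub_apply, inner_smul_left, inner_sub_left,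
        ContinuousLinearMap.id_apply, real_inner_self_eq_norm_sq]
      simp only [conj_trivial]
      nlinarith)
    have c4 : ConvexOn ℝ univ (fun z : WithLp 2 (E × E) => (inner ℝ (-g) z : ℝ)) :=
      ((innerSL ℝ (-g)).toLinearMap).convexOn convex_univ
    have := ((c1.add c2).add c3).add c4
    refine this.congr ?_
    intro z _
    simp only [Pi.add_apply, hf, hP]
    have := pr_norm z
    simp only [_root_.smul_apply, _root_.sub_apply, inner_smul_left, inner_sub_left,
        ContinuousLinearMap.id_apply, real_inner_self_eq_norm_sq, inner_neg_left]
    simp only [conj_trivial]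
    rw [this]
    ring
  have hAG : ∀ t : ℝ, L * t - (n - η) / 2 * t ^ 2 ≤ η * σ ^ 2 / 8 := by
    intro t
    have h1 : (n - η) * (L * t - (n - η) / 2 * t ^ 2) ≤ (n - η) * (η * σ ^ 2 / 8) := by
      nlinarith [sq_nonneg (L - (n - η) * t)]
    exact le_of_mul_le_mul_left h1 hn0
  have hdrop : ∀ z, σ ≤ ‖z‖ → ‖z‖ ≤ r → f z ≤ f 0 - η * σ ^ 2 / 8 := by
    intro z hz1 hz2
    obtain ⟨z', -, -, -, -, h5⟩ := hmx z hz2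
    have h6 : ‖z‖ ≤ ‖z - z'‖ + ‖z'‖ := by
      have : z = (z - z') + z' := by abel
      conv_lhs => rw [this]
      exact norm_add_le _ _
    have h7 : σ ^ 2 ≤ 2 * ‖z - z'‖ ^ 2 + 2 * ‖z'‖ ^ 2 := by
      have : σ ^ 2 ≤ (‖z - z'‖ + ‖z'‖) ^ 2 := by
        apply pow_le_pow_left₀ hσ0.le; linarith
      nlinarith [sq_nonneg (‖z - z'‖ - ‖z'‖)]
    have h8 := hAG ‖z - z'‖
    have h9 := mul_le_mul_of_nonneg_left h7 hη.le
    linarith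
  letI : MeasurableSpace (WithLp 2 (E × E)) := borel _
  haveI : BorelSpace (WithLp 2 (E × E)) := ⟨rfl⟩
  obtain ⟨k, s, D, hkσ, hsτ, htouch, hexp⟩ := jensen_alex (f := f) (C := n + 2 * η + ‖T‖)
    (by have := norm_nonneg T; linarith) hconv hσ0 hσr (μ₀ := η * σ ^ 2 / 8) (τ := η * σ / 16)
    (by positivity) (by positivity) hdrop
  obtain ⟨k', hk1, hk2, hka, hkc, hk5⟩ := hmx k (by linarith)
  have hk'σ : ‖k'‖ ≤ σ := by
    have h1 := htouch 0 (by simp [hr.le])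
    rw [zero_sub, inner_neg_right] at h1
    have h2 := (abs_le.1 ((abs_real_inner_le_norm s k))).1
    have h3 : ‖s‖ * ‖k‖ ≤ η * σ / 16 * σ := by gcongr
    have h4 := hAG ‖k - k'‖
    have h50 : 0 ≤ η / 2 * ‖k - k'‖ ^ 2 := by positivity
    have h51 : 0 ≤ η * σ ^ 2 := by positivity
    have h5 : η * ‖k'‖ ^ 2 ≤ η * σ ^ 2 := by
      have h52 : η * σ / 16 * σ = η * σ ^ 2 / 16 := by ring
      linarith
    have h6 := le_of_mul_le_mul_left h5 hη
    exact (pow_le_pow_iff_left₀ (norm_nonneg _) hσ0.le two_ne_zero).1 h6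
  have hk'r : ‖k'‖ < r := by linarith
  set M := D + T + (2 * η) • ContinuousLinearMap.id ℝ (WithLp 2 (E × E)) with hM
  set g' := s + (g + T k + (2 * η) • k) with hg'
  have hMq : ∀ z, (inner ℝ (M z) z : ℝ) = inner ℝ (D z) z + inner ℝ (T z) z + 2 * η * ‖z‖ ^ 2 := by
    intro z
    simp [hM, inner_add_left, inner_smul_left]
  have hW : ∀ ε, 0 < ε → ∀ᶠ ζ in 𝓝 (0 : WithLp 2 (E × E)),
      |an (pr1 (k + ζ)) + cn (pr2 (k + ζ)) - an (pr1 k) - cn (pr2 k) - inner ℝ g' ζ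
        - 1 / 2 * inner ℝ (M ζ) ζ| ≤ ε * ‖ζ‖ ^ 2 := by
    intro ε hε
    filter_upwards [hexp ε hε] with ζ hζ
    have e := hPexp k ζ
    have : an (pr1 (k + ζ)) + cn (pr2 (k + ζ)) - an (pr1 k) - cn (pr2 k) - inner ℝ g' ζ
        - 1 / 2 * inner ℝ (M ζ) ζ = f (k + ζ) - f k - inner ℝ s ζ - 1 / 2 * inner ℝ (D ζ) ζ := by
      simp only [hf, hMq, hg']
      rw [e, inner_add_left s]
      ring
    rw [this]; exact hζ
  have ti1 : Tendsto (fun ζ : E => (i1 ζ : WithLp 2 (E × E))) (𝓝 0) (𝓝 0) := by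
    have := (i1 (E := E)).continuous.tendsto 0
    rwa [map_zero] at this
  have ti2 : Tendsto (fun ζ : E => (i2 ζ : WithLp 2 (E × E))) (𝓝 0) (𝓝 0) := by
    have := (i2 (E := E)).continuous.tendsto 0
    rwa [map_zero] at this
  have tp1 : Tendsto (fun ζ : WithLp 2 (E × E) => (pr1 ζ : E)) (𝓝 0) (𝓝 0) := by
    have := (pr1 (E := E)).continuous.tendsto 0
    rwa [map_zero] at this
  have tp2 : Tendsto (fun ζ : WithLp 2 (E × E) => (pr2 ζ : E)) (𝓝 0) (𝓝 0) := by
    have := (pr2 (E := E)).continuous.tendsto 0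
    rwa [map_zero] at this
  have hA : ∀ ε, 0 < ε → ∀ᶠ ζ in 𝓝 (0:E),
      |an (pr1 k + ζ) - an (pr1 k) - inner ℝ (pr1 g') ζ - 1 / 2 * inner ℝ (M (i1 ζ)) (i1 ζ)| ≤ ε * ‖ζ‖ ^ 2 := by
    intro ε hε
    filter_upwards [ti1.eventually (hW ε hε)] with ζ hζ
    rw [i1_norm, map_add, map_add, pr_inner g'] at hζ
    simp only [pr1_i1, pr2_i1, add_zero, inner_zero_right] at hζ
    convert hζ using 2
    ring
  have hCc : ∀ ε, 0 < ε → ∀ᶠ ζ in 𝓝 (0:E),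
      |cn (pr2 k + ζ) - cn (pr2 k) - inner ℝ (pr2 g') ζ - 1 / 2 * inner ℝ (M (i2 ζ)) (i2 ζ)| ≤ ε * ‖ζ‖ ^ 2 := by
    intro ε hε
    filter_upwards [ti2.eventually (hW ε hε)] with ζ hζ
    rw [i2_norm, map_add, map_add, pr_inner g'] at hζ
    simp only [pr1_i2, pr2_i2, add_zero, zero_add, inner_zero_right] at hζ
    convert hζ using 2
    ring
  refine ⟨k', g', (ContinuousLinearMap.adjoint i1).comp (M.comp i1),
    (ContinuousLinearMap.adjoint i2).comp (M.comp i2), ?_, hk'r, ?_, ?_, ?_, ?_⟩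
  · have := norm_nonneg T
    nlinarith
  · have e : g' - g = s + T k + (2 * η) • k := by rw [hg']; abel
    rw [e]
    have h1 : ‖T k‖ ≤ ‖T‖ * σ := (T.le_opNorm k).trans (by gcongr)
    have h2 : ‖(2 * η) • k‖ ≤ 2 * η * σ := by
      rw [norm_smul, Real.norm_of_nonneg (by positivity)]; gcongr
    refine ((norm_add_le _ _).trans (add_le_add_left (norm_add_le _ _) _)).trans_lt ?_
    nlinarith [mul_pos hη hσ0]
  · intro ε hε
    have hin : ∀ᶠ ζ in 𝓝 (0:E), ‖pr1 k' + ζ‖ ≤ r := by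
      have hc : Continuous (fun ζ : E => ‖pr1 k' + ζ‖) := by fun_prop
      have := hc.tendsto 0
      simp only [add_zero] at this
      exact (this.eventually (gt_mem_nhds (lt_of_le_of_lt (pr1_le k') hk'r))).mono fun _ h => h.le
    filter_upwards [hA ε hε, hin] with ζ h1 h2
    have h3 := han1 (pr1 k + ζ) (pr1 k' + ζ) (by simpa using h2)
    rw [add_sub_add_right_eq_sub] at h3
    have h4 := (abs_le.1 h1).2
    simp only [ContinuousLinearMap.comp_apply, ContinuousLinearMap.adjoint_inner_left]
    linarith
  · intro ε hε
    have hin : ∀ᶠ ζ in 𝓝 (0:E), ‖pr2 k' + ζ‖ ≤ r := by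
      have hc : Continuous (fun ζ : E => ‖pr2 k' + ζ‖) := by fun_prop
      have := hc.tendsto 0
      simp only [add_zero] at this
      exact (this.eventually (gt_mem_nhds (lt_of_le_of_lt (pr2_le k') hk'r))).mono fun _ h => h.le
    filter_upwards [hCc ε hε, hin] with ζ h1 h2
    have h3 := hcn1 (pr2 k + ζ) (pr2 k' + ζ) (by simpa using h2)
    rw [add_sub_add_right_eq_sub] at h3
    have h4 := (abs_le.1 h1).2
    simp only [ContinuousLinearMap.comp_apply, ContinuousLinearMap.adjoint_inner_left]
    linarith
  · intro z
    simp only [ContinuousLinearMap.comp_apply, ContinuousLinearMap.adjoint_inner_left]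
    have := hom2_nonpos (c := 2) (q := fun z : WithLp 2 (E × E) => (inner ℝ (M (i1 (pr1 z))) (i1 (pr1 z))
      + inner ℝ (M (i2 (pr2 z))) (i2 (pr2 z)) - (inner ℝ (T z) z + 2 * η * ‖z‖ ^ 2) : ℝ)) (by
        intro t z
        simp only [map_smul, inner_smul_left, inner_smul_right, norm_smul, mul_pow, Real.norm_eq_abs, sq_abs]
        simp; ring) (by
        intro ε hε
        have hin : ∀ᶠ ζ in 𝓝 (0:WithLp 2 (E × E)), ‖k + ζ‖ ≤ r := by
          have hc : Continuous (fun ζ : WithLp 2 (E × E) => ‖k + ζ‖) := by fun_prop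
          have := hc.tendsto 0
          simp only [add_zero] at this
          exact (this.eventually (gt_mem_nhds (show ‖k‖ < r by linarith))).mono fun _ h => h.le
        filter_upwards [tp1.eventually (hA ε hε), tp2.eventually (hCc ε hε), hin] with z h1 h2 h3
        have h4 := htouch (k + z) h3
        have h5 := hPexp k z
        have h6 := pr_norm z
        have h7 := (abs_le.1 h1).1
        have h8 := (abs_le.1 h2).1
        rw [add_sub_cancel_left] at h4
        have h9 : f (k + z) = an (pr1 k + pr1 z) + cn (pr2 k + pr2 z) - P (k + z) := by
          simp only [hf, map_add]
        have h10 : f k = an (pr1 k) + cn (pr2 k) - P k := rfl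
        have h11 := pr_inner g' z
        have h12 : (inner ℝ g' z : ℝ) = inner ℝ s z + inner ℝ (g + T k + (2 * η) • k) z := by
          rw [hg', inner_add_left]
        rw [h6] at h5 ⊢
        linarith) z
    linarith
end DL2


section DL3
variable {N : ℕ}
local notation "EE" => EuclideanSpace ℝ (Fin N)

/-- model quadratic form -/
noncomputable def Bq {F : Type*} [NormedAddCommGroup F] [InnerProductSpace ℝ F]
    (α β α' β' : ℝ) (e f h l : F) : ℝ :=
  α * ‖h - l‖ ^ 2 + β * (inner ℝ e (h - l)) ^ 2 + α' * ‖h + l‖ ^ 2 + β' * (inner ℝ f (h + l)) ^ 2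

/-- pair of functions satisfying the doubled inequality -/
structure Good (U : Set EE) (v u : EE → ℝ) (Λ H₀ : ℝ) : Prop where
  usc : UpperSemicontinuousOn v U
  lsc : LowerSemicontinuousOn u U
  le : ∀ x ∈ U, v x ≤ u x
  key : ∀ x ∈ U, ∀ y ∈ U, ∀ (p q e f : EE) (α β α' β' : ℝ) (b b' : OrthonormalBasis (Fin N) ℝ EE),
    (∀ η, 0 < η → ∀ᶠ d in 𝓝 (0 : EE × EE), v (x + d.1) - u (y + d.2) ≤ v x - u y
      + inner ℝ p d.1 - inner ℝ q d.2 + 1 / 2 * Bq α β α' β' e f d.1 d.2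
      + η * (‖d.1‖ ^ 2 + ‖d.2‖ ^ 2)) →
    -(Λ * ‖x - y‖ * sq1 q + H₀ * ‖p - q‖) ≤ ∑ i, Bq α β α' β' e f (Sop p (b i)) (Sop q (b' i))

lemma Bq_op {F : Type*} [NormedAddCommGroup F] [InnerProductSpace ℝ F] [FiniteDimensional ℝ F]
    (α β α' β' : ℝ) (e f : F) : ∃ T : WithLp 2 (F × F) →L[ℝ] WithLp 2 (F × F),
    (∀ z w, inner ℝ (T z) w = (inner ℝ z (T w) : ℝ)) ∧
    ∀ z, (inner ℝ (T z) z : ℝ) = Bq α β α' β' e f (pr1 z) (pr2 z) := by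
  have hq : ∀ {G : Type _} [NormedAddCommGroup G] [InnerProductSpace ℝ G] [CompleteSpace G]
      (A : WithLp 2 (F × F) →L[ℝ] G) (z : WithLp 2 (F × F)),
      (inner ℝ (((ContinuousLinearMap.adjoint A).comp A) z) z : ℝ) = ‖A z‖ ^ 2 := by
    intro G _ _ _ A z
    simp [ContinuousLinearMap.adjoint_inner_left]
  have hq' : ∀ (A : WithLp 2 (F × F) →L[ℝ] ℝ) (z : WithLp 2 (F × F)),
      (inner ℝ (((ContinuousLinearMap.adjoint A).comp A) z) z : ℝ) = (A z) ^ 2 := by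
    intro A z
    simp [ContinuousLinearMap.adjoint_inner_left]
  set A1 : WithLp 2 (F × F) →L[ℝ] F := pr1 - pr2
  set A2 : WithLp 2 (F × F) →L[ℝ] F := pr1 + pr2
  set B1 : WithLp 2 (F × F) →L[ℝ] ℝ := (innerSL ℝ e).comp A1
  set B2 : WithLp 2 (F × F) →L[ℝ] ℝ := (innerSL ℝ f).comp A2
  obtain ⟨T, hT1, hT2⟩ := quad_symm (α • (ContinuousLinearMap.adjoint A1).comp A1
    + β • (ContinuousLinearMap.adjoint B1).comp B1 + α' • (ContinuousLinearMap.adjoint A2).comp A2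
    + β' • (ContinuousLinearMap.adjoint B2).comp B2)
  refine ⟨T, hT1, fun z => ?_⟩
  rw [hT2]
  simp only [_root_.add_apply, _root_.smul_apply, inner_add_left, inner_smul_left]
  rw [hq, hq, hq', hq']
  simp [Bq, A1, A2, B1, B2, inner_sub_right, inner_add_right]

lemma sq1_lip {F : Type*} [NormedAddCommGroup F] [InnerProductSpace ℝ F] (p q : F) :
    |sq1 p - sq1 q| ≤ ‖p - q‖ := by
  have h1 := sq1_sq p
  have h2 := sq1_sq q
  have h3 := sq1_ge p
  have h4 := sq1_ge q
  have h5 : ‖p‖ ≤ sq1 p := by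
    apply le_of_sq_le_sq _ (by linarith); linarith
  have h6 : ‖q‖ ≤ sq1 q := by
    apply le_of_sq_le_sq _ (by linarith); linarith
  have h7 : (sq1 p - sq1 q) * (sq1 p + sq1 q) = (‖p‖ - ‖q‖) * (‖p‖ + ‖q‖) := by nlinarith
  have h8 : |‖p‖ - ‖q‖| ≤ ‖p - q‖ := abs_norm_sub_norm_le p q
  have h9 : |sq1 p - sq1 q| * (sq1 p + sq1 q) ≤ ‖p - q‖ * (sq1 p + sq1 q) := by
    have : |sq1 p - sq1 q| * (sq1 p + sq1 q) = |‖p‖ - ‖q‖| * (‖p‖ + ‖q‖) := by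
      rw [← abs_of_nonneg (show 0 ≤ sq1 p + sq1 q by linarith), ← abs_mul, h7, abs_mul,
        abs_of_nonneg (show 0 ≤ ‖p‖ + ‖q‖ by positivity)]
    rw [this]
    exact mul_le_mul h8 (by linarith) (by positivity) (by positivity)
  exact le_of_mul_le_mul_right h9 (by linarith)

lemma Sop_cont (h : EE) : Continuous (fun p : EE => Sop p h) := by
  unfold Sop
  have h0 : Continuous (sq1 : EE → ℝ) := sq1_cont
  have : ∀ p : EE, sq1 p * (sq1 p + 1) ≠ 0 := fun p => by have := sq1_pos p; positivity
  fun_prop (disch := assumption)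

set_option maxHeartbeats 800000 in
lemma good_of_visc {Ω U : Set EE} {H u v : EE → ℝ} {Λ H₀ : ℝ} (hU : IsOpen U) (hUΩ : U ⊆ Ω)
    (hu_lsc : LowerSemicontinuousOn u Ω) (hu : IsViscositySupersol Ω H u)
    (hv_usc : UpperSemicontinuousOn v Ω) (hv : IsViscositySubsol Ω H v)
    (huv : ∀ x ∈ Ω, v x ≤ u x) (hΛ : 0 ≤ Λ)
    (hH0 : ∀ x ∈ U, |N * H x| ≤ H₀) (hHL : ∀ x ∈ U, ∀ y ∈ U, |N * H x - N * H y| ≤ Λ * ‖x - y‖) :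
    Good U v u Λ H₀ := by
  refine ⟨hv_usc.mono hUΩ, hu_lsc.mono hUΩ, fun x hx => huv x (hUΩ hx), ?_⟩
  intro x hx y hy p q e f α β α' β' b b' hev
  obtain ⟨T, hT1, hT2⟩ := Bq_op α β α' β' e f
  have hmain : ∀ η, 0 < η → 0 ≤ ∑ i, Bq α β α' β' e f (Sop p (b i)) (Sop q (b' i)) + 4 * η * N
      + (Λ * ‖x - y‖ * sq1 q + H₀ * ‖p - q‖) := by
    intro η hη
    -- small radius
    obtain ⟨r1, hr1, hr1'⟩ := Metric.eventually_nhds_iff_ball.1 (hev (η / 2) (by positivity))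
    obtain ⟨r2, hr2, hr2'⟩ := Metric.isOpen_iff.1 hU x hx
    obtain ⟨r3, hr3, hr3'⟩ := Metric.isOpen_iff.1 hU y hy
    set r := min r1 (min r2 r3) / 2 with hr
    have hr0 : 0 < r := by positivity
    have hrr : r < r1 ∧ r < r2 ∧ r < r3 := by
      have a1 := min_le_left r1 (min r2 r3)
      have a2 := min_le_right r1 (min r2 r3)
      have a3 := min_le_left r2 r3
      have a4 := min_le_right r2 r3
      refine ⟨?_, ?_, ?_⟩ <;> linarith
    have hxm : ∀ h : EE, ‖h‖ ≤ r → x + h ∈ U := fun h hh => hr2' (by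
      rw [mem_ball, dist_eq_norm, add_sub_cancel_left]; linarith)
    have hym : ∀ h : EE, ‖h‖ ≤ r → y + h ∈ U := fun h hh => hr3' (by
      rw [mem_ball, dist_eq_norm, add_sub_cancel_left]; linarith)
    have ha : UpperSemicontinuousOn (fun h => v (x + h)) (closedBall 0 r) := by
      apply UpperSemicontinuousOn.comp (hv_usc.mono hUΩ) (by fun_prop : Continuous fun h => x + h).continuousOn
      intro h hh; exact hxm h (by simpa using hh)
    have hc : UpperSemicontinuousOn (fun h => - u (y + h)) (closedBall 0 r) := by
      have : LowerSemicontinuousOn (fun h => u (y + h)) (closedBall 0 r) := by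
        apply LowerSemicontinuousOn.comp (hu_lsc.mono hUΩ) (by fun_prop : Continuous fun h => y + h).continuousOn
        intro h hh; exact hym h (by simpa using hh)
      intro h hh c hc
      filter_upwards [this h hh (-c) (by simp at hc ⊢; linarith)] with z hz
      simp at hz ⊢; linarith
    set g : WithLp 2 (EE × EE) := i1 p - i2 q with hg
    set Φ : WithLp 2 (EE × EE) × WithLp 2 (EE × EE) → ℝ := fun w =>
      ∑ i, (Bq α β α' β' e f (Sop (pr1 w.2) (b i)) (Sop (- pr2 w.2) (b' i))) + 4 * η * N
      + (Λ * ‖(x + pr1 w.1) - (y + pr2 w.1)‖ * sq1 (- pr2 w.2) + H₀ * ‖pr1 w.2 - - pr2 w.2‖) with hΦ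
    have hΦc : Continuous Φ := by
      have h0 : Continuous (sq1 : EE → ℝ) := sq1_cont
      have h1 := fun i => Sop_cont (b i)
      have h2 := fun i => Sop_cont (b' i)
      have h3 : Continuous (fun w : WithLp 2 (EE × EE) × WithLp 2 (EE × EE) => pr1 w.2) := by fun_prop
      have h4 : Continuous (fun w : WithLp 2 (EE × EE) × WithLp 2 (EE × EE) => - pr2 w.2) := by fun_prop
      have h5 := fun i => (h1 i).comp h3
      have h6 := fun i => (h2 i).comp h4
      have h7 := h0.comp h4
      simp only [Function.comp_def] at h5 h6 h7
      simp only [hΦ, Bq]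
      fun_prop
    have hcl : (0, g) ∈ closure {w | 0 ≤ Φ w} := by
      rw [Metric.mem_closure_iff]
      intro δ hδ
      obtain ⟨k', g', X, Y, hk1, hk2, hg1, hX, hY, hXY⟩ := jensen_ishii hr0 ha hc g T hT1 hη hδ (by
        intro z hz1 hz2
        have := hr1' (pr1 z, pr2 z) (by
          simp only [mem_ball, dist_zero_right, Prod.norm_def]
          exact max_lt (by linarith) (by linarith))
        simp only at this
        rw [← hT2, ← pr_norm] at this
        have e1 : (inner ℝ g z : ℝ) = inner ℝ p (pr1 z) - inner ℝ q (pr2 z) := by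
          rw [pr_inner, hg]; simp [inner_neg_left, sub_eq_add_neg]
        simp only [add_zero]
        rw [e1]; linarith)
      refine ⟨(k', g'), ?_, ?_⟩
      · have hx' := hxm (pr1 k') ((pr1_le k').trans hk2.le)
        have hy' := hym (pr2 k') ((pr2_le k').trans hk2.le)
        set x' := x + pr1 k' with hx'd
        set y' := y + pr2 k' with hy'd
        have s1 := visc_sub hv b (hUΩ hx') X (p := pr1 g') (fun ε hε => by
          filter_upwards [hX ε hε] with ζ hζ
          rw [hx'd, add_assoc]; exact hζ)
        have s2 := visc_super hu b' (hUΩ hy') Y (q := - pr2 g') (fun ε hε => by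
          filter_upwards [hY ε hε] with ζ hζ
          rw [hy'd, add_assoc, inner_neg_left, sub_neg_eq_add]; exact hζ)
        set p' := pr1 g'
        set q' := - pr2 g'
        have s3 : ∑ i, (inner ℝ (X (Sop p' (b i))) (Sop p' (b i)) : ℝ)
            + ∑ i, (inner ℝ (Y (Sop q' (b' i))) (Sop q' (b' i)) : ℝ) ≤
            ∑ i, (Bq α β α' β' e f (Sop p' (b i)) (Sop q' (b' i))) + 4 * η * N := by
          rw [← Finset.sum_add_distrib]
          have : (4 * η * N : ℝ) = ∑ i : Fin N, 4 * η := by simp; ring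
          rw [this, ← Finset.sum_add_distrib]
          apply Finset.sum_le_sum
          intro i _
          have := hXY (i1 (Sop p' (b i)) + i2 (Sop q' (b' i)))
          rw [hT2, pr_norm] at this
          simp only [map_add, pr1_i1, pr1_i2, pr2_i1, pr2_i2, add_zero, zero_add] at this
          have n1 := Sop_norm_sq_add p' (b i)
          have n2 := Sop_norm_sq_add q' (b' i)
          rw [b.norm_eq_one] at n1
          rw [b'.norm_eq_one] at n2
          nlinarith
        have s4 := (abs_le.1 (hHL x' hx' y' hy')).1
        have s5 := (abs_le.1 (hH0 x' hx'))
        have s6 := abs_le.1 (sq1_lip p' q')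
        have s7 := sq1_pos q'
        have s8 : -(H₀ * ‖p' - q'‖) ≤ (sq1 p' - sq1 q') * (N * H x') := by
          have : |(sq1 p' - sq1 q') * (N * H x')| ≤ ‖p' - q'‖ * H₀ := by
            rw [abs_mul]
            exact mul_le_mul (sq1_lip p' q') (hH0 x' hx') (abs_nonneg _) (norm_nonneg _)
          have := (abs_le.1 this).1
          linarith
        have s9 := mul_le_mul_of_nonneg_left s4 s7.le
        simp only [hΦ, mem_ofPred_eq]
        linarith
      · rw [dist_comm, dist_eq_norm, Prod.norm_def]
        simp only [Prod.fst_sub, Prod.snd_sub, sub_zero]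
        exact max_lt hk1 hg1
    have hcl2 : IsClosed {w | 0 ≤ Φ w} := isClosed_le continuous_const hΦc
    have := hcl2.closure_eq ▸ hcl
    simpa [hΦ, hg, sub_eq_add_neg] using this
  have : ∀ ε, 0 < ε → -(Λ * ‖x - y‖ * sq1 q + H₀ * ‖p - q‖) ≤
      ∑ i, Bq α β α' β' e f (Sop p (b i)) (Sop q (b' i)) + ε := by
    intro ε hε
    have := hmain (ε / (4 * (N + 1))) (by positivity)
    have h2 : 4 * (ε / (4 * (N + 1))) * N ≤ ε := by
      have : (4 * (ε / (4 * (N + 1))) * N : ℝ) = ε * (N / (N + 1)) := by field_simp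
      rw [this]
      have : (N / (N + 1) : ℝ) ≤ 1 := by rw [div_le_one (by positivity)]; linarith
      nlinarith
    linarith
  exact le_of_forall_pos_le_add this
end DL3


section SG
variable {F : Type*} [NormedAddCommGroup F] [InnerProductSpace ℝ F]

lemma Sop_symm (p h l : F) : (inner ℝ (Sop p h) l : ℝ) = inner ℝ h (Sop p l) := by
  unfold Sop
  rw [inner_sub_left, inner_sub_right, inner_smul_left, inner_smul_right, real_inner_comm h p]
  simp; ring

lemma Sop_sub (p h l : F) : Sop p (h - l) = Sop p h - Sop p l := by
  unfold Sop
  rw [inner_sub_right, sub_div, sub_smul]; abel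

lemma Sop_smul (p h : F) (c : ℝ) : Sop p (c • h) = c • Sop p h := by
  unfold Sop
  rw [inner_smul_right, smul_sub, smul_smul, mul_div_assoc]

lemma norm_le_sq1 (p : F) : ‖p‖ ≤ sq1 p := by
  have h1 := sq1_sq p
  apply le_of_sq_le_sq _ (sq1_pos p).le; linarith

lemma Sop_lower (p h : F) : ‖h‖ ^ 2 / sq1 p ≤ inner ℝ (Sop p h) h := by
  have hp := sq1_pos p
  unfold Sop
  rw [inner_sub_left, inner_smul_left, real_inner_self_eq_norm_sq]
  have h1 := sq1_sq p
  have h2 : (inner ℝ p h : ℝ) ^ 2 ≤ (sq1 p ^ 2 - 1) * ‖h‖ ^ 2 := by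
    have := sq_le_sq' (by have := (abs_le.1 (abs_real_inner_le_norm p h)).1; linarith)
      (real_inner_le_norm p h)
    rw [mul_pow] at this
    rw [h1]; linarith
  have h3 : (inner ℝ p h / (sq1 p * (sq1 p + 1)) * inner ℝ p h : ℝ) ≤ (sq1 p - 1) / sq1 p * ‖h‖ ^ 2 := by
    rw [div_mul_eq_mul_div, div_le_iff₀ (by positivity)]
    have : (sq1 p - 1) / sq1 p * ‖h‖ ^ 2 * (sq1 p * (sq1 p + 1)) = (sq1 p ^ 2 - 1) * ‖h‖ ^ 2 := by
      field_simp; ring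
    rw [this]; linarith
  have h4 : (sq1 p - 1) / sq1 p * ‖h‖ ^ 2 = ‖h‖ ^ 2 - ‖h‖ ^ 2 / sq1 p := by field_simp
  simp only [conj_trivial]
  linarith

lemma Sop_inv (q e : F) (he : ‖e‖ = 1) : ∃ n : F, ∃ τ : ℝ, ‖n‖ = 1 ∧ 0 < τ ∧ τ ≤ sq1 q ∧
    Sop q n = τ⁻¹ • e := by
  have hq := sq1_pos q
  have h1 := sq1_sq q
  set c : ℝ := inner ℝ q e with hc
  set n0 : F := e + (c / (sq1 q + 1)) • q with hn0
  have hS : Sop q n0 = e := by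
    unfold Sop
    rw [hn0, inner_add_right, inner_smul_right, real_inner_self_eq_norm_sq, ← hc]
    have : (c + c / (sq1 q + 1) * ‖q‖ ^ 2) / (sq1 q * (sq1 q + 1)) = c / (sq1 q + 1) := by
      have : ‖q‖ ^ 2 = sq1 q ^ 2 - 1 := by linarith
      rw [this]; field_simp; ring
    rw [this]; abel
  have hn : ‖n0‖ ^ 2 = 1 + c ^ 2 := by
    rw [hn0, norm_add_sq_real, he, inner_smul_right, norm_smul, mul_pow, Real.norm_eq_abs, sq_abs,
      real_inner_comm, ← hc]
    have : ‖q‖ ^ 2 = sq1 q ^ 2 - 1 := by linarith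
    rw [this]; field_simp; ring
  have hn1 : 0 < ‖n0‖ := by
    rcases (norm_nonneg n0).lt_or_eq with h | h
    · exact h
    · rw [← h] at hn; nlinarith [sq_nonneg c]
  refine ⟨‖n0‖⁻¹ • n0, ‖n0‖, ?_, hn1, ?_, ?_⟩
  · rw [norm_smul, norm_inv, norm_norm, inv_mul_cancel₀ hn1.ne']
  · apply le_of_sq_le_sq _ hq.le
    have h3 : |c| ≤ ‖q‖ := by have := abs_real_inner_le_norm q e; rwa [he, mul_one] at this
    have : c ^ 2 ≤ ‖q‖ ^ 2 := sq_le_sq' (by linarith [(abs_le.1 h3).1]) (abs_le.1 h3).2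
    rw [hn, h1]; linarith
  · rw [Sop_smul, hS]

lemma Sop_diff (p q h : F) : ‖Sop p h - Sop q h‖ ≤ 5 * ‖p - q‖ / sq1 q * ‖h‖ := by
  set s := sq1 p with hs
  set t := sq1 q with ht
  have hs1 := sq1_ge p
  have ht1 := sq1_ge q
  rw [← hs] at hs1
  rw [← ht] at ht1
  set φ := Real.sqrt (s * (s + 1)) with hφ
  set χ := Real.sqrt (t * (t + 1)) with hχ
  have hφ2 : φ ^ 2 = s * (s + 1) := Real.sq_sqrt (by nlinarith)
  have hχ2 : χ ^ 2 = t * (t + 1) := Real.sq_sqrt (by nlinarith)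
  have hφs : s ≤ φ := Real.le_sqrt_of_sq_le (by nlinarith)
  have hχt : t ≤ χ := Real.le_sqrt_of_sq_le (by nlinarith)
  have hφ0 : 0 < φ := by linarith
  have hχ0 : 0 < χ := by linarith
  set a := φ⁻¹ • p with ha
  set b := χ⁻¹ • q with hb
  have hSp : Sop p h = h - (inner ℝ a h : ℝ) • a := by
    unfold Sop
    rw [ha, inner_smul_left, smul_smul, ← hs, ← hφ2]
    simp only [conj_trivial]
    congr 2; field_simp
  have hSq : Sop q h = h - (inner ℝ b h : ℝ) • b := by
    unfold Sop
    rw [hb, inner_smul_left, smul_smul, ← ht, ← hχ2]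
    simp only [conj_trivial]
    congr 2; field_simp
  have hps : ‖p‖ ≤ φ := (norm_le_sq1 p).trans hφs
  have hqs : ‖q‖ ≤ χ := (norm_le_sq1 q).trans hχt
  have han : ‖a‖ ≤ 1 := by
    rw [ha, norm_smul, norm_inv, Real.norm_of_nonneg hφ0.le, inv_mul_le_iff₀ hφ0]; linarith
  have hbn : ‖b‖ ≤ 1 := by
    rw [hb, norm_smul, norm_inv, Real.norm_of_nonneg hχ0.le, inv_mul_le_iff₀ hχ0]; linarith
  have hst : |s - t| ≤ ‖p - q‖ := sq1_lip p q
  have hφχ : |φ - χ| ≤ 3 / 2 * ‖p - q‖ := by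
    have e1 : |φ - χ| * (φ + χ) = |s - t| * (s + t + 1) := by
      rw [← abs_of_nonneg (show 0 ≤ φ + χ by linarith), ← abs_mul,
        ← abs_of_nonneg (show 0 ≤ s + t + 1 by linarith), ← abs_mul]
      congr 1; nlinarith
    have e2 : |φ - χ| * (φ + χ) ≤ 3 / 2 * ‖p - q‖ * (φ + χ) := by
      rw [e1]
      calc |s - t| * (s + t + 1) ≤ ‖p - q‖ * (3 / 2 * (φ + χ)) := by
            apply mul_le_mul hst (by linarith) (by linarith) (norm_nonneg _)
        _ = _ := by ring
    exact le_of_mul_le_mul_right e2 (by linarith)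
  have hab : ‖a - b‖ ≤ 5 / 2 * ‖p - q‖ / t := by
    have e1 : a - b = χ⁻¹ • (p - q) + (φ⁻¹ - χ⁻¹) • p := by
      rw [ha, hb, smul_sub, sub_smul]; abel
    have e2 : ‖χ⁻¹ • (p - q)‖ ≤ ‖p - q‖ / t := by
      rw [norm_smul, norm_inv, Real.norm_of_nonneg hχ0.le, inv_mul_eq_div]
      gcongr
    have e3 : ‖(φ⁻¹ - χ⁻¹) • p‖ ≤ 3 / 2 * ‖p - q‖ / t := by
      rw [norm_smul, Real.norm_eq_abs]
      have : φ⁻¹ - χ⁻¹ = - ((φ - χ) / (φ * χ)) := by field_simp; ring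
      rw [this, abs_neg, abs_div, abs_of_pos (mul_pos hφ0 hχ0)]
      calc |φ - χ| / (φ * χ) * ‖p‖ ≤ 3 / 2 * ‖p - q‖ / (φ * χ) * φ := by gcongr
        _ = 3 / 2 * ‖p - q‖ / χ := by field_simp
        _ ≤ _ := by gcongr
    rw [e1]
    refine (norm_add_le _ _).trans ?_
    have : 5 / 2 * ‖p - q‖ / t = ‖p - q‖ / t + 3 / 2 * ‖p - q‖ / t := by ring
    linarith
  have e : Sop p h - Sop q h = - ((inner ℝ (a - b) h : ℝ) • a + (inner ℝ b h : ℝ) • (a - b)) := by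
    rw [hSp, hSq, inner_sub_left, sub_smul, smul_sub]; abel
  rw [e, norm_neg]
  refine (norm_add_le _ _).trans ?_
  rw [norm_smul (inner ℝ (a - b) h : ℝ) a, norm_smul (inner ℝ b h : ℝ) (a - b)]
  have e1 : ‖(inner ℝ (a - b) h : ℝ)‖ ≤ ‖a - b‖ * ‖h‖ := norm_inner_le_norm _ _
  have e2 : ‖(inner ℝ b h : ℝ)‖ ≤ 1 * ‖h‖ := (norm_inner_le_norm _ _).trans (by gcongr)
  calc _ ≤ ‖a - b‖ * ‖h‖ * 1 + 1 * ‖h‖ * ‖a - b‖ := by gcongr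
    _ = 2 * ‖a - b‖ * ‖h‖ := by ring
    _ ≤ 2 * (5 / 2 * ‖p - q‖ / t) * ‖h‖ := by gcongr
    _ = _ := by ring
end SG

section TG
variable {N : ℕ}
local notation "EE" => EuclideanSpace ℝ (Fin N)

/-- upper second order expansion -/
def UT (f : EE → ℝ) (z g : EE) (α β : ℝ) (e : EE) : Prop :=
  ∀ η, 0 < η → ∀ᶠ δ in 𝓝 (0 : EE), f (z + δ) ≤ f z + inner ℝ g δ
    + 1 / 2 * (α * ‖δ‖ ^ 2 + β * (inner ℝ e δ) ^ 2) + η * ‖δ‖ ^ 2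

lemma touch {U : Set EE} {v u : EE → ℝ} {Λ H₀ : ℝ} (hG : Good U v u Λ H₀) {x y : EE} (hx : x ∈ U)
    (hy : y ∈ U) {A B : EE → ℝ} {g g' e f : EE} {α β α' β' : ℝ} (hA : UT A (x - y) g α β e)
    (hB : UT B (x + y) g' α' β' f)
    (hmax : ∀ᶠ d in 𝓝 (0 : EE × EE), v (x + d.1) - u (y + d.2) - A (x + d.1 - (y + d.2))
      - B (x + d.1 + (y + d.2)) ≤ v x - u y - A (x - y) - B (x + y))
    (b b' : OrthonormalBasis (Fin N) ℝ EE) :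
    -(Λ * ‖x - y‖ * sq1 (g - g') + H₀ * (2 * ‖g'‖)) ≤
      ∑ i, Bq α β α' β' e f (Sop (g + g') (b i)) (Sop (g - g') (b' i)) := by
  have e0 : ‖g + g' - (g - g')‖ = 2 * ‖g'‖ := by
    have : g + g' - (g - g') = (2:ℝ) • g' := by rw [two_smul]; abel
    rw [this, norm_smul]; simp
  rw [← e0]
  refine hG.key x hx y hy _ _ e f α β α' β' b b' fun η hη => ?_
  have t1 : Tendsto (fun d : EE × EE => d.1 - d.2) (𝓝 0) (𝓝 0) := by
    have : Continuous (fun d : EE × EE => d.1 - d.2) := by fun_prop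
    simpa using this.tendsto 0
  have t2 : Tendsto (fun d : EE × EE => d.1 + d.2) (𝓝 0) (𝓝 0) := by
    have : Continuous (fun d : EE × EE => d.1 + d.2) := by fun_prop
    simpa using this.tendsto 0
  filter_upwards [hmax, t1.eventually (hA (η / 2) (by positivity)),
    t2.eventually (hB (η / 2) (by positivity))] with d h1 h2 h3
  rw [show x + d.1 - (y + d.2) = x - y + (d.1 - d.2) by abel,
    show x + d.1 + (y + d.2) = x + y + (d.1 + d.2) by abel] at h1
  have e1 : (inner ℝ (g + g') d.1 - inner ℝ (g - g') d.2 : ℝ)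
      = inner ℝ g (d.1 - d.2) + inner ℝ g' (d.1 + d.2) := by
    rw [inner_add_left, inner_sub_left, inner_sub_right, inner_add_right]; ring
  have e2 : ‖d.1 - d.2‖ ^ 2 + ‖d.1 + d.2‖ ^ 2 = 2 * (‖d.1‖ ^ 2 + ‖d.2‖ ^ 2) := by
    rw [norm_sub_sq_real, norm_add_sq_real]; ring
  unfold Bq
  have e3 : η * (‖d.1‖ ^ 2 + ‖d.2‖ ^ 2) = η / 2 * ‖d.1 - d.2‖ ^ 2 + η / 2 * ‖d.1 + d.2‖ ^ 2 := by
    rw [← mul_add, e2]; ring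
  linarith

lemma sum_inner_sq (b : OrthonormalBasis (Fin N) ℝ EE) (f : EE) :
    ∑ i, (inner ℝ f (b i) : ℝ) ^ 2 = ‖f‖ ^ 2 := by
  have := b.sum_inner_mul_inner f f
  rw [real_inner_self_eq_norm_sq] at this
  rw [← this]
  refine Finset.sum_congr rfl fun i _ => ?_
  rw [real_inner_comm f (b i)]; ring

/-- identity coupling -/
lemma touch_id {U : Set EE} {v u : EE → ℝ} {Λ H₀ : ℝ} (hG : Good U v u Λ H₀) {x y : EE} (hx : x ∈ U)
    (hy : y ∈ U) {A B : EE → ℝ} {g g' e f : EE} {α β α' β' : ℝ} (hA : UT A (x - y) g α β e)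
    (hB : UT B (x + y) g' α' β' f)
    (hmax : ∀ᶠ d in 𝓝 (0 : EE × EE), v (x + d.1) - u (y + d.2) - A (x + d.1 - (y + d.2))
      - B (x + d.1 + (y + d.2)) ≤ v x - u y - A (x - y) - B (x + y))
    {a : ℝ} (ha0 : 0 ≤ a) (ha : ∀ δ : EE, α * ‖δ‖ ^ 2 + β * (inner ℝ e δ) ^ 2 ≤ a * ‖δ‖ ^ 2)
    (hα' : 0 ≤ α') (hβ' : β' ≤ 0) {Γ : ℝ} (hp : sq1 (g + g') ^ 2 ≤ Γ) (hq : sq1 (g - g') ^ 2 ≤ Γ) :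
    -(Λ * ‖x - y‖ * sq1 (g - g') + 2 * H₀ * ‖g'‖) ≤
      100 * N * a * ‖g'‖ ^ 2 + 4 * N * α' + 4 * β' * ‖f‖ ^ 2 / Γ := by
  set b := EuclideanSpace.basisFun (Fin N) ℝ
  have h := touch hG hx hy hA hB hmax b b
  set p := g + g' with hpd
  set q := g - g' with hqd
  have e0 : ‖p - q‖ = 2 * ‖g'‖ := by
    have : p - q = (2:ℝ) • g' := by rw [hpd, hqd, two_smul]; abel
    rw [this, norm_smul]; simp
  have hs : ∑ i, Bq α β α' β' e f (Sop p (b i)) (Sop q (b i)) ≤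
      ∑ i : Fin N, (100 * a * ‖g'‖ ^ 2 + 4 * α' + β' * (inner ℝ (Sop p f + Sop q f) (b i)) ^ 2) := by
    apply Finset.sum_le_sum
    intro i _
    unfold Bq
    have h1 := ha (Sop p (b i) - Sop q (b i))
    have h2 := Sop_diff p q (b i)
    rw [b.norm_eq_one, e0, mul_one] at h2
    have h3 : ‖Sop p (b i) - Sop q (b i)‖ ≤ 10 * ‖g'‖ := by
      refine h2.trans ?_
      rw [div_le_iff₀ (sq1_pos q)]
      have := sq1_ge q
      have := norm_nonneg g'
      nlinarith
    have h4 : ‖Sop p (b i) - Sop q (b i)‖ ^ 2 ≤ (10 * ‖g'‖) ^ 2 := by gcongr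
    have h5 : ‖Sop p (b i) + Sop q (b i)‖ ^ 2 ≤ 4 := by
      have : ‖Sop p (b i) + Sop q (b i)‖ ≤ 2 := by
        refine (norm_add_le _ _).trans ?_
        have a1 := Sop_norm_le p (b i)
        have a2 := Sop_norm_le q (b i)
        rw [b.norm_eq_one] at a1 a2
        linarith
      have : ‖Sop p (b i) + Sop q (b i)‖ ^ 2 ≤ 2 ^ 2 := by gcongr
      linarith
    have h6 : (inner ℝ f (Sop p (b i) + Sop q (b i)) : ℝ) = inner ℝ (Sop p f + Sop q f) (b i) := by
      rw [inner_add_right, inner_add_left, Sop_symm, Sop_symm]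
    rw [h6]
    have h7 := mul_le_mul_of_nonneg_left h4 ha0
    have h8 := mul_le_mul_of_nonneg_left h5 hα'
    nlinarith
  rw [Finset.sum_add_distrib, ← Finset.mul_sum, sum_inner_sq] at hs
  simp only [Finset.sum_const, Finset.card_univ, Fintype.card_fin, nsmul_eq_mul] at hs
  have hΓ : 0 < Γ := lt_of_lt_of_le (pow_pos (sq1_pos _) 2) hq
  have hf : 4 * ‖f‖ ^ 2 / Γ ≤ ‖Sop p f + Sop q f‖ ^ 2 := by
    have l1 := Sop_lower p f
    have l2 := Sop_lower q f
    set w := Real.sqrt Γ with hw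
    have hw0 : 0 < w := Real.sqrt_pos.2 hΓ
    have hw2 : w ^ 2 = Γ := Real.sq_sqrt hΓ.le
    have m1 : ‖f‖ ^ 2 / w ≤ ‖f‖ ^ 2 / sq1 p :=
      div_le_div_of_nonneg_left (by positivity) (sq1_pos p) (Real.le_sqrt_of_sq_le hp)
    have m2 : ‖f‖ ^ 2 / w ≤ ‖f‖ ^ 2 / sq1 q :=
      div_le_div_of_nonneg_left (by positivity) (sq1_pos q) (Real.le_sqrt_of_sq_le hq)
    have m3 : 2 * ‖f‖ ^ 2 / w ≤ ‖Sop p f + Sop q f‖ * ‖f‖ := by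
      refine le_trans ?_ (real_inner_le_norm _ _)
      rw [inner_add_left]
      have : 2 * ‖f‖ ^ 2 / w = ‖f‖ ^ 2 / w + ‖f‖ ^ 2 / w := by ring
      linarith
    rcases eq_or_lt_of_le (norm_nonneg f) with h0 | h0
    · rw [← h0]; simp
    · have m4 : 2 * ‖f‖ / w ≤ ‖Sop p f + Sop q f‖ := by
        apply le_of_mul_le_mul_right _ h0
        refine le_trans (le_of_eq ?_) m3
        ring
      have : (2 * ‖f‖ / w) ^ 2 ≤ ‖Sop p f + Sop q f‖ ^ 2 := by gcongr
      rw [div_pow, hw2] at this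
      convert this using 1
      ring
  have hf' := mul_le_mul_of_nonpos_left hf hβ'
  have : 4 * β' * ‖f‖ ^ 2 / Γ = β' * (4 * ‖f‖ ^ 2 / Γ) := by ring
  rw [this]
  linarith

/-- reflection coupling -/
lemma touch_refl {U : Set EE} {v u : EE → ℝ} {Λ H₀ : ℝ} (hG : Good U v u Λ H₀) {x y : EE} (hx : x ∈ U)
    (hy : y ∈ U) {A B : EE → ℝ} {g g' e : EE} {κ c k : ℝ} (he : ‖e‖ = 1)
    (hA : UT A (x - y) g κ (- c - κ) e)
    (hB : UT B (x + y) g' (2 * k) 0 0)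
    (hmax : ∀ᶠ d in 𝓝 (0 : EE × EE), v (x + d.1) - u (y + d.2) - A (x + d.1 - (y + d.2))
      - B (x + d.1 + (y + d.2)) ≤ v x - u y - A (x - y) - B (x + y))
    (hc0 : 0 ≤ c) (hcκ : c ≤ κ) (hk : 0 ≤ k) :
    2 * c ≤ 100 * (N + 1) * κ * ‖g'‖ ^ 2 + sq1 (g - g') ^ 2 * (8 * N * k + 2 * H₀ * ‖g'‖)
      + Λ * ‖x - y‖ * sq1 (g - g') ^ 3 := by
  set p := g + g' with hpd
  set q := g - g' with hqd
  have e0 : ‖p - q‖ = 2 * ‖g'‖ := by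
    have : p - q = (2:ℝ) • g' := by rw [hpd, hqd, two_smul]; abel
    rw [this, norm_smul]; simp
  obtain ⟨n, τ, hn, hτ, hτt, hSn⟩ := Sop_inv q e he
  set b := EuclideanSpace.basisFun (Fin N) ℝ
  set R := (ℝ ∙ n)ᗮ.reflection with hR
  set b' := b.map R with hb'
  have hbi : ∀ i, b' i = b i - (2 * inner ℝ n (b i) : ℝ) • n := by
    intro i
    rw [hb', OrthonormalBasis.map_apply, hR]
    rw [Submodule.reflection_orthogonal_apply, Submodule.reflection_singleton_apply, hn]
    simp only [RCLike.ofReal_real_eq_id, id, one_pow, div_one]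
    rw [mul_smul, two_smul, two_smul]
    abel
  have h := touch hG hx hy hA hB hmax b b'
  rw [← hpd, ← hqd] at h
  set t := sq1 q with ht
  have ht0 : 0 < t := sq1_pos q
  set D := 5 * (2 * ‖g'‖) / t with hD
  have hD0 : 0 ≤ D := by positivity
  have hDd : ∀ l, ‖Sop p l - Sop q l‖ ≤ D * ‖l‖ := by
    intro l; have := Sop_diff p q l; rwa [e0] at this
  have hκ0 : 0 ≤ κ := hc0.trans hcκ
  set w : EE := Sop p e - Sop q e + (2 / τ) • n with hw
  have hs : ∑ i, Bq κ (- c - κ) (2 * k) 0 e 0 (Sop p (b i)) (Sop q (b' i)) ≤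
      ∑ i : Fin N, (κ * D ^ 2 - c * (inner ℝ w (b i)) ^ 2 + 8 * k) := by
    apply Finset.sum_le_sum
    intro i _
    unfold Bq
    set d := Sop p (b i) - Sop q (b i) with hd
    have h1 : Sop p (b i) - Sop q (b' i) = d + (2 / τ * inner ℝ n (b i)) • e := by
      rw [hbi, Sop_sub, Sop_smul, hSn, smul_smul, hd]
      rw [show (2 * inner ℝ n (b i) * τ⁻¹ : ℝ) = 2 / τ * inner ℝ n (b i) by ring]
      abel
    set ξ : ℝ := 2 / τ * inner ℝ n (b i) with hξ
    have h2 : (inner ℝ e (Sop p (b i) - Sop q (b' i)) : ℝ) = inner ℝ w (b i) := by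
      rw [h1, hw, inner_add_right, inner_add_left, inner_smul_right, inner_smul_left, inner_sub_left,
        Sop_symm, Sop_symm, real_inner_self_eq_norm_sq, he, hd, inner_sub_right, hξ]
      simp
    have h3 : ‖Sop p (b i) - Sop q (b' i)‖ ^ 2 - (inner ℝ e (Sop p (b i) - Sop q (b' i)) : ℝ) ^ 2
        ≤ D ^ 2 := by
      have a1 := hDd (b i)
      rw [b.norm_eq_one, mul_one, ← hd] at a1
      have a2 : ‖d‖ ^ 2 ≤ D ^ 2 := by gcongr
      rw [h1, norm_add_sq_real, inner_add_right, inner_smul_right, inner_smul_right,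
        real_inner_self_eq_norm_sq, norm_smul, he, real_inner_comm, mul_pow, Real.norm_eq_abs, sq_abs]
      nlinarith [sq_nonneg (inner ℝ e d : ℝ)]
    have h5 : ‖Sop p (b i) + Sop q (b' i)‖ ^ 2 ≤ 4 := by
      have : ‖Sop p (b i) + Sop q (b' i)‖ ≤ 2 := by
        refine (norm_add_le _ _).trans ?_
        have a1 := Sop_norm_le p (b i)
        have a2 := Sop_norm_le q (b' i)
        rw [b.norm_eq_one] at a1
        rw [b'.norm_eq_one] at a2
        linarith
      have : ‖Sop p (b i) + Sop q (b' i)‖ ^ 2 ≤ 2 ^ 2 := by gcongr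
      linarith
    have h6 := mul_le_mul_of_nonneg_left h3 hκ0
    have h7 := mul_le_mul_of_nonneg_left h5 hk
    rw [h2] at h6 ⊢
    linarith
  rw [Finset.sum_add_distrib, Finset.sum_sub_distrib, ← Finset.mul_sum _ _ c, sum_inner_sq] at hs
  simp only [Finset.sum_const, Finset.card_univ, Fintype.card_fin, nsmul_eq_mul] at hs
  have hwl : 2 / t ^ 2 - D ^ 2 ≤ ‖w‖ ^ 2 := by
    have a1 := hDd e
    rw [he, mul_one] at a1
    have a2 : ‖Sop p e - Sop q e‖ ^ 2 ≤ D ^ 2 := by gcongr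
    have a3 : (2 / τ) = ‖w - (Sop p e - Sop q e)‖ := by
      rw [hw, add_sub_cancel_left, norm_smul, hn, Real.norm_of_nonneg (by positivity), mul_one]
    have a4 : 2 / t ≤ 2 / τ := by gcongr
    have a5 : (2 / t) ^ 2 ≤ 2 * ‖w‖ ^ 2 + 2 * D ^ 2 := by
      have : 2 / t ≤ ‖w‖ + ‖Sop p e - Sop q e‖ := by
        rw [a3] at a4; exact a4.trans (norm_sub_le _ _)
      have : (2 / t) ^ 2 ≤ (‖w‖ + ‖Sop p e - Sop q e‖) ^ 2 := by gcongr
      nlinarith [sq_nonneg (‖w‖ - ‖Sop p e - Sop q e‖)]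
    have a6 : (2 / t) ^ 2 = 2 * (2 / t ^ 2) := by rw [div_pow]; ring
    linarith
  have h9 := mul_le_mul_of_nonneg_left hwl hc0
  have h10 : c * D ^ 2 ≤ κ * D ^ 2 := by gcongr
  have h11 : 2 * c / t ^ 2 ≤ (N + 1) * κ * D ^ 2 + 8 * N * k + 2 * H₀ * ‖g'‖ + Λ * ‖x - y‖ * t := by
    have : 2 * c / t ^ 2 = c * (2 / t ^ 2) := by ring
    linarith
  rw [div_le_iff₀ (by positivity)] at h11
  refine h11.trans (le_of_eq ?_)
  rw [hD]; field_simp; ring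
end TG


lemma peano2 {ψ ψ1 : ℝ → ℝ} {r c : ℝ} (h1 : ∀ᶠ s in 𝓝 r, HasDerivAt ψ (ψ1 s) s)
    (h2 : HasDerivAt ψ1 c r) {η : ℝ} (hη : 0 < η) :
    ∀ᶠ ρ in 𝓝 (0:ℝ), ψ (r + ρ) ≤ ψ r + ψ1 r * ρ + 1 / 2 * c * ρ ^ 2 + η * ρ ^ 2 := by
  have h3 := (hasDerivAt_iff_isLittleO.1 h2).def hη
  obtain ⟨d, hd, hd'⟩ := Metric.eventually_nhds_iff_ball.1 (h1.and h3)
  filter_upwards [Metric.ball_mem_nhds (0:ℝ) hd] with ρ hρ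
  rw [mem_ball, dist_zero_right, Real.norm_eq_abs] at hρ
  set G : ℝ → ℝ := fun s => ψ s - ψ1 r * (s - r) - 1 / 2 * c * (s - r) ^ 2 with hG
  have hmv := Convex.norm_image_sub_le_of_norm_hasDerivWithin_le (f := G)
    (f' := fun s => ψ1 s - ψ1 r - (s - r) * c) (s := closedBall r |ρ|) (C := η * |ρ|) (x := r)
    (y := r + ρ) (by
      intro s hs
      rw [mem_closedBall] at hs
      have hs' := (hd' s (by rw [mem_ball]; linarith)).1
      apply HasDerivAt.hasDerivWithinAt
      have i1 : HasDerivAt (fun s : ℝ => s - r) 1 s := (hasDerivAt_id s).sub_const r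
      have := (hs'.sub (i1.const_mul (ψ1 r))).sub ((i1.pow 2).const_mul (1 / 2 * c))
      refine this.congr_deriv ?_
      simp; ring) (by
      intro s hs
      rw [mem_closedBall] at hs
      have hs' := (hd' s (by rw [mem_ball]; linarith)).2
      rw [Real.norm_eq_abs (s - r), ← Real.dist_eq] at hs'
      rw [smul_eq_mul] at hs'
      exact hs'.trans (by gcongr)) (convex_closedBall _ _) (by simp) (by simp)
  rw [add_sub_cancel_left, Real.norm_eq_abs, Real.norm_eq_abs] at hmv
  have h5 := (abs_le.1 hmv).2
  simp only [hG] at h5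
  have h6 : |ρ| * |ρ| = ρ ^ 2 := by rw [← sq, sq_abs]
  simp at h5
  nlinarith

section EX
variable {N : ℕ}
local notation "EE" => EuclideanSpace ℝ (Fin N)

lemma small_ev {c η : ℝ} (hη : 0 < η) : ∀ᶠ δ in 𝓝 (0 : EE), c * ‖δ‖ ≤ η ∧ ‖δ‖ ≤ 1 := by
  have t1 : Tendsto (fun δ : EE => c * ‖δ‖) (𝓝 0) (𝓝 0) := by
    have : Continuous (fun δ : EE => c * ‖δ‖) := by fun_prop
    simpa using this.tendsto 0
  have t2 : Tendsto (fun δ : EE => ‖δ‖) (𝓝 0) (𝓝 0) := by simpa using (continuous_norm (E := EE)).tendsto 0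
  exact ((t1.eventually (gt_mem_nhds hη)).and (t2.eventually (gt_mem_nhds one_pos))).mono
    fun _ h => ⟨h.1.le, h.2.le⟩

lemma UT_radial {ψ ψ1 : ℝ → ℝ} {c : ℝ} {z p : EE} (hz : z ≠ 0)
    (h1 : ∀ᶠ s in 𝓝 ‖z‖, HasDerivAt ψ (ψ1 s) s) (h2 : HasDerivAt ψ1 c ‖z‖) :
    UT (fun z => inner ℝ p z + ψ ‖z‖) z (p + (ψ1 ‖z‖) • (‖z‖⁻¹ • z)) (ψ1 ‖z‖ / ‖z‖)
      (c - ψ1 ‖z‖ / ‖z‖) (‖z‖⁻¹ • z) := by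
  intro η hη
  set r := ‖z‖ with hr
  have hr0 : 0 < r := norm_pos_iff.2 hz
  set e := r⁻¹ • z with he
  have t1 : Tendsto (fun δ : EE => ‖z + δ‖ - r) (𝓝 0) (𝓝 0) := by
    have : Continuous (fun δ : EE => ‖z + δ‖ - r) := by fun_prop
    simpa [hr] using this.tendsto 0
  filter_upwards [t1.eventually (peano2 h1 h2 (show 0 < η / 2 by positivity)),
    small_ev (c := |c - ψ1 r / r| / r) hη] with δ hδ hs
  set ρ := ‖z + δ‖ - r with hρ
  have e1 : ‖z + δ‖ = r + ρ := by rw [hρ]; ring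
  have e2 : (r + ρ) ^ 2 = r ^ 2 + 2 * (r * inner ℝ e δ) + ‖δ‖ ^ 2 := by
    rw [← e1, norm_add_sq_real, he, inner_smul_left]
    simp; field_simp; rw [hr]
  set a : ℝ := inner ℝ e δ with ha
  have hen : ‖e‖ = 1 := by
    rw [he, norm_smul, norm_inv, Real.norm_of_nonneg hr0.le, ← hr, inv_mul_cancel₀ hr0.ne']
  have haδ : |a| ≤ ‖δ‖ := by have := abs_real_inner_le_norm e δ; rwa [hen, one_mul] at this
  have hρδ : |ρ| ≤ ‖δ‖ := by
    rw [hρ, hr]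
    have := abs_norm_sub_norm_le (z + δ) z
    rwa [add_sub_cancel_left] at this
  have e3 : ρ = a + (‖δ‖ ^ 2 - ρ ^ 2) / (2 * r) := by field_simp; nlinarith
  have hρ2 : ρ ^ 2 ≤ ‖δ‖ ^ 2 := sq_le_sq' (by linarith [(abs_le.1 hρδ).1]) (abs_le.1 hρδ).2
  have e4 : |ρ ^ 2 - a ^ 2| ≤ ‖δ‖ ^ 2 / r * ‖δ‖ := by
    have : ρ ^ 2 - a ^ 2 = (ρ - a) * (ρ + a) := by ring
    rw [this, abs_mul]
    have a1 : |ρ - a| ≤ ‖δ‖ ^ 2 / (2 * r) := by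
      have : ρ - a = (‖δ‖ ^ 2 - ρ ^ 2) / (2 * r) := by linarith
      rw [this, abs_of_nonneg (div_nonneg (by linarith) (by positivity))]
      gcongr
      nlinarith [sq_nonneg ρ]
    have a2 : |ρ + a| ≤ 2 * ‖δ‖ := (abs_add_le _ _).trans (by linarith)
    calc _ ≤ ‖δ‖ ^ 2 / (2 * r) * (2 * ‖δ‖) := by gcongr
      _ = _ := by field_simp
  have e5 : ψ1 r * ρ = ψ1 r * a + ψ1 r / r * (‖δ‖ ^ 2 - ρ ^ 2) / 2 := by
    conv_lhs => rw [e3]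
    field_simp
  have e6 : (c - ψ1 r / r) * (ρ ^ 2 - a ^ 2) ≤ η * ‖δ‖ ^ 2 := by
    refine (le_abs_self _).trans ?_
    rw [abs_mul]
    calc _ ≤ |c - ψ1 r / r| * (‖δ‖ ^ 2 / r * ‖δ‖) := by gcongr
      _ = |c - ψ1 r / r| / r * ‖δ‖ * ‖δ‖ ^ 2 := by ring
      _ ≤ _ := by gcongr; exact hs.1
  simp only [e1]
  rw [inner_add_left, inner_add_right, inner_smul_left, ← ha]
  simp only [conj_trivial]
  nlinarith

lemma UT_quad (p s0 s e : EE) (k : ℝ) :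
    UT (fun s => inner ℝ p s + k * ‖s - s0‖ ^ 2) s (p + (2 * k) • (s - s0)) (2 * k) 0 e := by
  intro η hη
  filter_upwards with δ
  have : s + δ - s0 = (s - s0) + δ := by abel
  have h0 : 0 ≤ η * ‖δ‖ ^ 2 := by positivity
  rw [this, norm_add_sq_real, inner_add_left, inner_add_right, inner_smul_left]
  simp only [conj_trivial]
  linarith

lemma UT_exp (s : EE) {ε γ : ℝ} (hε : 0 ≤ ε) (hγ : 0 ≤ γ) :
    UT (fun s => - (ε * Real.exp (-(γ * ‖s‖ ^ 2)))) s ((2 * ε * γ * Real.exp (-(γ * ‖s‖ ^ 2))) • s)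
      (2 * ε * γ * Real.exp (-(γ * ‖s‖ ^ 2))) (-(4 * ε * γ ^ 2 * Real.exp (-(γ * ‖s‖ ^ 2)))) s := by
  intro η hη
  set χ := Real.exp (-(γ * ‖s‖ ^ 2)) with hχ
  have hχ0 : 0 < χ := Real.exp_pos _
  set C := ε * χ * (2 * γ ^ 2 * ‖s‖ + (γ * (2 * ‖s‖ + 1)) ^ 3) with hC
  filter_upwards [small_ev (c := C) hη, small_ev (c := γ * (2 * ‖s‖ + 1)) one_pos] with δ h1 h2
  set a : ℝ := inner ℝ s δ with ha
  have haδ : |a| ≤ ‖s‖ * ‖δ‖ := abs_real_inner_le_norm s δ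
  set y := -(γ * (2 * a + ‖δ‖ ^ 2)) with hy
  have hexp : Real.exp (-(γ * ‖s + δ‖ ^ 2)) = χ * Real.exp y := by
    rw [hχ, ← Real.exp_add, norm_add_sq_real]; congr 1; rw [hy]; ring
  have hyb : |y| ≤ γ * (2 * ‖s‖ + 1) * ‖δ‖ := by
    rw [hy, abs_neg, abs_mul, abs_of_nonneg hγ, mul_assoc]
    gcongr
    refine (abs_add_le _ _).trans ?_
    rw [abs_mul, abs_of_nonneg (show (0:ℝ) ≤ 2 by norm_num), abs_of_nonneg (sq_nonneg ‖δ‖)]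
    nlinarith [norm_nonneg δ, h1.2]
  have hy1 : |y| ≤ 1 := hyb.trans h2.1
  have hb := (abs_le.1 (Real.exp_bound hy1 (n := 3) (by norm_num))).1
  simp [Finset.sum_range_succ, Nat.factorial] at hb
  norm_num at hb
  have hy3 : |y| ^ 3 ≤ (γ * (2 * ‖s‖ + 1)) ^ 3 * (‖δ‖ ^ 2 * ‖δ‖) := by
    calc |y| ^ 3 ≤ (γ * (2 * ‖s‖ + 1) * ‖δ‖) ^ 3 := by gcongr
      _ = _ := by ring
  have hb2 : 1 + y + y ^ 2 / 2 - |y| ^ 3 ≤ Real.exp y := by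
    have : 0 ≤ |y| ^ 3 := by positivity
    linarith
  have hb3 := mul_le_mul_of_nonneg_left hb2 (show 0 ≤ ε * χ by positivity)
  simp only [hexp, inner_smul_left, conj_trivial, ← ha]
  have e1 : ε * χ * (γ ^ 2 * (2 * |a| * ‖δ‖ ^ 2)) ≤ ε * χ * (2 * γ ^ 2 * ‖s‖) * ‖δ‖ * ‖δ‖ ^ 2 := by
    calc _ ≤ ε * χ * (γ ^ 2 * (2 * (‖s‖ * ‖δ‖) * ‖δ‖ ^ 2)) := by gcongr
      _ = _ := by ring
  have e2 : ε * χ * |y| ^ 3 ≤ ε * χ * (γ * (2 * ‖s‖ + 1)) ^ 3 * ‖δ‖ * ‖δ‖ ^ 2 := by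
    calc _ ≤ ε * χ * ((γ * (2 * ‖s‖ + 1)) ^ 3 * (‖δ‖ ^ 2 * ‖δ‖)) := by gcongr
      _ = _ := by ring
  have e3 : C * ‖δ‖ * ‖δ‖ ^ 2 ≤ η * ‖δ‖ ^ 2 := by gcongr; exact h1.1
  have e4 : y ^ 2 / 2 ≥ 2 * γ ^ 2 * a ^ 2 - γ ^ 2 * (2 * |a| * ‖δ‖ ^ 2) := by
    have : y ^ 2 / 2 = 2 * γ ^ 2 * a ^ 2 + γ ^ 2 * (2 * a * ‖δ‖ ^ 2) + γ ^ 2 * (‖δ‖ ^ 2) ^ 2 / 2 := by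
      rw [hy]; ring
    have h5 : γ ^ 2 * (2 * (-|a|) * ‖δ‖ ^ 2) ≤ γ ^ 2 * (2 * a * ‖δ‖ ^ 2) := by
      gcongr; exact neg_abs_le a
    have h6 : 0 ≤ γ ^ 2 * (‖δ‖ ^ 2) ^ 2 / 2 := by positivity
    linarith
  have e5 := mul_le_mul_of_nonneg_left e4 (show 0 ≤ ε * χ by positivity)
  have e6 : ε * χ * y = -(ε * χ * γ * 2 * a) - ε * χ * γ * ‖δ‖ ^ 2 := by rw [hy]; ring
  have e7 : C * ‖δ‖ * ‖δ‖ ^ 2 = ε * χ * (2 * γ ^ 2 * ‖s‖) * ‖δ‖ * ‖δ‖ ^ 2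
      + ε * χ * (γ * (2 * ‖s‖ + 1)) ^ 3 * ‖δ‖ * ‖δ‖ ^ 2 := by rw [hC]; ring
  linarith
end EX


section MX
variable {N : ℕ}
local notation "EE" => EuclideanSpace ℝ (Fin N)

lemma sq1_le_add {F : Type*} [NormedAddCommGroup F] [InnerProductSpace ℝ F] (p : F) :
    sq1 p ≤ 1 + ‖p‖ := by
  apply le_of_sq_le_sq _ (by positivity)
  rw [sq1_sq]; nlinarith [norm_nonneg p]

lemma half_recover (z s : EE) : (2⁻¹ : ℝ) • (s + z) - (2⁻¹ : ℝ) • (s - z) = z ∧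
    (2⁻¹ : ℝ) • (s + z) + (2⁻¹ : ℝ) • (s - z) = s := by
  constructor
  · rw [← smul_sub, show s + z - (s - z) = (2:ℝ) • z by rw [two_smul]; abel, smul_smul]; norm_num
  · rw [← smul_add, show s + z + (s - z) = (2:ℝ) • s by rw [two_smul]; abel, smul_smul]; norm_num

lemma half_recover' (x y : EE) : (2⁻¹ : ℝ) • ((x + y) + (x - y)) = x ∧
    (2⁻¹ : ℝ) • ((x + y) - (x - y)) = y := by
  constructor
  · rw [show x + y + (x - y) = (2:ℝ) • x by rw [two_smul]; abel, smul_smul]; norm_num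
  · rw [show x + y - (x - y) = (2:ℝ) • y by rw [two_smul]; abel, smul_smul]; norm_num

/-- the doubled region -/
def Reg (Kz Ks : Set EE) : Set (EE × EE) := {w | w.1 - w.2 ∈ Kz ∧ w.1 + w.2 ∈ Ks}

lemma Reg_compact {Kz Ks : Set EE} (hz : IsCompact Kz) (hs : IsCompact Ks) : IsCompact (Reg Kz Ks) := by
  have : Reg Kz Ks = (fun w : EE × EE => ((2⁻¹ : ℝ) • (w.2 + w.1), (2⁻¹ : ℝ) • (w.2 - w.1))) ''
      (Kz ×ˢ Ks) := by
    ext w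
    constructor
    · intro hw
      refine ⟨(w.1 - w.2, w.1 + w.2), ⟨hw.1, hw.2⟩, ?_⟩
      have := half_recover' w.1 w.2
      exact Prod.ext this.1 this.2
    · rintro ⟨⟨z, s⟩, ⟨h1, h2⟩, rfl⟩
      have := half_recover z s
      exact ⟨by rw [this.1]; exact h1, by rw [this.2]; exact h2⟩
  rw [this]
  exact (hz.prod hs).image (by fun_prop)

lemma V_usc {U : Set EE} {v u : EE → ℝ} (hv : UpperSemicontinuousOn v U)
    (hu : LowerSemicontinuousOn u U) {R : Set (EE × EE)} (hR : ∀ w ∈ R, w.1 ∈ U ∧ w.2 ∈ U)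
    {f : EE × EE → ℝ} (hf : Continuous f) :
    UpperSemicontinuousOn (fun w : EE × EE => v w.1 - u w.2 - f w) R := by
  have h1 : UpperSemicontinuousOn (fun w : EE × EE => v w.1) R :=
    UpperSemicontinuousOn.comp hv continuous_fst.continuousOn (fun w hw => (hR w hw).1)
  have h2 : LowerSemicontinuousOn (fun w : EE × EE => u w.2) R :=
    LowerSemicontinuousOn.comp hu continuous_snd.continuousOn (fun w hw => (hR w hw).2)
  have h3 : UpperSemicontinuousOn (fun w : EE × EE => - u w.2) R := by
    intro h hh c hc
    filter_upwards [h2 h hh (-c) (by simp at hc ⊢; linarith)] with z hz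
    simp at hz ⊢; linarith
  have h4 : UpperSemicontinuousOn (fun w : EE × EE => - f w) R :=
    hf.neg.upperSemicontinuous.upperSemicontinuousOn _
  have := (h1.add h3).add h4
  simpa [sub_eq_add_neg] using this

lemma exists_max {U : Set EE} {v u : EE → ℝ} {Λ H₀ : ℝ} (hG : Good U v u Λ H₀) {Kz Ks : Set EE}
    (hz : IsCompact Kz) (hs : IsCompact Ks) (hU : ∀ x y, x - y ∈ Kz → x + y ∈ Ks → x ∈ U ∧ y ∈ U)
    {A B : EE → ℝ} (hA : Continuous A) (hB : Continuous B) {b : ℝ} {x0 y0 : EE} (hz0 : x0 - y0 ∈ Kz)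
    (hs0 : x0 + y0 ∈ Ks) (hb : b < v x0 - u y0 - A (x0 - y0) - B (x0 + y0)) :
    ∃ x y, x - y ∈ Kz ∧ x + y ∈ Ks ∧ b < v x - u y - A (x - y) - B (x + y) ∧
      (x - y ∈ interior Kz → x + y ∈ interior Ks →
        ∀ᶠ d in 𝓝 (0 : EE × EE), v (x + d.1) - u (y + d.2) - A (x + d.1 - (y + d.2))
      - B (x + d.1 + (y + d.2)) ≤ v x - u y - A (x - y) - B (x + y)) := by
  have husc := V_usc hG.usc hG.lsc (R := Reg Kz Ks) (fun w hw => hU w.1 w.2 hw.1 hw.2)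
    (f := fun w => A (w.1 - w.2) + B (w.1 + w.2)) (by fun_prop)
  obtain ⟨w, hw, hmax⟩ := UpperSemicontinuousOn.exists_isMaxOn (s := Reg Kz Ks) ⟨(x0, y0), hz0, hs0⟩ (Reg_compact hz hs) husc
  refine ⟨w.1, w.2, hw.1, hw.2, ?_, ?_⟩
  · have := hmax (show (x0, y0) ∈ Reg Kz Ks from ⟨hz0, hs0⟩)
    simp at this
    linarith
  · intro h1 h2
    have t1 : Tendsto (fun d : EE × EE => w.1 + d.1 - (w.2 + d.2)) (𝓝 0) (𝓝 (w.1 - w.2)) := by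
      have : Continuous (fun d : EE × EE => w.1 + d.1 - (w.2 + d.2)) := by fun_prop
      simpa using this.tendsto 0
    have t2 : Tendsto (fun d : EE × EE => w.1 + d.1 + (w.2 + d.2)) (𝓝 0) (𝓝 (w.1 + w.2)) := by
      have : Continuous (fun d : EE × EE => w.1 + d.1 + (w.2 + d.2)) := by fun_prop
      simpa using this.tendsto 0
    filter_upwards [t1.eventually (mem_interior_iff_mem_nhds.1 h1),
      t2.eventually (mem_interior_iff_mem_nhds.1 h2)] with d a1 a2
    have := hmax (show (w.1 + d.1, w.2 + d.2) ∈ Reg Kz Ks from ⟨a1, a2⟩)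
    simp at this
    linarith

lemma IL_max {U : Set EE} {v u : EE → ℝ} {Λ H₀ : ℝ} (hG : Good U v u Λ H₀) (hΛ : 0 ≤ Λ) (hH : 0 ≤ H₀)
    {p s0 : EE} {ℓ r1 k : ℝ} (hℓ : 0 < ℓ) (hr1 : 0 < r1) (hk : 0 ≤ k)
    (hU : ∀ x y, ‖x - y‖ ≤ r1 → ‖x + y - s0‖ ≤ ℓ → x ∈ U ∧ y ∈ U)
    {ψ ψ1 ψ2 w : ℝ → ℝ} (hψc : Continuous ψ) (hψ0 : ψ 0 = 0)
    (hd1 : ∀ r, 0 < r → r < r1 → HasDerivAt ψ (ψ1 r) r)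
    (hd2 : ∀ r, 0 < r → r < r1 → HasDerivAt ψ1 (- ψ2 r) r)
    (hψ2 : ∀ r, 0 < r → r < r1 → 0 ≤ ψ2 r ∧ ψ2 r ≤ ψ1 r / r)
    (hV : ∀ x y, ‖x - y‖ ≤ r1 → ‖x + y - s0‖ ≤ ℓ → v x - u y ≤ inner ℝ p (x - y) + w ‖x - y‖)
    (hV1 : ∀ x y, ‖x - y‖ = r1 → ‖x + y - s0‖ ≤ ℓ → v x - u y ≤ inner ℝ p (x - y) + ψ r1)
    (hwℓ : ∀ r, 0 < r → r ≤ r1 → w r ≤ ψ r + k * ℓ ^ 2)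
    (hineq : ∀ r σ, 0 < r → r < r1 → 0 ≤ σ → σ ≤ ℓ → k * σ ^ 2 ≤ w r - ψ r →
      400 * (N + 1) * (ψ1 r / r) * (k * σ) ^ 2 + (1 + ‖p‖ + ψ1 r + 2 * (k * σ)) ^ 2
        * (8 * N * k + 4 * H₀ * (k * σ))
        + Λ * r * (1 + ‖p‖ + ψ1 r + 2 * (k * σ)) ^ 3 < 2 * ψ2 r) :
    ∀ x y, ‖x - y‖ ≤ r1 → x + y = s0 → v x - u y ≤ inner ℝ p (x - y) + ψ ‖x - y‖ := by
  intro x0 y0 h1 h2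
  by_contra! hcon
  have e1 : ∀ z : EE, z ∈ closedBall (0:EE) r1 ↔ ‖z‖ ≤ r1 := fun z => by simp
  have e2 : ∀ z : EE, z ∈ closedBall s0 ℓ ↔ ‖z - s0‖ ≤ ℓ := fun z => by simp [dist_eq_norm]
  obtain ⟨x, y, hx, hy, hpos, hmax⟩ := exists_max hG (isCompact_closedBall (0:EE) r1)
    (isCompact_closedBall s0 ℓ) (fun x y hx hy => hU x y ((e1 _).1 hx) ((e2 _).1 hy))
    (A := fun z => inner ℝ p z + ψ ‖z‖) (B := fun s => inner ℝ (0:EE) s + k * ‖s - s0‖ ^ 2)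
    (by fun_prop) (by fun_prop) (b := 0) (x0 := x0) (y0 := y0) ((e1 _).2 h1) ((e2 _).2 (by simp [h2, hℓ.le]))
    (by simp [h2]; linarith)
  have hx' := (e1 _).1 hx
  have hy' := (e2 _).1 hy
  obtain ⟨hxU, hyU⟩ := hU x y hx' hy'
  set z := x - y with hz
  set σ := ‖x + y - s0‖ with hσ
  simp only [inner_zero_left, zero_add] at hpos
  have hkσ : 0 ≤ k * σ ^ 2 := by positivity
  have hz0 : z ≠ 0 := by
    intro h0
    have : x = y := sub_eq_zero.1 h0
    rw [h0] at hpos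
    simp only [inner_zero_right, norm_zero, hψ0] at hpos
    have := hG.le x hxU
    rw [‹x = y›] at this hpos
    linarith
  have hr0 : 0 < ‖z‖ := norm_pos_iff.2 hz0
  have hVz := hV x y hx' hy'
  have hrlt : ‖z‖ < r1 := by
    rcases hx'.lt_or_eq with h | h
    · exact h
    · have := hV1 x y h hy'
      rw [h] at hpos
      linarith
  have hσlt : σ < ℓ := by
    rcases hy'.lt_or_eq with h | h
    · exact h
    · have := hwℓ ‖z‖ hr0 hx'
      rw [h] at hpos
      linarith
  have hmax' := hmax (by
      rw [interior_closedBall _ hr1.ne']; simpa using hrlt) (by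
      rw [interior_closedBall _ hℓ.ne']; simpa [dist_eq_norm] using hσlt)
  have hnh : ∀ᶠ s in 𝓝 ‖z‖, HasDerivAt ψ (ψ1 s) s := by
    filter_upwards [Ioo_mem_nhds hr0 hrlt] with s hs
    exact hd1 s hs.1 hs.2
  have hUTA := UT_radial (p := p) hz0 hnh (hd2 ‖z‖ hr0 hrlt)
  have hUTB := UT_quad (0:EE) s0 (x + y) 0 k
  have he : ‖(‖z‖⁻¹ • z : EE)‖ = 1 := by
    rw [norm_smul, norm_inv, norm_norm, inv_mul_cancel₀ hr0.ne']
  set e := (‖z‖⁻¹ • z : EE) with hed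
  have ht := touch_refl hG hxU hyU he hUTA hUTB hmax' (hψ2 _ hr0 hrlt).1 (hψ2 _ hr0 hrlt).2 hk
  rw [zero_add] at ht
  have hψ10 : 0 ≤ ψ1 ‖z‖ := by
    have h1 := hψ2 _ hr0 hrlt
    have h2 : 0 ≤ ψ1 ‖z‖ / ‖z‖ := h1.1.trans h1.2
    have := mul_nonneg h2 hr0.le
    rwa [div_mul_cancel₀ _ hr0.ne'] at this
  have hg' : ‖(2 * k) • (x + y - s0)‖ = 2 * (k * σ) := by
    rw [norm_smul, Real.norm_of_nonneg (by positivity)]; ring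
  set g' := (2 * k) • (x + y - s0) with hg'd
  have hT : sq1 (p + ψ1 ‖z‖ • e - g') ≤ 1 + ‖p‖ + ψ1 ‖z‖ + 2 * (k * σ) := by
    refine (sq1_le_add _).trans ?_
    have a1 := norm_sub_le (p + ψ1 ‖z‖ • e) g'
    have a2 := norm_add_le p (ψ1 ‖z‖ • e)
    rw [norm_smul, he, Real.norm_of_nonneg hψ10, mul_one] at a2
    linarith
  set T := 1 + ‖p‖ + ψ1 ‖z‖ + 2 * (k * σ) with hTd
  have hs0 := (sq1_pos (p + ψ1 ‖z‖ • e - g')).le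
  have hfin := hineq ‖z‖ σ hr0 hrlt (norm_nonneg _) hσlt.le (by linarith)
  rw [hg'] at ht
  have b1 : sq1 (p + ψ1 ‖z‖ • e - g') ^ 2 * (8 * N * k + 2 * H₀ * (2 * (k * σ))) ≤
      T ^ 2 * (8 * N * k + 4 * H₀ * (k * σ)) := by
    have : 0 ≤ 8 * N * k + 4 * H₀ * (k * σ) := by positivity
    rw [show 2 * H₀ * (2 * (k * σ)) = 4 * H₀ * (k * σ) by ring]
    gcongr
  have b2 : Λ * ‖z‖ * sq1 (p + ψ1 ‖z‖ • e - g') ^ 3 ≤ Λ * ‖z‖ * T ^ 3 := by gcongr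
  have b3 : 100 * (N + 1) * (ψ1 ‖z‖ / ‖z‖) * (2 * (k * σ)) ^ 2
      = 400 * (N + 1) * (ψ1 ‖z‖ / ‖z‖) * (k * σ) ^ 2 := by ring
  linarith
end MX


section LIN
variable {N : ℕ}
local notation "EE" => EuclideanSpace ℝ (Fin N)

lemma lin_ineq {n ρ3 ω τ r1 ℓ T0 T H₀ Λ r m kσ k a : ℝ} (hn : 0 ≤ n) (hr1 : 0 < r1) (hℓ : 0 < ℓ) (hℓ1 : ℓ ≤ 1)
    (hω : 0 < ω) (hτ : 0 ≤ τ) (hτω : τ ≤ 24 * ω) (hτT : τ ≤ T0) (hρT : ρ3 ≤ T0) (h3 : 0 ≤ ρ3) (hT0 : 0 ≤ T)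
    (hT : T ≤ T0) (hc : 19200 * (n + 1) * T0 ^ 2 * r1 ^ 2 ≤ ℓ ^ 2) (hH : 0 ≤ H₀) (hH1 : H₀ ≤ 1)
    (hΛ : 0 ≤ Λ) (hΛ1 : Λ * r1 ^ 2 * T0 ^ 3 ≤ ω / 8) (hr : 0 < r) (hm : 0 < m) (hmr : m ^ 2 = r * r1)
    (hrm : r ≤ m) (hm1 : m ≤ r1) (hk : k = τ * r1 / ℓ ^ 2) (hkσ0 : 0 ≤ kσ) (hkσ : kσ ≤ τ * r1 / ℓ)
    (hkσ2 : kσ ^ 2 ≤ τ ^ 2 * r1 * m / ℓ ^ 2) (ha : a ≤ ρ3) (ha0 : 0 ≤ a) :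
    400 * (n + 1) * (a / r) * kσ ^ 2 + T ^ 2 * (8 * n * k + 4 * H₀ * kσ) + Λ * r * T ^ 3
      < 2 * (3 / 4 * ω / m) := by
  have hTT : 0 ≤ T0 := hT0.trans hT
  have hQ : T0 ^ 2 * r1 ^ 2 / ℓ ^ 2 ≤ 1 / (19200 * (n + 1)) := by
    rw [div_le_div_iff₀ (by positivity) (by positivity)]; linarith
  have A1 : 400 * (n + 1) * (a / r) * kσ ^ 2 ≤ (1 / 2 * ω) / m := by
    have e1 : 400 * (n + 1) * (a / r) * kσ ^ 2 ≤ 400 * (n + 1) * (T0 / r) * (τ ^ 2 * r1 * m / ℓ ^ 2) := by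
      gcongr
      linarith
    have e2 : 400 * (n + 1) * (T0 / r) * (τ ^ 2 * r1 * m / ℓ ^ 2) =
        400 * (n + 1) * T0 * τ ^ 2 * (r1 ^ 2 / ℓ ^ 2) / m := by
      have : r = m ^ 2 / r1 := by rw [hmr]; field_simp
      rw [this]; field_simp
    have e3 : 400 * (n + 1) * T0 * τ ^ 2 * (r1 ^ 2 / ℓ ^ 2) ≤ 1 / 2 * ω := by
      have : τ ^ 2 ≤ T0 * (24 * ω) := by rw [sq]; gcongr
      calc 400 * (n + 1) * T0 * τ ^ 2 * (r1 ^ 2 / ℓ ^ 2)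
          ≤ 400 * (n + 1) * T0 * (T0 * (24 * ω)) * (r1 ^ 2 / ℓ ^ 2) := by gcongr
        _ = 9600 * (n + 1) * ω * (T0 ^ 2 * r1 ^ 2 / ℓ ^ 2) := by ring
        _ ≤ 9600 * (n + 1) * ω * (1 / (19200 * (n + 1))) := by gcongr
        _ = 1 / 2 * ω := by field_simp; ring
    refine e1.trans ?_
    rw [e2]; gcongr
  have A2 : T ^ 2 * (8 * n * k + 4 * H₀ * kσ) ≤ (1 / 2 * ω) / m := by
    rw [le_div_iff₀ hm, hk]
    have hlr : τ * r1 / ℓ ≤ τ * r1 / ℓ ^ 2 := by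
      gcongr; nlinarith
    calc T ^ 2 * (8 * n * (τ * r1 / ℓ ^ 2) + 4 * H₀ * kσ) * m
        ≤ T0 ^ 2 * (8 * n * (τ * r1 / ℓ ^ 2) + 4 * 1 * (τ * r1 / ℓ ^ 2)) * r1 := by
          gcongr; exact hkσ.trans hlr
      _ = (8 * n + 4) * τ * (T0 ^ 2 * r1 ^ 2 / ℓ ^ 2) := by ring
      _ ≤ (8 * (n + 1)) * (24 * ω) * (1 / (19200 * (n + 1))) := by gcongr; linarith
      _ = 1 / 100 * ω := by field_simp; ring
      _ ≤ _ := by linarith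
  have A3 : Λ * r * T ^ 3 ≤ (1 / 8 * ω) / m := by
    rw [le_div_iff₀ hm]
    calc Λ * r * T ^ 3 * m ≤ Λ * r1 * T0 ^ 3 * r1 := by gcongr; linarith
      _ = Λ * r1 ^ 2 * T0 ^ 3 := by ring
      _ ≤ _ := by linarith
  have A4 : 2 * (3 / 4 * ω / m) = (1 / 2 * ω) / m + (1 / 2 * ω) / m + (1 / 2 * ω) / m := by ring
  have A5 : (1 / 8 * ω) / m < (1 / 2 * ω) / m := by gcongr; linarith
  linarith

lemma LIN {U : Set EE} {v u : EE → ℝ} {Λ H₀ : ℝ} (hG : Good U v u Λ H₀) (hΛ : 0 ≤ Λ) (hH : 0 ≤ H₀)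
    (hH1 : H₀ ≤ 1) {p s0 : EE} {ℓ r1 ρ2 ω τ T0 : ℝ} (hℓ : 0 < ℓ) (hℓ1 : ℓ ≤ 1) (hr1 : 0 < r1) (hω : 0 < ω)
    (hωρ : 5 * ω ≤ 4 * ρ2) (hτ : 0 ≤ τ) (hτω : τ ≤ 24 * ω) (hτT : τ ≤ T0)
    (hT : 1 + ‖p‖ + ρ2 + ω + 2 * (τ * r1 / ℓ) ≤ T0)
    (hc : 19200 * (N + 1) * T0 ^ 2 * r1 ^ 2 ≤ ℓ ^ 2) (hΛ1 : Λ * r1 ^ 2 * T0 ^ 3 ≤ ω / 8)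
    (hU : ∀ x y, ‖x - y‖ ≤ r1 → ‖x + y - s0‖ ≤ ℓ → x ∈ U ∧ y ∈ U)
    (hV : ∀ x y, ‖x - y‖ ≤ r1 → ‖x + y - s0‖ ≤ ℓ →
      v x - u y ≤ inner ℝ p (x - y) + (ρ2 * ‖x - y‖ + τ * √(‖x - y‖ * r1)))
    (hV1 : ∀ x y, ‖x - y‖ = r1 → ‖x + y - s0‖ ≤ ℓ → v x - u y ≤ inner ℝ p (x - y) + ρ2 * r1) :
    ∀ x y, ‖x - y‖ ≤ r1 → x + y = s0 → v x - u y ≤ inner ℝ p (x - y) + (ρ2 + ω) * ‖x - y‖ := by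
  have hmp : ∀ r, 0 < r → r ≤ r1 → 0 < √(r * r1) ∧ √(r * r1) ^ 2 = r * r1 ∧ r ≤ √(r * r1) ∧ √(r * r1) ≤ r1 := by
    intro r h0 h1
    refine ⟨Real.sqrt_pos.2 (by positivity), Real.sq_sqrt (by positivity), Real.le_sqrt_of_sq_le (by nlinarith), ?_⟩
    rw [Real.sqrt_le_left hr1.le]; nlinarith
  have hρ2 : 0 < ρ2 := by linarith
  have key := IL_max hG hΛ hH (p := p) (s0 := s0) (ℓ := ℓ) (r1 := r1) (k := τ * r1 / ℓ ^ 2) hℓ hr1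
    (by positivity) hU (ψ := fun r => (ρ2 + ω) * r - ω / r1 * (r * √(r * r1)))
    (ψ1 := fun r => (ρ2 + ω) - 3 / 2 * (ω / r1) * √(r * r1)) (ψ2 := fun r => 3 / 4 * ω / √(r * r1))
    (w := fun r => ρ2 * r + τ * √(r * r1)) (by fun_prop) (by simp) ?_ ?_ ?_ hV ?_ ?_ ?_
  · intro x y h1 h2
    refine (key x y h1 h2).trans ?_
    have : 0 ≤ ω / r1 * (‖x - y‖ * √(‖x - y‖ * r1)) := by positivity
    linarith
  · intro r h0 h1
    obtain ⟨m1, m2, m3, m4⟩ := hmp r h0 h1.le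
    have d1 : HasDerivAt (fun r => √(r * r1)) ((1 * r1) / (2 * √(r * r1))) r :=
      ((hasDerivAt_id' r).mul_const r1).sqrt (by positivity)
    have d2 := ((hasDerivAt_id' r).const_mul (ρ2 + ω)).sub (((hasDerivAt_id' r).mul d1).const_mul (ω / r1))
    refine d2.congr_deriv ?_
    have : r * (1 * r1 / (2 * √(r * r1))) = √(r * r1) / 2 := by
      rw [one_mul, ← mul_div_assoc, div_eq_div_iff (by positivity) (by norm_num)]; linarith
    rw [this]; ring
  · intro r h0 h1
    obtain ⟨m1, m2, m3, m4⟩ := hmp r h0 h1.le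
    have d1 : HasDerivAt (fun r => √(r * r1)) ((1 * r1) / (2 * √(r * r1))) r :=
      ((hasDerivAt_id' r).mul_const r1).sqrt (by positivity)
    refine ((d1.const_mul (3 / 2 * (ω / r1))).const_sub (ρ2 + ω)).congr_deriv ?_
    field_simp; ring
  · intro r h0 h1
    obtain ⟨m1, m2, m3, m4⟩ := hmp r h0 h1.le
    refine ⟨by positivity, ?_⟩
    rw [div_le_div_iff₀ m1 h0]
    have : 3 / 2 * (ω / r1) * √(r * r1) ≤ 3 / 2 * (ω / r1) * r1 := by gcongr
    rw [show 3 / 2 * (ω / r1) * r1 = 3 / 2 * ω by field_simp] at this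
    have h2 : 3 / 4 * ω ≤ (ρ2 + ω) - 3 / 2 * (ω / r1) * √(r * r1) := by linarith
    have h3 : 3 / 4 * ω * r ≤ 3 / 4 * ω * √(r * r1) := by gcongr
    have h4 := mul_le_mul_of_nonneg_right h2 m1.le
    linarith
  · intro x y h1 h2
    refine (hV1 x y h1 h2).trans (le_of_eq ?_)
    rw [Real.sqrt_mul_self hr1.le]; field_simp; ring
  · intro r h0 h1
    obtain ⟨m1, m2, m3, m4⟩ := hmp r h0 h1
    have : τ * r1 / ℓ ^ 2 * ℓ ^ 2 = τ * r1 := by field_simp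
    rw [this]
    have a1 : τ * √(r * r1) ≤ τ * r1 := by gcongr
    have a2 : ω / r1 * (r * √(r * r1)) ≤ ω / r1 * (r * r1) := by gcongr
    rw [show ω / r1 * (r * r1) = ω * r by field_simp] at a2
    linarith
  · intro r σ h0 h1 hσ0 hσ hkσ
    obtain ⟨m1, m2, m3, m4⟩ := hmp r h0 h1.le
    have a0 : (0:ℝ) ≤ 3 / 2 * (ω / r1) * √(r * r1) := by positivity
    have a1 : 3 / 2 * (ω / r1) * √(r * r1) ≤ 3 / 2 * (ω / r1) * r1 := by gcongr
    rw [show 3 / 2 * (ω / r1) * r1 = 3 / 2 * ω by field_simp] at a1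
    have a2 : ω / r1 * (r * √(r * r1)) ≤ ω / r1 * (r * r1) := by gcongr
    rw [show ω / r1 * (r * r1) = ω * r by field_simp] at a2
    have hks : τ * r1 / ℓ ^ 2 * σ ^ 2 ≤ τ * √(r * r1) := by linarith
    have hks1 : τ * r1 / ℓ ^ 2 * σ ≤ τ * r1 / ℓ := by
      calc τ * r1 / ℓ ^ 2 * σ ≤ τ * r1 / ℓ ^ 2 * ℓ := by gcongr
        _ = _ := by field_simp
    have hks0 : 0 ≤ τ * r1 / ℓ ^ 2 * σ := by positivity
    have hp := norm_nonneg p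
    have hx : 0 ≤ τ * r1 / ℓ := by positivity
    refine lin_ineq (n := (N:ℝ)) (ρ3 := ρ2 + ω) (τ := τ) (r1 := r1) (ℓ := ℓ) (T0 := T0) (by positivity) hr1 hℓ hℓ1 hω hτ hτω hτT (by linarith)
      (by linarith) (by linarith) (by linarith) hc hH hH1 hΛ hΛ1 h0 m1 m2 m3 m4 rfl hks0 hks1 ?_ (by linarith) (by linarith)
    calc (τ * r1 / ℓ ^ 2 * σ) ^ 2 = τ * r1 / ℓ ^ 2 * (τ * r1 / ℓ ^ 2 * σ ^ 2) := by ring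
      _ ≤ τ * r1 / ℓ ^ 2 * (τ * √(r * r1)) := by gcongr
      _ = _ := by ring
end LIN


section HOL
variable {N : ℕ}
local notation "EE" => EuclideanSpace ℝ (Fin N)

lemma Good.mono {U U' : Set EE} {v u : EE → ℝ} {Λ H₀ Λ' H₀' : ℝ} (hG : Good U v u Λ H₀) (hUU : U' ⊆ U)
    (h1 : Λ ≤ Λ') (h2 : H₀ ≤ H₀') : Good U' v u Λ' H₀' where
  usc := fun x hx => (hG.usc x (hUU hx)).mono hUU
  lsc := fun x hx => (hG.lsc x (hUU hx)).mono hUU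
  le := fun x hx => hG.le x (hUU hx)
  key := by
    intro x hx y hy p q e f α β α' β' b b' h
    have := hG.key x (hUU hx) y (hUU hy) p q e f α β α' β' b b' h
    have a1 : Λ * ‖x - y‖ * sq1 q ≤ Λ' * ‖x - y‖ * sq1 q := by
      have := (sq1_pos q).le
      gcongr
    have a2 : H₀ * ‖p - q‖ ≤ H₀' * ‖p - q‖ := by gcongr
    linarith

lemma Bq_div (α β α' β' R : ℝ) (e f h l : EE) :
    Bq (α / R) (β / R) (α' / R) (β' / R) e f h l = Bq α β α' β' e f h l / R := by
  unfold Bq; ring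

lemma Bq_smul (α β α' β' R : ℝ) (e f h l : EE) :
    Bq α β α' β' e f (R • h) (R • l) = R ^ 2 * Bq α β α' β' e f h l := by
  unfold Bq
  rw [← smul_sub, ← smul_add, norm_smul, norm_smul, inner_smul_right, inner_smul_right, mul_pow, mul_pow,
    Real.norm_eq_abs, sq_abs, mul_pow, sq_abs]; ring

lemma Good.scale {U U' : Set EE} {v u : EE → ℝ} {Λ H₀ : ℝ} (hG : Good U v u Λ H₀) {R : ℝ} (hR : 0 < R) (c : EE)
    (hUU : ∀ x ∈ U', c + R • x ∈ U) :
    Good U' (fun x => v (c + R • x) / R) (fun x => u (c + R • x) / R) (R ^ 2 * Λ) (R * H₀) where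
  usc := by
    have h1 : UpperSemicontinuousOn (fun x => v (c + R • x)) U' :=
      UpperSemicontinuousOn.comp hG.usc (f := v) (g := fun x : EE => c + R • x) (by fun_prop) hUU
    intro x hx t ht
    filter_upwards [h1 x hx (t * R) (by rwa [div_lt_iff₀ hR] at ht)] with z hz
    rwa [div_lt_iff₀ hR]
  lsc := by
    have h1 : LowerSemicontinuousOn (fun x => u (c + R • x)) U' :=
      LowerSemicontinuousOn.comp hG.lsc (f := u) (g := fun x : EE => c + R • x) (by fun_prop) hUU
    intro x hx t ht
    filter_upwards [h1 x hx (t * R) ((lt_div_iff₀ hR).1 ht)] with z hz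
    exact (lt_div_iff₀ hR).2 hz
  le := fun x hx => by
    have := hG.le _ (hUU x hx)
    gcongr
  key := by
    intro x hx y hy p q e f α β α' β' b b' h
    have := hG.key _ (hUU x hx) _ (hUU y hy) p q e f (α / R) (β / R) (α' / R) (β' / R) b b' ?_
    · simp only [Bq_div] at this
      rw [← Finset.sum_div, le_div_iff₀ hR, show c + R • x - (c + R • y) = R • (x - y) by rw [smul_sub]; abel,
        norm_smul, Real.norm_of_nonneg hR.le] at this
      refine le_trans (le_of_eq ?_) this
      ring
    · intro η hη
      have t : Tendsto (fun d : EE × EE => R⁻¹ • d) (𝓝 0) (𝓝 0) := by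
        have : Continuous (fun d : EE × EE => R⁻¹ • d) := by fun_prop
        simpa using this.tendsto 0
      filter_upwards [t.eventually (h (η * R) (by positivity))] with d hd
      have e1 : ∀ x w : EE, c + R • (x + R⁻¹ • w) = c + R • x + w := by
        intro x w
        rw [smul_add, smul_smul, mul_inv_cancel₀ hR.ne', one_smul, add_assoc]
      simp only [Prod.smul_fst, Prod.smul_snd, e1, Bq_smul, inner_smul_right, norm_smul, mul_pow] at hd
      rw [Bq_div]
      rw [norm_inv, Real.norm_of_nonneg hR.le] at hd
      have h3 := mul_le_mul_of_nonneg_right hd hR.le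
      have l1 : (v (c + R • x + d.1) / R - u (c + R • y + d.2) / R) * R
        = v (c + R • x + d.1) - u (c + R • y + d.2) := by field_simp
      rw [l1] at h3
      refine h3.trans (le_of_eq ?_)
      field_simp

lemma usc_strip {U : Set EE} {v u : EE → ℝ} {Λ H₀ : ℝ} (hG : Good U v u Λ H₀) {Ks : Set EE} (hKs : IsCompact Ks)
    {r : ℝ} (hr : 0 < r) (hU : ∀ x y, ‖x - y‖ ≤ r → x + y ∈ Ks → x ∈ U ∧ y ∈ U) {M : ℝ}
    (hd : ∀ x, x + x ∈ Ks → v x - u x < M) :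
    ∃ r0 > 0, r0 ≤ r ∧ ∃ M' < M, ∀ x y, ‖x - y‖ ≤ r0 → x + y ∈ Ks → v x - u y ≤ M' := by
  by_cases hne : ∃ r0 > 0, r0 ≤ r ∧ ∀ x y, ‖x - y‖ ≤ r0 → x + y ∈ Ks → v x - u y < M
  · obtain ⟨r0, h0, h0r, h1⟩ := hne
    refine ⟨r0, h0, h0r, ?_⟩
    have husc := V_usc hG.usc hG.lsc (R := Reg (closedBall 0 r0) Ks)
      (fun w hw => hU w.1 w.2 (by have := hw.1; simp at this; linarith) hw.2)
      (f := fun w => 0) (by fun_prop)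
    rcases (Reg (closedBall (0:EE) r0) Ks).eq_empty_or_nonempty with he | he
    · refine ⟨M - 1, by linarith, fun x y hx hy => ?_⟩
      have : (x, y) ∈ Reg (closedBall (0:EE) r0) Ks := ⟨by simpa using hx, hy⟩
      rw [he] at this; exact absurd this (by simp)
    · obtain ⟨w, hw, hmax⟩ := UpperSemicontinuousOn.exists_isMaxOn he
        (Reg_compact (isCompact_closedBall _ _) hKs) husc
      refine ⟨v w.1 - u w.2, h1 _ _ (by simpa using hw.1) hw.2, fun x y hx hy => ?_⟩
      have := hmax (show (x, y) ∈ Reg (closedBall (0:EE) r0) Ks from ⟨by simpa using hx, hy⟩)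
      simpa using this
  · exfalso
    push Not at hne
    have hseq : ∀ n : ℕ, ∃ w : EE × EE, ‖w.1 - w.2‖ ≤ r / (n + 1) ∧ w.1 + w.2 ∈ Ks ∧ M ≤ v w.1 - u w.2 := by
      intro n
      obtain ⟨x, y, h1, h2, h3⟩ := hne (r / (n + 1)) (by positivity) (div_le_self hr.le (by linarith [n.cast_nonneg (α := ℝ)]))
      exact ⟨(x, y), h1, h2, h3⟩
    choose w hw1 hw2 hw3 using hseq
    have hin : ∀ n, w n ∈ Reg (closedBall (0:EE) r) Ks := fun n =>
      ⟨by simpa using (hw1 n).trans (div_le_self hr.le (by linarith [n.cast_nonneg (α := ℝ)])), hw2 n⟩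
    obtain ⟨a, ha, φ, hφ, hlim⟩ := (Reg_compact (isCompact_closedBall (0:EE) r) hKs).tendsto_subseq hin
    have husc := V_usc hG.usc hG.lsc (R := Reg (closedBall 0 r) Ks)
      (fun w hw => hU w.1 w.2 (by simpa using hw.1) hw.2)
      (f := fun w => 0) (by fun_prop)
    have hz : a.1 - a.2 = 0 := by
      have l1 : Tendsto (fun n => ‖(w (φ n)).1 - (w (φ n)).2‖) atTop (𝓝 ‖a.1 - a.2‖) := by
        have : Continuous (fun w : EE × EE => ‖w.1 - w.2‖) := by fun_prop
        exact (this.tendsto a).comp hlim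
      have l2 : Tendsto (fun n : ℕ => r / ((φ n : ℝ) + 1)) atTop (𝓝 0) := by
        have : Tendsto (fun n : ℕ => r / ((n : ℝ) + 1)) atTop (𝓝 0) := by
          have := (tendsto_one_div_add_atTop_nhds_zero_nat (𝕜 := ℝ)).const_mul r
          simpa [div_eq_mul_inv] using this
        exact this.comp hφ.tendsto_atTop
      have := le_of_tendsto_of_tendsto' l1 l2 (fun n => hw1 (φ n))
      exact norm_le_zero_iff.1 this
    have hxy : a.1 = a.2 := sub_eq_zero.1 hz
    have := hd a.1 (by have := ha.2; rwa [← hxy] at this)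
    have hev := husc a ha M (by simp only [sub_zero]; rw [← hxy]; exact this)
    have hlim' : Tendsto (w ∘ φ) atTop (𝓝[Reg (closedBall (0:EE) r) Ks] a) :=
      tendsto_nhdsWithin_iff.2 ⟨hlim, Eventually.of_forall fun n => hin _⟩
    obtain ⟨n, hn⟩ := (hlim'.eventually hev).exists
    have := hw3 (φ n)
    simp at hn
    linarith
end HOL


section HOL
variable {N : ℕ}
local notation "EE" => EuclideanSpace ℝ (Fin N)

lemma mem_of_sz {x y : EE} {a b c : ℝ} (h1 : ‖x - y‖ ≤ a) (h2 : ‖x + y‖ ≤ b) (h : a + b < 2 * c) :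
    x ∈ ball (0:EE) c ∧ y ∈ ball (0:EE) c := by
  have e := half_recover' x y
  constructor
  · rw [mem_ball_zero_iff, ← e.1, norm_smul]
    have := norm_add_le (x + y) (x - y)
    rw [Real.norm_of_nonneg (by norm_num)]; linarith
  · rw [mem_ball_zero_iff, ← e.2, norm_smul]
    have := norm_sub_le (x + y) (x - y)
    rw [Real.norm_of_nonneg (by norm_num)]; linarith

lemma norm_of_sub {s s0 : EE} {a b : ℝ} (h1 : ‖s - s0‖ ≤ a) (h2 : ‖s0‖ ≤ b) : ‖s‖ ≤ a + b := by
  have := norm_add_le (s - s0) s0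
  simp at this; linarith

lemma holder_ineq {n B M r q kσ k H₀ Λ T a c : ℝ} (hn : 0 ≤ n) (hM : M = 1 / (200 * (n + 1)))
    (hB : 1 ≤ B) (hq : 0 < q) (hqr : q ^ 2 = r) (hqB : B * q ≤ M) (hk : k = 4 * M)
    (hkσ0 : 0 ≤ kσ) (hkσ1 : kσ ≤ 2 * M) (hkσ2 : kσ ^ 2 ≤ 4 * M ^ 2) (hH : 0 ≤ H₀) (hH1 : H₀ ≤ 1)
    (hΛ : 0 ≤ Λ) (hΛ1 : Λ ≤ 1) (ha : a = B / (2 * q)) (hc : c = B / (4 * (r * q)))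
    (hT : T = 1 + 0 + a + 2 * kσ) :
    400 * (n + 1) * (a / r) * kσ ^ 2 + T ^ 2 * (8 * n * k + 4 * H₀ * kσ) + Λ * r * T ^ 3 < 2 * c := by
  have hM0 : 0 < M := by rw [hM]; positivity
  have hMn : (n + 1) * M = 1 / 200 := by rw [hM]; field_simp
  have hM1 : M ≤ 1 / 200 := by nlinarith
  have hq1 : q ≤ M := by nlinarith
  have ha1 : 1 ≤ a := by
    rw [ha, le_div_iff₀ (by positivity)]; linarith
  have hT0 : 0 ≤ T := by rw [hT]; positivity
  have hT3 : T ≤ 3 * a := by rw [hT]; linarith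
  have hr : 0 < r := by rw [← hqr]; positivity
  -- let D = B / (r q)
  set D := B / (r * q) with hD
  have hD0 : 0 < D := by positivity
  have e1 : a / r = D / 2 := by rw [ha, hD]; field_simp
  have e2 : 2 * c = D / 2 := by rw [hc, hD]; field_simp; norm_num
  have e3 : a ^ 2 = D * (B * q) / 4 := by rw [ha, hD, ← hqr]; field_simp; norm_num
  have e4 : r * a ^ 3 = D * (B * q) ^ 2 / 8 := by rw [ha, hD, ← hqr]; field_simp; norm_num
  have A1 : 400 * (n + 1) * (a / r) * kσ ^ 2 ≤ D / 8 := by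
    rw [e1]
    calc 400 * (n + 1) * (D / 2) * kσ ^ 2 ≤ 400 * (n + 1) * (D / 2) * (4 * M ^ 2) := by gcongr
      _ = 800 * D * M * ((n + 1) * M) := by ring
      _ = 4 * D * M := by rw [hMn]; ring
      _ ≤ 4 * D * (1 / 200) := by gcongr
      _ ≤ _ := by linarith
  have A2 : T ^ 2 * (8 * n * k + 4 * H₀ * kσ) ≤ D / 8 := by
    calc T ^ 2 * (8 * n * k + 4 * H₀ * kσ) ≤ (3 * a) ^ 2 * (8 * n * (4 * M) + 4 * 1 * (2 * M)) := by
          rw [hk]; gcongr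
      _ ≤ (3 * a) ^ 2 * (32 * ((n + 1) * M)) := by gcongr; linarith
      _ = 9 * (D * (B * q) / 4) * (32 / 200) := by rw [hMn, ← e3]; ring
      _ ≤ 9 * (D * (1 / 200) / 4) * (32 / 200) := by gcongr; linarith
      _ ≤ _ := by linarith
  have A3 : Λ * r * T ^ 3 ≤ D / 8 := by
    calc Λ * r * T ^ 3 ≤ 1 * r * (3 * a) ^ 3 := by gcongr
      _ = 27 * (D * (B * q) ^ 2 / 8) := by rw [← e4]; ring
      _ ≤ 27 * (D * (1 / 200) ^ 2 / 8) := by gcongr; linarith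
      _ ≤ _ := by linarith
  linarith

lemma holder {v u : EE → ℝ} {Λ H₀ : ℝ} (hG : Good (ball (0:EE) 1) v u Λ H₀) (hΛ : 0 ≤ Λ) (hΛ1 : Λ ≤ 1)
    (hH : 0 ≤ H₀) (hH1 : H₀ ≤ 1) : ∃ B ≥ 1, ∃ r1 > 0, r1 ≤ 1 / 2 ∧ ∀ x y : EE, ‖x - y‖ ≤ r1 → ‖x + y‖ ≤ 1 / 2 →
    v x - u y ≤ B * √‖x - y‖ := by
  obtain ⟨M, hM⟩ : ∃ M : ℝ, M = 1 / (200 * ((N:ℝ) + 1)) := ⟨_, rfl⟩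
  have hM0 : 0 < M := by rw [hM]; positivity
  have hM1 : M ≤ 1 / 200 := by
    rw [hM]; gcongr; linarith [N.cast_nonneg (α := ℝ)]
  obtain ⟨r0, hr0, hr0', M', hM', hs⟩ := usc_strip hG (isCompact_closedBall (0:EE) 1) (r := 1 / 2) (by norm_num)
    (fun x y h1 h2 => mem_of_sz h1 (by simpa using h2) (by norm_num)) (M := M) (by
      intro x hx
      have hxx : ‖x + x‖ ≤ 1 := by simpa using hx
      have := (mem_of_sz (x := x) (y := x) (a := 0) (c := 1) (by simp) hxx (by norm_num)).1
      have := hG.le x this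
      linarith)
  obtain ⟨B, hB1, hBr⟩ : ∃ B : ℝ, 1 ≤ B ∧ (M / B) ^ 2 ≤ r0 := by
    refine ⟨1 + 1 / r0, by linarith [show 0 < 1 / r0 by positivity], ?_⟩
    have h1 : M / (1 + 1 / r0) ≤ r0 := by
      rw [div_le_iff₀ (by positivity)]
      have : r0 * (1 + 1 / r0) = r0 + 1 := by field_simp
      linarith
    have h2 : M / (1 + 1 / r0) ≤ 1 := by
      rw [div_le_iff₀ (by positivity)]
      have : 0 < 1 / r0 := by positivity
      linarith
    have h3 : 0 ≤ M / (1 + 1 / r0) := by positivity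
    nlinarith
  have hr1 : 0 < (M / B) ^ 2 := by positivity
  refine ⟨B, hB1, (M / B) ^ 2, hr1, by linarith, ?_⟩
  intro x y hxy hxs
  have hq : ∀ r, 0 ≤ r → r ≤ (M / B) ^ 2 → B * √r ≤ M := by
    intro r h0 h1
    have : √r ≤ M / B := by
      rw [Real.sqrt_le_left (by positivity)]; exact h1
    rw [le_div_iff₀ (by positivity)] at this
    linarith
  have hnear : ∀ x' y' : EE, ‖x' + y' - (x + y)‖ ≤ 1 / 2 → ‖x' + y'‖ ≤ 1 := by
    intro x' y' h
    have := norm_of_sub h hxs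
    linarith
  have key := IL_max hG hΛ hH (p := 0) (s0 := x + y) (ℓ := 1 / 2) (r1 := (M / B) ^ 2) (k := 4 * M) (by norm_num) hr1
    (by positivity) (fun x' y' h1 h2 => mem_of_sz h1 (hnear _ _ h2) (by linarith))
    (ψ := fun r => B * √r) (ψ1 := fun r => B / (2 * √r)) (ψ2 := fun r => B / (4 * (r * √r)))
    (w := fun r => M) (by fun_prop) (by simp) ?_ ?_ ?_ ?_ ?_ ?_ ?_
  · simpa using key x y hxy rfl
  · intro r h0 h1
    exact ((Real.hasDerivAt_sqrt h0.ne').const_mul B).congr_deriv (by ring)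
  · intro r h0 h1
    have h2 : 0 < √r := Real.sqrt_pos.2 h0
    have := ((((Real.hasDerivAt_sqrt h0.ne').const_mul 2).inv (by positivity)).const_mul B)
    refine (this.congr_deriv ?_).congr_of_eventuallyEq ?_
    · have h3 : √r ^ 2 = r := Real.sq_sqrt h0.le
      rw [mul_pow, h3]; field_simp; norm_num
    · exact Eventually.of_forall fun s => by simp [div_eq_mul_inv]
  · intro r h0 h1
    have h2 : 0 < √r := Real.sqrt_pos.2 h0
    refine ⟨by positivity, ?_⟩
    rw [div_div]
    apply div_le_div_of_nonneg_left (by positivity) (by positivity)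
    nlinarith [mul_pos h0 h2]
  · intro x' y' h1 h2
    have := hs x' y' (h1.trans hBr) (by simpa using hnear _ _ h2)
    simp; linarith
  · intro x' y' h1 h2
    have := hs x' y' (h1.le.trans hBr) (by simpa using hnear _ _ h2)
    have e : B * √((M / B) ^ 2) = M := by
      rw [Real.sqrt_sq (by positivity)]; field_simp
    simp only [inner_zero_left, zero_add, e]; linarith
  · intro r h0 h1
    have : 0 ≤ B * √r := by positivity
    linarith
  · intro r σ h0 h1 hσ hσ2 hk
    have h2 : 0 < √r := Real.sqrt_pos.2 h0
    have hBq : 0 ≤ B * √r := by positivity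
    have hk' : 4 * M * σ ^ 2 ≤ M := by linarith
    refine holder_ineq (n := (N:ℝ)) (M := M) (B := B) (q := √r) (r := r) (k := 4 * M) (kσ := 4 * M * σ) (a := B / (2 * √r))
      (by positivity) hM hB1 h2
      (Real.sq_sqrt h0.le) (hq r h0.le h1.le) rfl (by positivity) (by nlinarith) ?_ hH hH1 hΛ hΛ1 rfl rfl (by simp)
    calc (4 * M * σ) ^ 2 = 4 * M * (4 * M * σ ^ 2) := by ring
      _ ≤ 4 * M * M := by gcongr
      _ = _ := by ring

lemma lip_local {v u : EE → ℝ} {Λ H₀ : ℝ} (hG : Good (ball (0:EE) 1) v u Λ H₀) (hΛ : 0 ≤ Λ) (hΛ1 : Λ ≤ 1)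
    (hH : 0 ≤ H₀) (hH1 : H₀ ≤ 1) : ∃ A ≥ 0, ∃ r1 > 0, r1 ≤ 1 / 2 ∧ ∀ x y : EE, ‖x - y‖ ≤ r1 → ‖x + y‖ ≤ 1 / 4 →
    v x - u y ≤ A * ‖x - y‖ := by
  obtain ⟨B, hB1, r1, hr1, hr1', hHol⟩ := holder hG hΛ hΛ1 hH hH1
  obtain ⟨r2, hr2, hr21, hrB, hr16⟩ : ∃ r2 > 0, r2 ≤ r1 ∧ 19200 * (N + 1) * 9 * B ^ 2 * r2 ≤ 1 / 16 ∧ r2 ≤ 1 / 16 := by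
    refine ⟨min r1 (1 / 16 / (19200 * (N + 1) * 9 * B ^ 2)), by positivity, min_le_left _ _, ?_, ?_⟩
    · have := min_le_right r1 (1 / 16 / (19200 * (N + 1) * 9 * B ^ 2))
      rw [le_div_iff₀ (by positivity)] at this
      linarith
    · refine (min_le_right _ _).trans (div_le_self (by norm_num) ?_)
      have : 1 ≤ B ^ 2 := by nlinarith
      have : (1:ℝ) ≤ N + 1 := by linarith [N.cast_nonneg (α := ℝ)]
      nlinarith
  have hq : 0 < √r2 := Real.sqrt_pos.2 hr2
  have hq2 : √r2 ^ 2 = r2 := Real.sq_sqrt hr2.le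
  have hq1 : √r2 ≤ 1 := by nlinarith
  obtain ⟨ρ, hρ⟩ : ∃ ρ, ρ = B / √r2 := ⟨_, rfl⟩
  have hρ1 : 1 ≤ ρ := by rw [hρ, le_div_iff₀ hq]; linarith
  have hρB : ρ * √r2 = B := by rw [hρ]; field_simp
  have hρB2 : ρ ^ 2 * r2 ^ 2 = B ^ 2 * r2 := by
    rw [← hρB]; nth_rewrite 1 [← hq2]; nth_rewrite 3 [← hq2]; ring
  have hn : (0:ℝ) ≤ N := N.cast_nonneg
  have hBr0 : 0 ≤ B ^ 2 * r2 := by positivity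
  refine ⟨ρ + ρ / 2, by positivity, r2, hr2, by linarith, ?_⟩
  intro x y hxy hxs
  have hnear : ∀ x' y' : EE, ‖x' + y' - (x + y)‖ ≤ 1 / 4 → ‖x' + y'‖ ≤ 1 / 2 := by
    intro x' y' h
    have := norm_of_sub h hxs
    linarith
  have key := LIN hG hΛ hH hH1 (p := 0) (s0 := x + y) (ℓ := 1 / 4) (r1 := r2) (ρ2 := ρ) (ω := ρ / 2) (τ := ρ)
    (T0 := 3 * ρ) (by norm_num) (by norm_num) hr2 (by positivity) (by linarith) (by positivity) (by linarith) (by linarith)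
    (by
      have : ρ * r2 / (1 / 4) ≤ ρ * (1 / 16) / (1 / 4) := by gcongr
      rw [norm_zero]; linarith)
    (by
      calc 19200 * (N + 1) * (3 * ρ) ^ 2 * r2 ^ 2 = 19200 * (N + 1) * 9 * (ρ ^ 2 * r2 ^ 2) := by ring
        _ = 19200 * (N + 1) * 9 * B ^ 2 * r2 := by rw [hρB2]; ring
        _ ≤ _ := by linarith)
    (by
      have : 432 * (B ^ 2 * r2) ≤ 1 := by
        have : 0 ≤ N * (B ^ 2 * r2) := by positivity
        linarith
      calc Λ * r2 ^ 2 * (3 * ρ) ^ 3 ≤ 1 * r2 ^ 2 * (3 * ρ) ^ 3 := by gcongr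
        _ = ρ / 16 * (432 * (ρ ^ 2 * r2 ^ 2)) := by ring
        _ = ρ / 16 * (432 * (B ^ 2 * r2)) := by rw [hρB2]
        _ ≤ ρ / 16 * 1 := by gcongr
        _ = _ := by ring)
    (fun x' y' h1 h2 => mem_of_sz h1 (hnear _ _ h2) (by linarith))
    (by
      intro x' y' h1 h2
      have := hHol x' y' (h1.trans hr21) (hnear _ _ h2)
      rw [Real.sqrt_mul (norm_nonneg _)]
      have e : ρ * (√‖x' - y'‖ * √r2) = B * √‖x' - y'‖ := by rw [← hρB]; ring
      rw [e, inner_zero_left]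
      have : 0 ≤ ρ * ‖x' - y'‖ := by positivity
      linarith)
    (by
      intro x' y' h1 h2
      have := hHol x' y' (h1.le.trans hr21) (hnear _ _ h2)
      rw [h1] at this
      have e : ρ * r2 = B * √r2 := by rw [← hρB]; nth_rewrite 1 [← hq2]; ring
      rw [e, inner_zero_left]; linarith)
  simpa using key x y hxy rfl
end HOL


section ICM
variable {N : ℕ}
local notation "EE" => EuclideanSpace ℝ (Fin N)

lemma ic_ineq {n Γ a ε γ χ σ Λ zn H₀ S s1 : ℝ} (hn : 0 ≤ n) (hΓ : 1 ≤ Γ) (ha : 0 ≤ a) (hε : 0 < ε) (hγ : 0 < γ) (hχ : 0 < χ)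
    (hχ1 : χ ≤ 1) (hs1 : 0 < s1) (hσ : s1 ≤ σ) (hΛz : 0 ≤ Λ * zn) (hS : S ≤ Γ)
    (c1 : n * Γ ≤ γ * s1 ^ 2) (c2 : 100 * n * Γ * a * ε ≤ 1) (c3 : 2 * Γ * H₀ ≤ γ * s1)
    (c4 : Λ * zn * Γ ^ 2 ≤ ε * γ ^ 2 * χ * s1 ^ 2)
    (h : -(Λ * zn * S + 2 * H₀ * (2 * ε * γ * χ * σ)) ≤ 100 * n * a * (2 * ε * γ * χ * σ) ^ 2 +
      4 * n * (2 * ε * γ * χ) + 4 * (-(4 * ε * γ ^ 2 * χ)) * σ ^ 2 / Γ) : False := by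
  obtain ⟨X, hX⟩ : ∃ X, X = ε * γ * χ := ⟨_, rfl⟩
  have hX0 : 0 < X := by rw [hX]; positivity
  have hσ0 : 0 < σ := by linarith
  have hΓ0 : 0 < Γ := by linarith
  have h1 : 16 * X * γ * σ ^ 2 ≤ (Λ * zn * S + 4 * H₀ * X * σ + 400 * n * a * X ^ 2 * σ ^ 2 + 8 * n * X) * Γ := by
    rw [← div_le_iff₀ hΓ0]
    have e : 4 * (-(4 * ε * γ ^ 2 * χ)) * σ ^ 2 / Γ = - (16 * X * γ * σ ^ 2 / Γ) := by rw [hX]; ring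
    have e2 : 100 * n * a * (2 * ε * γ * χ * σ) ^ 2 = 400 * n * a * X ^ 2 * σ ^ 2 := by rw [hX]; ring
    have e3 : 4 * n * (2 * ε * γ * χ) = 8 * n * X := by rw [hX]; ring
    have e4 : 2 * H₀ * (2 * ε * γ * χ * σ) = 4 * H₀ * X * σ := by rw [hX]; ring
    rw [e, e2, e3, e4] at h
    linarith
  have s2 : s1 ^ 2 ≤ σ ^ 2 := by gcongr
  have A1 : 8 * n * X * Γ ≤ 8 * X * (γ * σ ^ 2) := by
    have : n * Γ ≤ γ * σ ^ 2 := c1.trans (by gcongr)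
    calc 8 * n * X * Γ = 8 * X * (n * Γ) := by ring
      _ ≤ _ := by gcongr
  have A2 : 400 * n * a * X ^ 2 * σ ^ 2 * Γ ≤ 4 * X * (γ * σ ^ 2) := by
    calc 400 * n * a * X ^ 2 * σ ^ 2 * Γ = 4 * X * (γ * σ ^ 2) * ((100 * n * Γ * a * ε) * χ) := by
          nth_rewrite 1 [sq, hX]; ring
      _ ≤ 4 * X * (γ * σ ^ 2) * (1 * 1) := by gcongr
      _ = _ := by ring
  have A3 : 4 * H₀ * X * σ * Γ ≤ 2 * X * (γ * σ ^ 2) := by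
    have : γ * s1 ≤ γ * σ := by gcongr
    calc 4 * H₀ * X * σ * Γ = 2 * X * σ * (2 * Γ * H₀) := by ring
      _ ≤ 2 * X * σ * (γ * σ) := mul_le_mul_of_nonneg_left (c3.trans this) (by positivity)
      _ = _ := by ring
  have A4 : Λ * zn * S * Γ ≤ X * (γ * σ ^ 2) := by
    calc Λ * zn * S * Γ ≤ Λ * zn * Γ * Γ := by gcongr
      _ = Λ * zn * Γ ^ 2 := by ring
      _ ≤ ε * γ ^ 2 * χ * s1 ^ 2 := c4
      _ ≤ ε * γ ^ 2 * χ * σ ^ 2 := by gcongr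
      _ = _ := by rw [hX]; ring
  have : 0 < X * (γ * σ ^ 2) := by positivity
  nlinarith

lemma IC_max {U : Set EE} {v u : EE → ℝ} {Λ H₀ : ℝ} (hG : Good U v u Λ H₀) (hΛ : 0 ≤ Λ)
    {Kz : Set EE} (hKz : IsCompact Kz) {s1 s2 ε γ α Γ G b : ℝ} (hs1 : 0 < s1) (hs2 : s1 < s2)
    (hε : 0 < ε) (hγ : 0 < γ) (hα : 0 ≤ α) (hG0 : 0 ≤ G)
    (hU : ∀ x y, x - y ∈ Kz → ‖x + y‖ ≤ s2 → x ∈ U ∧ y ∈ U) {F : EE → ℝ} (hFc : Continuous F)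
    (c0 : 1 + (G + 2 * ε * γ * s2) ^ 2 ≤ Γ)
    (c1 : N * Γ ≤ γ * s1 ^ 2) (c2 : 100 * N * Γ * α * ε ≤ 1) (c3 : 2 * Γ * H₀ ≤ γ * s1)
    (hb : ∀ x y, x - y ∈ Kz → ‖x + y‖ ≤ s2 → (x - y ∉ interior Kz ∨ ‖x + y‖ ≤ s1 ∨ ‖x + y‖ = s2) →
      v x - u y - F (x - y) + ε * Real.exp (-(γ * ‖x + y‖ ^ 2)) ≤ b)
    (hF : ∀ x y, x - y ∈ interior Kz → s1 < ‖x + y‖ → ‖x + y‖ < s2 →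
      b < v x - u y - F (x - y) + ε * Real.exp (-(γ * ‖x + y‖ ^ 2)) →
      (∃ g e : EE, ∃ α1 β1 : ℝ, UT F (x - y) g α1 β1 e ∧
        (∀ δ : EE, α1 * ‖δ‖ ^ 2 + β1 * (inner ℝ e δ) ^ 2 ≤ α * ‖δ‖ ^ 2) ∧ ‖g‖ ≤ G) ∧
      Λ * ‖x - y‖ * Γ ^ 2 ≤ ε * γ ^ 2 * Real.exp (-(γ * s2 ^ 2)) * s1 ^ 2) :
    ∀ x y, x - y ∈ Kz → ‖x + y‖ ≤ s2 → v x - u y - F (x - y) + ε * Real.exp (-(γ * ‖x + y‖ ^ 2)) ≤ b := by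
  intro x0 y0 h1 h2
  by_contra! hcon
  have hs20 : 0 < s2 := by linarith
  obtain ⟨x, y, hx, hy, hpos, hmax⟩ := exists_max hG hKz (isCompact_closedBall (0:EE) s2)
    (fun x y hx hy => hU x y hx (by simpa using hy))
    (A := F) (B := fun s => -(ε * Real.exp (-(γ * ‖s‖ ^ 2))))
    hFc (by fun_prop) (b := b) (x0 := x0) (y0 := y0) h1 (by simpa using h2)
    (by linarith)
  have hy' : ‖x + y‖ ≤ s2 := by simpa using hy
  obtain ⟨hxU, hyU⟩ := hU x y hx hy'
  have hpos' : b < v x - u y - F (x - y) + ε * Real.exp (-(γ * ‖x + y‖ ^ 2)) := by linarith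
  have hbb := hb x y hx hy'
  by_cases hz : x - y ∈ interior Kz
  swap
  · linarith [hbb (Or.inl hz)]
  by_cases hsa : ‖x + y‖ ≤ s1
  · linarith [hbb (Or.inr (Or.inl hsa))]
  by_cases hsb : ‖x + y‖ = s2
  · linarith [hbb (Or.inr (Or.inr hsb))]
  have hsb' : ‖x + y‖ < s2 := lt_of_le_of_ne hy' hsb
  push Not at hsa
  obtain ⟨⟨g, e, α1, β1, hUT, hform, hg⟩, hΛz⟩ := hF x y hz hsa hsb' hpos'
  have hm := hmax hz (by rw [interior_closedBall _ hs20.ne']; simpa using hsb')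
  have hUB := UT_exp (x + y) hε.le hγ.le
  set χ := Real.exp (-(γ * ‖x + y‖ ^ 2)) with hχ
  have hχ0 : 0 < χ := Real.exp_pos _
  have hχ1 : χ ≤ 1 := Real.exp_le_one_iff.2 (by simp; positivity)
  have hχ2 : Real.exp (-(γ * s2 ^ 2)) ≤ χ := by
    apply Real.exp_le_exp.2
    have : γ * ‖x + y‖ ^ 2 ≤ γ * s2 ^ 2 := by gcongr
    linarith
  have hg' : ‖(2 * ε * γ * χ) • (x + y)‖ = 2 * ε * γ * χ * ‖x + y‖ := by
    rw [norm_smul, Real.norm_of_nonneg (by positivity)]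
  have hg'2 : ‖(2 * ε * γ * χ) • (x + y)‖ ≤ 2 * ε * γ * s2 := by
    rw [hg']
    calc 2 * ε * γ * χ * ‖x + y‖ ≤ 2 * ε * γ * 1 * s2 := by gcongr
      _ = _ := by ring
  have hΓb : ∀ w : EE, ‖w‖ ≤ G + 2 * ε * γ * s2 → sq1 w ^ 2 ≤ Γ := by
    intro w hw
    rw [sq1_sq]
    have : ‖w‖ ^ 2 ≤ (G + 2 * ε * γ * s2) ^ 2 := by gcongr
    linarith
  have hp := hΓb (g + (2 * ε * γ * χ) • (x + y)) ((norm_add_le _ _).trans (by linarith))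
  have hq := hΓb (g - (2 * ε * γ * χ) • (x + y)) ((norm_sub_le _ _).trans (by linarith))
  have ht := touch_id hG hxU hyU hUT hUB hm hα hform (by positivity) (by
    have : 0 ≤ 4 * ε * γ ^ 2 * χ := by positivity
    linarith) hp hq
  rw [hg'] at ht
  have hΓ1 : 1 ≤ Γ := by linarith [sq_nonneg (G + 2 * ε * γ * s2)]
  refine ic_ineq (n := (N:ℝ)) (Γ := Γ) (a := α) (s1 := s1) (by positivity) hΓ1 hα hε hγ hχ0 hχ1 hs1 hsa.le
    (by positivity) ?_ c1 c2 c3 ?_ ht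
  · have h3 := sq1_ge (g - (2 * ε * γ * χ) • (x + y))
    exact (le_self_pow₀ h3 two_ne_zero).trans hq
  · refine hΛz.trans ?_
    gcongr
end ICM


section STD
variable {N : ℕ}
local notation "EE" => EuclideanSpace ℝ (Fin N)

/-- annulus -/
def Ann (a b : ℝ) : Set EE := {z | a ≤ ‖z‖ ∧ ‖z‖ ≤ b}

lemma Ann_compact (a b : ℝ) : IsCompact (Ann a b : Set EE) := by
  have : (Ann a b : Set EE) = closedBall 0 b ∩ {z | a ≤ ‖z‖} := by
    ext z; simp only [Ann, Set.mem_ofPred_eq, mem_inter_iff, mem_closedBall_zero_iff]; tauto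
  rw [this]
  exact (isCompact_closedBall _ _).inter_right (isClosed_le continuous_const continuous_norm)

lemma Ann_interior {a b : ℝ} {z : EE} (h1 : a < ‖z‖) (h2 : ‖z‖ < b) : z ∈ interior (Ann a b : Set EE) := by
  rw [mem_interior_iff_mem_nhds]
  have hc : Continuous (fun z : EE => ‖z‖) := continuous_norm
  filter_upwards [hc.continuousAt.eventually (Ioo_mem_nhds h1 h2)] with w hw
  exact ⟨hw.1.le, hw.2.le⟩

lemma Ann_norm_le {z : EE} {a b : ℝ} (h : z ∈ (Ann a b : Set EE)) : a ≤ ‖z‖ ∧ ‖z‖ ≤ b := h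

lemma radial_form {α1 c K : ℝ} (h1 : α1 ≤ K) (h2 : c ≤ K) {e : EE} (he : ‖e‖ = 1) (δ : EE) :
    α1 * ‖δ‖ ^ 2 + (c - α1) * (inner ℝ e δ) ^ 2 ≤ K * ‖δ‖ ^ 2 := by
  have h3 : (inner ℝ e δ : ℝ) ^ 2 ≤ ‖δ‖ ^ 2 := by
    have := abs_real_inner_le_norm e δ
    rw [he, one_mul] at this
    exact sq_le_sq' (abs_le.1 this).1 (abs_le.1 this).2
  have h4 : 0 ≤ (inner ℝ e δ : ℝ) ^ 2 := sq_nonneg _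
  have h5 := mul_le_mul_of_nonneg_right h1 (sub_nonneg.2 h3)
  have h6 := mul_le_mul_of_nonneg_right h2 h4
  linarith

lemma D1a {v u : EE → ℝ} {Λ H₀ : ℝ} (hG : Good (ball (0:EE) 1) v u Λ H₀) (hΛ : 0 ≤ Λ)
    (hH1 : H₀ ≤ 1) {p : EE} {ρ C1 d s1 Γ γ ε : ℝ} (hρ : 0 < ρ) (hC1 : ‖p‖ + 2 * ρ ≤ C1)
    (hflat : ∀ x ∈ ball (0:EE) 1, ∀ y ∈ ball (0:EE) 1, v x - u y ≤ inner ℝ p (x - y) + ρ * ‖x - y‖)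
    (hd : 0 < d) (hd4 : d ≤ 1 / 4) (hs1 : 0 < s1) (hs12 : s1 ≤ 1 / 2) (hΓ : Γ = 1 + (C1 + 1) ^ 2)
    (hγ : γ = (N + 1) * Γ / s1 ^ 2) (hε : 0 < ε) (hε1 : 400 * N * Γ * ρ * ε ≤ d) (hε2 : ε ≤ ρ * d / 4)
    (hε3 : 3 * ε * γ ≤ 1)
    (hc : ∀ x y : EE, d / 2 ≤ ‖x - y‖ → ‖x - y‖ ≤ 3 * d / 2 → ‖x + y‖ ≤ s1 →
      v x - u y ≤ inner ℝ p (x - y) + (ρ * ‖x - y‖ + ρ / d * (‖x - y‖ - d) ^ 2) - ε)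
    (hΛ1 : Λ * Γ ^ 2 ≤ ε * γ ^ 2 * Real.exp (-(γ * (3 / 2) ^ 2)) * s1 ^ 2) :
    ∀ x y : EE, ‖x - y‖ = d → ‖x + y‖ ≤ 1 →
      v x - u y ≤ inner ℝ p (x - y) + ρ * d - ε * (Real.exp (-γ) - Real.exp (-(γ * (3 / 2) ^ 2))) := by
  have hC0 : 0 ≤ C1 := by linarith [norm_nonneg p]
  have hΓ1 : 1 ≤ Γ := by rw [hΓ]; linarith [sq_nonneg (C1 + 1)]
  have hn : (0:ℝ) ≤ N := N.cast_nonneg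
  have hγ0 : 0 < γ := by rw [hγ]; positivity
  have hγs : γ * s1 ^ 2 = (N + 1) * Γ := by rw [hγ]; field_simp
  have hUin : ∀ x y : EE, x - y ∈ (Ann (d / 2) (3 * d / 2) : Set EE) → ‖x + y‖ ≤ 3 / 2 →
      x ∈ ball (0:EE) 1 ∧ y ∈ ball (0:EE) 1 := by
    intro x y h1 h2
    exact mem_of_sz h1.2 h2 (by linarith)
  have hexp : ∀ s : ℝ, Real.exp (-(γ * s ^ 2)) ≤ 1 := fun s => Real.exp_le_one_iff.2 (by
    simp; positivity)
  have hE := Real.exp_pos (-(γ * (3 / 2) ^ 2))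
  have key := IC_max hG hΛ (Ann_compact (d / 2) (3 * d / 2)) (s1 := s1) (s2 := 3 / 2) (ε := ε) (γ := γ)
    (α := 4 * ρ / d) (Γ := Γ) (G := C1) (b := ε * Real.exp (-(γ * (3 / 2) ^ 2)))
    hs1 (by linarith) hε hγ0 (by positivity) hC0 hUin
    (F := fun z => inner ℝ p z + (fun r => ρ * r + ρ / d * (r - d) ^ 2) ‖z‖) (by fun_prop)
    (by
      rw [hΓ]
      have : 0 ≤ 2 * ε * γ * (3 / 2) := by positivity
      have : C1 + 2 * ε * γ * (3 / 2) ≤ C1 + 1 := by linarith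
      gcongr)
    (by rw [hγs]; nlinarith)
    (by
      rw [show 100 * N * Γ * (4 * ρ / d) * ε = (400 * N * Γ * ρ * ε) / d by ring, div_le_one hd]; exact hε1)
    (by
      have h1 : 2 * Γ * H₀ ≤ 2 * Γ := by nlinarith
      have h2 : 2 * Γ * s1 ≤ γ * s1 * s1 := by
        rw [show γ * s1 * s1 = γ * s1 ^ 2 by ring, hγs]
        have : 0 ≤ N * Γ := by positivity
        nlinarith
      have h3 := le_of_mul_le_mul_right h2 hs1
      linarith)
    (by
      intro x y hz hs hor
      obtain ⟨hx, hy⟩ := hUin x y hz hs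
      have hf := hflat x hx y hy
      have hz' := Ann_norm_le hz
      have hpd : 0 ≤ ρ / d * (‖x - y‖ - d) ^ 2 := by positivity
      rcases hor with h | h | h
      · have hh : ρ / d * (‖x - y‖ - d) ^ 2 = ρ * d / 4 := by
          have : ‖x - y‖ = d / 2 ∨ ‖x - y‖ = 3 * d / 2 := by
            by_contra! hne
            exact h (Ann_interior (lt_of_le_of_ne hz'.1 (Ne.symm hne.1)) (lt_of_le_of_ne hz'.2 hne.2))
          rcases this with h | h <;> rw [h] <;> field_simp <;> ring
        have h1 : ε * Real.exp (-(γ * ‖x + y‖ ^ 2)) ≤ ε * 1 := by gcongr; exact hexp _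
        have h2 : 0 ≤ ε * Real.exp (-(γ * (3 / 2) ^ 2)) := by positivity
        simp only [hh]
        linarith
      · have h0 := hc x y hz'.1 hz'.2 h
        have h1 : ε * Real.exp (-(γ * ‖x + y‖ ^ 2)) ≤ ε * 1 := by gcongr; exact hexp _
        have h2 : 0 ≤ ε * Real.exp (-(γ * (3 / 2) ^ 2)) := by positivity
        linarith
      · rw [h]; linarith)
    (by
      intro x y hz hs1' hs2' _
      have hz1 := Ann_norm_le (interior_subset hz)
      have hz0 : 0 < ‖x - y‖ := by linarith
      have hzne : x - y ≠ 0 := norm_pos_iff.1 hz0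
      have he : ‖(‖x - y‖⁻¹ • (x - y) : EE)‖ = 1 := by
        rw [norm_smul, norm_inv, norm_norm, inv_mul_cancel₀ hz0.ne']
      have hr1 : ρ / d * (‖x - y‖ - d) ≤ ρ / d * (d / 2) := by gcongr; linarith
      have hr2 : ρ / d * (-(d / 2)) ≤ ρ / d * (‖x - y‖ - d) := by gcongr; linarith
      have hrr : ρ / d * (d / 2) = ρ / 2 := by field_simp
      rw [mul_neg, hrr] at hr2
      rw [hrr] at hr1
      refine ⟨⟨_, _, _, _, UT_radial (p := p) (ψ := fun r => ρ * r + ρ / d * (r - d) ^ 2) (ψ1 := fun r => ρ + 2 * (ρ / d) * (r - d)) (c := 2 * (ρ / d)) hzne ?_ ?_, ?_, ?_⟩, ?_⟩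
      · refine Eventually.of_forall fun s => ?_
        have h1 := ((hasDerivAt_id' s).const_mul ρ).add ((((hasDerivAt_id' s).sub_const d).pow 2).const_mul (ρ / d))
        refine h1.congr_deriv ?_
        simp; ring
      · have h1 := (((hasDerivAt_id' ‖x - y‖).sub_const d).const_mul (2 * (ρ / d))).const_add ρ
        exact h1.congr_deriv (by ring)
      · intro δ
        apply radial_form _ _ he
        · rw [div_le_div_iff₀ hz0 hd]
          have : (ρ + 2 * (ρ / d) * (‖x - y‖ - d)) ≤ 2 * ρ := by linarith
          nlinarith
        · rw [← mul_div_assoc]; gcongr; linarith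
      · refine (norm_add_le _ _).trans ?_
        rw [norm_smul, he, mul_one, Real.norm_of_nonneg (by linarith)]
        linarith
      · calc Λ * ‖x - y‖ * Γ ^ 2 ≤ Λ * 1 * Γ ^ 2 := by gcongr; linarith
          _ ≤ _ := by linarith)
  intro x y h1 h2
  have := key x y ⟨by linarith, by linarith⟩ (by linarith)
  rw [h1] at this
  have h3 : ε * Real.exp (-γ) ≤ ε * Real.exp (-(γ * ‖x + y‖ ^ 2)) := by
    gcongr
    have : ‖x + y‖ ^ 2 ≤ 1 := by nlinarith [norm_nonneg (x + y)]
    nlinarith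
  simp only [sub_self] at this
  linarith

lemma le_sqrt_mul_of_le {r r1 : ℝ} (h0 : 0 ≤ r) (h : r ≤ r1) : r ≤ √(r * r1) :=
  Real.le_sqrt_of_sq_le (by nlinarith)

lemma D1b {v u : EE → ℝ} {Λ H₀ : ℝ} (hG : Good (ball (0:EE) 1) v u Λ H₀) (hΛ : 0 ≤ Λ) (hH : 0 ≤ H₀)
    (hH1 : H₀ ≤ 1) {p : EE} {ρ C1 d τ : ℝ} (hC1 : ‖p‖ + 2 * ρ ≤ C1)
    (hflat : ∀ x ∈ ball (0:EE) 1, ∀ y ∈ ball (0:EE) 1, v x - u y ≤ inner ℝ p (x - y) + ρ * ‖x - y‖)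
    (hd : 0 < d) (hd4 : d ≤ 1 / 4) (hdc : 19200 * (N + 1) * (1 + C1) ^ 2 * d ^ 2 ≤ 1 / 4)
    (hτ0 : 0 < τ) (hτ : τ ≤ ρ / 4) (hΛ1 : Λ * (1 + C1) ^ 3 ≤ τ / 16)
    (hD : ∀ x y : EE, ‖x - y‖ = d → ‖x + y‖ ≤ 1 → v x - u y ≤ inner ℝ p (x - y) + (ρ - τ) * d) :
    ∀ x y : EE, ‖x - y‖ ≤ d → ‖x + y‖ ≤ 1 / 2 → v x - u y ≤ inner ℝ p (x - y) + (ρ - τ / 2) * ‖x - y‖ := by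
  intro x y hxy hxs
  have hC0 : 0 ≤ C1 := by linarith [norm_nonneg p]
  have hnear : ∀ x' y' : EE, ‖x' + y' - (x + y)‖ ≤ 1 / 2 → ‖x' + y'‖ ≤ 1 := by
    intro x' y' h
    have := norm_of_sub h hxs
    linarith
  have hUin : ∀ x' y' : EE, ‖x' - y'‖ ≤ d → ‖x' + y' - (x + y)‖ ≤ 1 / 2 → x' ∈ ball (0:EE) 1 ∧ y' ∈ ball (0:EE) 1 :=
    fun x' y' h1 h2 => mem_of_sz h1 (hnear _ _ h2) (by linarith)
  have key := LIN hG hΛ hH hH1 (p := p) (s0 := x + y) (ℓ := 1 / 2) (r1 := d) (ρ2 := ρ - τ) (ω := τ / 2) (τ := τ)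
    (T0 := 1 + C1) (by norm_num) (by norm_num) hd (by positivity) (by linarith) hτ0.le (by linarith)
    (by linarith [norm_nonneg p])
    (by
      have : τ * d / (1 / 2) ≤ τ * (1 / 4) / (1 / 2) := by gcongr
      linarith)
    (by linarith)
    (by
      calc Λ * d ^ 2 * (1 + C1) ^ 3 ≤ Λ * 1 * (1 + C1) ^ 3 := by gcongr; nlinarith
        _ ≤ _ := by linarith)
    hUin
    (by
      intro x' y' h1 h2
      obtain ⟨a, b⟩ := hUin x' y' h1 h2
      have h3 := hflat x' a y' b
      have h4 : τ * ‖x' - y'‖ ≤ τ * √(‖x' - y'‖ * d) := by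
        gcongr; exact le_sqrt_mul_of_le (norm_nonneg _) h1
      linarith)
    (fun x' y' h1 h2 => hD x' y' h1 (hnear _ _ h2))
  refine (key x y hxy rfl).trans (le_of_eq ?_)
  ring
end STD


section STD
variable {N : ℕ}
local notation "EE" => EuclideanSpace ℝ (Fin N)

lemma norm_half_add {z b : EE} (hz : 0 < ‖z‖) :
    ‖(2⁻¹:ℝ) • z + b‖ ≤ 2⁻¹ * ‖z‖ + inner ℝ (‖z‖⁻¹ • z) b + ‖b‖ ^ 2 / ‖z‖ := by
  have h1 := norm_add_sq_real ((2⁻¹:ℝ) • z) b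
  rw [inner_smul_left, norm_smul, Real.norm_of_nonneg (by norm_num)] at h1
  simp only [conj_trivial] at h1
  have h2 : ‖(2⁻¹:ℝ) • z + b‖ * ‖z‖ ≤ 2⁻¹ * ‖z‖ ^ 2 + inner ℝ z b + ‖b‖ ^ 2 := by
    nlinarith [sq_nonneg (‖(2⁻¹:ℝ) • z + b‖ - 2⁻¹ * ‖z‖)]
  rw [inner_smul_left]
  simp only [conj_trivial]
  rw [← le_div_iff₀ hz] at h2
  refine h2.trans (le_of_eq ?_)
  field_simp

lemma D3a {U : Set EE} {v u : EE → ℝ} {p x' y' : EE} {ρ d s c : ℝ} (hρ : 0 < ρ) (hd : 0 < d)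
    (hflat : ∀ x ∈ U, ∀ y ∈ U, v x - u y ≤ inner ℝ p (x - y) + ρ * ‖x - y‖)
    (hx' : x' ∈ U) (hy' : y' ∈ U) (hz : d / 2 ≤ ‖x' - y'‖) (hs' : ‖x' + y'‖ ≤ 2 * s)
    (hc : c ≤ 16 * ρ * s ^ 2 / d) (hV : inner ℝ p (x' - y') + ρ * ‖x' - y'‖ - c ≤ v x' - u y')
    {x y : EE} (hx : x ∈ U) (hy : y ∈ U) (hxs : ‖x‖ ≤ s) (hys : ‖y‖ ≤ s) :
    v x - u y ≤ inner ℝ (p + ρ • (‖x' - y'‖⁻¹ • (x' - y'))) (x - y) + 32 * ρ * s ^ 2 / d := by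
  have hz0 : 0 < ‖x' - y'‖ := by linarith
  have h1 := hflat x hx y' hy'
  have h2 := hflat x' hx' y hy
  have hbd : ∀ b : EE, ‖b‖ ≤ 2 * s → ‖b‖ ^ 2 / ‖x' - y'‖ ≤ 8 * s ^ 2 / d := by
    intro b hb
    calc ‖b‖ ^ 2 / ‖x' - y'‖ ≤ (2 * s) ^ 2 / (d / 2) := by gcongr
      _ = _ := by field_simp; ring
  have hh : ‖(2⁻¹:ℝ) • (x' + y')‖ ≤ s := by
    rw [norm_smul, Real.norm_of_nonneg (by norm_num)]; linarith
  have n1 := norm_half_add (z := x' - y') (b := x - (2⁻¹:ℝ) • (x' + y')) hz0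
  have n2 := norm_half_add (z := x' - y') (b := (2⁻¹:ℝ) • (x' + y') - y) hz0
  have m1 := hbd (x - (2⁻¹:ℝ) • (x' + y')) ((norm_sub_le _ _).trans (by linarith))
  have m2 := hbd ((2⁻¹:ℝ) • (x' + y') - y) ((norm_sub_le _ _).trans (by linarith))
  have e1 : (2⁻¹:ℝ) • (x' - y') + (x - (2⁻¹:ℝ) • (x' + y')) = x - y' := by module
  have e2 : (2⁻¹:ℝ) • (x' - y') + ((2⁻¹:ℝ) • (x' + y') - y) = x' - y := by module
  rw [e1] at n1
  rw [e2] at n2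
  have hsum : ‖x - y'‖ + ‖x' - y‖ - ‖x' - y'‖ ≤ inner ℝ (‖x' - y'‖⁻¹ • (x' - y')) (x - y) + 16 * s ^ 2 / d := by
    have e3 : (inner ℝ (‖x' - y'‖⁻¹ • (x' - y')) (x - (2⁻¹:ℝ) • (x' + y')) : ℝ)
        + inner ℝ (‖x' - y'‖⁻¹ • (x' - y')) ((2⁻¹:ℝ) • (x' + y') - y) =
        inner ℝ (‖x' - y'‖⁻¹ • (x' - y')) (x - y) := by
      rw [← inner_add_right]; congr 1; module
    have e4 : 16 * s ^ 2 / d = 8 * s ^ 2 / d + 8 * s ^ 2 / d := by ring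
    rw [← e3, e4]; linarith
  have hsum' := mul_le_mul_of_nonneg_left hsum hρ.le
  have e5 : (inner ℝ p (x - y') : ℝ) + inner ℝ p (x' - y) - inner ℝ p (x' - y') = inner ℝ p (x - y) := by
    rw [← inner_add_right, ← inner_sub_right]; congr 1; module
  rw [inner_add_left, real_inner_smul_left _ _ ρ]
  have e6 : 32 * ρ * s ^ 2 / d = 16 * ρ * s ^ 2 / d + ρ * (16 * s ^ 2 / d) := by ring
  rw [e6]
  linarith

lemma D3b {v u : EE → ℝ} {Λ H₀ : ℝ} (hG : Good (ball (0:EE) 1) v u Λ H₀) (hΛ : 0 ≤ Λ) (hH : 0 ≤ H₀)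
    (hH1 : H₀ ≤ 1) {p e : EE} {ρ C1 c s d : ℝ} (hC1 : ‖p‖ + 2 * ρ ≤ C1) (hρ : 0 < ρ) (he : ‖e‖ = 1)
    (hflat : ∀ x ∈ ball (0:EE) 1, ∀ y ∈ ball (0:EE) 1, v x - u y ≤ inner ℝ p (x - y) + ρ * ‖x - y‖)
    (hc : 0 < c) (hc1 : c ≤ 1 / 10) (hcc : 19200 * (N + 1) * (1 + C1) ^ 2 * c ^ 2 ≤ 1) (hs : 0 < s) (hs1 : s < 1)
    (hd : 0 < d) (hsd : s = c * d / 256)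
    (hΛ1 : Λ * (1 + C1) ^ 3 ≤ ρ / 96)
    (hV : ∀ x y : EE, ‖x‖ ≤ s → ‖y‖ ≤ s → v x - u y ≤ inner ℝ (p + ρ • e) (x - y) + 32 * ρ * s ^ 2 / d) :
    ∀ x y : EE, ‖x - y‖ ≤ c * s / 2 → ‖x + y‖ ≤ s / 2 → v x - u y ≤ inner ℝ (p + ρ • e) (x - y) + ρ / 3 * ‖x - y‖ := by
  intro x y hxy hxs
  have hC0 : 0 ≤ C1 := by linarith [norm_nonneg p]
  have hcs : c * s ≤ 1 / 10 * s := by gcongr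
  have hnear : ∀ x' y' : EE, ‖x' - y'‖ ≤ c * s / 2 → ‖x' + y' - (x + y)‖ ≤ s / 2 → ‖x'‖ ≤ s ∧ ‖y'‖ ≤ s := by
    intro x' y' h0 h
    have h1 := norm_of_sub h hxs
    have e := half_recover' x' y'
    constructor
    · rw [← e.1, norm_smul, Real.norm_of_nonneg (by norm_num)]
      have := norm_add_le (x' + y') (x' - y')
      linarith
    · rw [← e.2, norm_smul, Real.norm_of_nonneg (by norm_num)]
      have := norm_sub_le (x' + y') (x' - y')
      linarith
  have hUin : ∀ x' y' : EE, ‖x' - y'‖ ≤ c * s / 2 → ‖x' + y' - (x + y)‖ ≤ s / 2 → x' ∈ ball (0:EE) 1 ∧ y' ∈ ball (0:EE) 1 := by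
    intro x' y' h0 h
    have := hnear x' y' h0 h
    simp only [mem_ball_zero_iff]
    exact ⟨by linarith, by linarith⟩
  have hcs0 : 0 < c * s / 2 := by positivity
  have hpe : ‖p + ρ • e‖ ≤ ‖p‖ + ρ := by
    refine (norm_add_le _ _).trans ?_
    rw [norm_smul, he, mul_one, Real.norm_of_nonneg hρ.le]
  have key := LIN hG hΛ hH hH1 (p := p + ρ • e) (s0 := x + y) (ℓ := s / 2) (r1 := c * s / 2) (ρ2 := ρ / 4)
    (ω := ρ / 12) (τ := 7 / 4 * ρ)
    (T0 := 1 + C1) (by positivity) (by linarith) hcs0 (by positivity) (by linarith) (by positivity) (by linarith)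
    (by linarith [norm_nonneg p])
    (by
      have e1 : 7 / 4 * ρ * (c * s / 2) / (s / 2) = 7 / 4 * ρ * c := by field_simp
      have e2 : 7 / 4 * ρ * c ≤ 7 / 4 * ρ * (1 / 10) := by gcongr
      rw [e1]; linarith)
    (by
      calc 19200 * (N + 1) * (1 + C1) ^ 2 * (c * s / 2) ^ 2
          = (19200 * (N + 1) * (1 + C1) ^ 2 * c ^ 2) * (s / 2) ^ 2 := by ring
        _ ≤ 1 * (s / 2) ^ 2 := by gcongr
        _ = _ := by ring)
    (by
      calc Λ * (c * s / 2) ^ 2 * (1 + C1) ^ 3 ≤ Λ * 1 * (1 + C1) ^ 3 := by gcongr; nlinarith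
        _ ≤ _ := by linarith)
    hUin
    (by
      intro x' y' h1 h2
      obtain ⟨a, b⟩ := hUin x' y' h1 h2
      have h3 := hflat x' a y' b
      have h4 : 7 / 4 * ρ * ‖x' - y'‖ ≤ 7 / 4 * ρ * √(‖x' - y'‖ * (c * s / 2)) := by
        gcongr; exact le_sqrt_mul_of_le (norm_nonneg _) h1
      have h5 : - ‖x' - y'‖ ≤ inner ℝ e (x' - y') := by
        have := abs_real_inner_le_norm e (x' - y')
        rw [he, one_mul] at this
        exact (abs_le.1 this).1
      have h6 := mul_le_mul_of_nonneg_left h5 hρ.le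
      rw [inner_add_left, inner_smul_left]
      simp only [conj_trivial]
      linarith)
    (by
      intro x' y' h1 h2
      obtain ⟨a, b⟩ := hnear x' y' h1.le h2
      refine (hV x' y' a b).trans (le_of_eq ?_)
      have : 32 * ρ * s ^ 2 / d = ρ / 4 * (c * s / 2) := by
        rw [hsd]; field_simp; norm_num
      rw [this])
  refine (key x y hxy rfl).trans (le_of_eq ?_)
  ring
end STD


section STD
variable {N : ℕ}
local notation "EE" => EuclideanSpace ℝ (Fin N)

lemma ev_small (a : ℝ) {b : ℝ} (hb : 0 < b) : ∀ᶠ ε in 𝓝[>] (0:ℝ), a * ε ≤ b := by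
  have : Tendsto (fun ε : ℝ => a * ε) (𝓝[>] 0) (𝓝 0) := by
    have h : Continuous (fun ε : ℝ => a * ε) := by fun_prop
    simpa using (h.tendsto 0).mono_left nhdsWithin_le_nhds
  exact this.eventually_le_const hb

lemma ev_pos : ∀ᶠ ε in 𝓝[>] (0:ℝ), 0 < ε := eventually_mem_nhdsWithin

/-- flatness -/
def Flat (R : ℝ) (v u : EE → ℝ) (p : EE) (ρ : ℝ) : Prop :=
  ∀ x ∈ ball (0:EE) R, ∀ y ∈ ball (0:EE) R, v x - u y ≤ inner ℝ p (x - y) + ρ * ‖x - y‖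

set_option maxHeartbeats 1000000 in
lemma stepD (N : ℕ) {C1 ρm : ℝ} (hC1 : 0 ≤ C1) (hρm : 0 < ρm) : ∃ μ δ κ : ℝ, 0 < μ ∧ μ < 1 ∧ 0 < δ ∧ δ < 1 ∧ 0 < κ ∧
    ∀ (v u : EuclideanSpace ℝ (Fin N) → ℝ) (Λ H₀ : ℝ), Good (ball 0 1) v u Λ H₀ → 0 ≤ Λ → Λ ≤ κ → 0 ≤ H₀ → H₀ ≤ κ →
    ∀ p ρ, ρm ≤ ρ → ‖p‖ + 2 * ρ ≤ C1 → Flat 1 v u p ρ →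
    ∃ p' ρ', 0 < ρ' ∧ ρ' ≤ (1 - δ) * ρ ∧ ‖p'‖ + 2 * ρ' ≤ ‖p‖ + 2 * ρ ∧ Flat μ v u p' ρ' := by
  have hn : (0:ℝ) ≤ N := N.cast_nonneg
  obtain ⟨c, hcd⟩ : ∃ c : ℝ, c = 1 / (200 * (N + 1) * (1 + C1)) := ⟨_, rfl⟩
  have hc : 0 < c := by rw [hcd]; positivity
  have hcm : c * ((N + 1) * (1 + C1)) = 1 / 200 := by rw [hcd]; field_simp
  have hN1 : 1 ≤ ((N:ℝ) + 1) * (1 + C1) := by nlinarith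
  have hc200 : c ≤ 1 / 200 := by nlinarith
  have hcc : 19200 * (N + 1) * (1 + C1) ^ 2 * c ^ 2 ≤ 1 := by
    have : (N + 1) * (1 + C1) ^ 2 * c ^ 2 ≤ (c * ((N + 1) * (1 + C1))) ^ 2 := by
      have h0 : 0 ≤ (N:ℝ) * (N + 1) * (1 + C1) ^ 2 * c ^ 2 := by positivity
      nlinarith
    rw [hcm] at this
    nlinarith
  obtain ⟨d, hdd⟩ : ∃ d : ℝ, d = c / 2 := ⟨_, rfl⟩
  have hd : 0 < d := by rw [hdd]; positivity
  have hdc : 19200 * (N + 1) * (1 + C1) ^ 2 * d ^ 2 ≤ 1 / 4 := by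
    rw [hdd, div_pow]; linarith
  obtain ⟨s, hs⟩ : ∃ s : ℝ, s = c * d / 256 := ⟨_, rfl⟩
  have hs0 : 0 < s := by rw [hs]; positivity
  have hsd : s ≤ d := by rw [hs]; nlinarith
  obtain ⟨Γ, hΓ⟩ : ∃ Γ : ℝ, Γ = 1 + (C1 + 1) ^ 2 := ⟨_, rfl⟩
  have hΓ0 : 0 < Γ := by rw [hΓ]; positivity
  obtain ⟨γ, hγ⟩ : ∃ γ : ℝ, γ = (N + 1) * Γ / (2 * s) ^ 2 := ⟨_, rfl⟩
  have hγ0 : 0 < γ := by rw [hγ]; positivity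
  obtain ⟨E, hE⟩ : ∃ E : ℝ, E = Real.exp (-(γ * (3 / 2) ^ 2)) := ⟨_, rfl⟩
  have hE0 : 0 < E := by rw [hE]; exact Real.exp_pos _
  obtain ⟨w, hw⟩ : ∃ w : ℝ, w = Real.exp (-γ) - E := ⟨_, rfl⟩
  have hw0 : 0 < w := by
    rw [hw, hE, sub_pos]; apply Real.exp_lt_exp.2; nlinarith
  have hw1 : w ≤ 1 := by
    have : Real.exp (-γ) ≤ 1 := Real.exp_le_one_iff.2 (by linarith)
    linarith
  obtain ⟨ε0, hε0, h1, h2, h3, h4⟩ := (ev_pos.and ((ev_small (400 * N * Γ * C1 ^ 2) hd).and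
    ((ev_small 1 (show 0 < 16 * s ^ 2 / d by positivity)).and
    ((ev_small 1 (show 0 < d / 4 by positivity)).and (ev_small (3 * C1 * γ) one_pos))))).exists
  obtain ⟨κ, hκ0, hκ1, k1, k2, k3⟩ := (ev_pos.and ((ev_small 1 one_pos).and ((ev_small (Γ ^ 2)
    (show 0 < ρm * ε0 * γ ^ 2 * E * (2 * s) ^ 2 by positivity)).and
    ((ev_small ((1 + C1) ^ 3) (show 0 < ρm * ε0 * w / d / 16 by positivity)).and
    (ev_small ((1 + C1) ^ 3) (show 0 < ρm / 96 by positivity)))))).exists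
  have hδ0 : 0 < ε0 * w / d / 2 := by positivity
  have hδ1 : ε0 * w / d ≤ 1 / 4 := by
    rw [div_le_iff₀ hd]
    have := mul_le_mul_of_nonneg_left hw1 hε0.le
    linarith
  refine ⟨c * s / 4, ε0 * w / d / 2, κ, by positivity, by
    have := mul_le_mul_of_nonneg_right hc200 hs0.le
    linarith, hδ0, by linarith, hκ0, ?_⟩
  intro v u Λ H₀ hG hΛ0 hΛκ hH0 hHκ p ρ hρ hpC hflat
  have hρ0 : 0 < ρ := by linarith
  have hρC : ρ ≤ C1 := by linarith [norm_nonneg p]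
  have hH1 : H₀ ≤ 1 := by linarith
  by_cases hcase : ∀ x y : EuclideanSpace ℝ (Fin N), d / 2 ≤ ‖x - y‖ → ‖x - y‖ ≤ 3 * d / 2 → ‖x + y‖ ≤ 2 * s →
      v x - u y ≤ inner ℝ p (x - y) + (ρ * ‖x - y‖ + ρ / d * (‖x - y‖ - d) ^ 2) - ρ * ε0
  · have a1 := D1a hG hΛ0 hH1 (C1 := C1) (d := d) (s1 := 2 * s) (Γ := Γ) (γ := γ) (ε := ρ * ε0) hρ0 hpC hflat hd (by linarith)
      (by positivity) (by linarith) hΓ hγ (by positivity) (by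
        calc 400 * N * Γ * ρ * (ρ * ε0) = 400 * N * Γ * ρ ^ 2 * ε0 := by ring
          _ ≤ 400 * N * Γ * C1 ^ 2 * ε0 := by gcongr
          _ ≤ d := h1) (by
        have := mul_le_mul_of_nonneg_left h3 hρ0.le
        linarith) (by
        calc 3 * (ρ * ε0) * γ = 3 * ρ * γ * ε0 := by ring
          _ ≤ 3 * C1 * γ * ε0 := by gcongr
          _ ≤ 1 := h4) hcase (by
        rw [← hE]
        calc Λ * Γ ^ 2 ≤ κ * Γ ^ 2 := by gcongr
          _ = Γ ^ 2 * κ := by ring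
          _ ≤ _ := k1
          _ ≤ _ := by gcongr)
    have hτρ : ρ * ε0 * w / d = ρ * (ε0 * w / d) := by ring
    have a2 := D1b hG hΛ0 hH0 hH1 (C1 := C1) (d := d) (τ := ρ * ε0 * w / d) hpC hflat hd (by linarith) hdc (by positivity)
      (by rw [hτρ]; have := mul_le_mul_of_nonneg_left hδ1 hρ0.le; linarith)
      (by
        calc Λ * (1 + C1) ^ 3 ≤ κ * (1 + C1) ^ 3 := by gcongr
          _ = (1 + C1) ^ 3 * κ := by ring
          _ ≤ _ := k2
          _ ≤ _ := by gcongr)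
      (by
        intro x y hx hy
        refine (a1 x y hx hy).trans (le_of_eq ?_)
        rw [← hE, ← hw]; field_simp; ring)
    refine ⟨p, ρ - ρ * ε0 * w / d / 2, ?_, ?_, ?_, ?_⟩
    · rw [hτρ]; have := mul_le_mul_of_nonneg_left hδ1 hρ0.le; linarith
    · rw [hτρ]; linarith
    · have : 0 ≤ ρ * ε0 * w / d := by positivity
      linarith
    · intro x hx y hy
      rw [mem_ball_zero_iff] at hx hy
      have hcs : c * s ≤ 1 * s := by gcongr; linarith
      refine a2 x y ((norm_sub_le _ _).trans (by linarith)) ((norm_add_le _ _).trans (by linarith))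
  · push Not at hcase
    obtain ⟨x', y', g1, g2, g3, g4⟩ := hcase
    obtain ⟨hx', hy'⟩ := mem_of_sz (c := 1) g2 g3 (by linarith)
    have hz0 : 0 < ‖x' - y'‖ := by linarith
    have he : ‖(‖x' - y'‖⁻¹ • (x' - y') : EuclideanSpace ℝ (Fin N))‖ = 1 := by
      rw [norm_smul, norm_inv, norm_norm, inv_mul_cancel₀ hz0.ne']
    have hs1 : s < 1 := by linarith
    have hV : ∀ x y : EuclideanSpace ℝ (Fin N), ‖x‖ ≤ s → ‖y‖ ≤ s →
        v x - u y ≤ inner ℝ (p + ρ • (‖x' - y'‖⁻¹ • (x' - y'))) (x - y) + 32 * ρ * s ^ 2 / d := by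
      intro x y hx hy
      refine D3a (U := ball 0 1) (c := ρ * ε0) hρ0 hd hflat hx' hy' g1 g3 ?_ ?_ (by rw [mem_ball_zero_iff]; linarith)
        (by rw [mem_ball_zero_iff]; linarith) hx hy
      · calc ρ * ε0 ≤ ρ * (16 * s ^ 2 / d) := by gcongr; linarith
          _ = _ := by ring
      · have : 0 ≤ ρ / d * (‖x' - y'‖ - d) ^ 2 := by positivity
        linarith
    have a2 := D3b hG hΛ0 hH0 hH1 (C1 := C1) (c := c) (s := s) (d := d) hpC hρ0 he hflat hc (by linarith) hcc hs0 hs1 hd hs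
      (by
        calc Λ * (1 + C1) ^ 3 ≤ κ * (1 + C1) ^ 3 := by gcongr
          _ = (1 + C1) ^ 3 * κ := by ring
          _ ≤ _ := k3
          _ ≤ _ := by gcongr) hV
    refine ⟨p + ρ • (‖x' - y'‖⁻¹ • (x' - y')), ρ / 3, by positivity, by
      have := mul_le_mul_of_nonneg_left hδ1 hρ0.le
      linarith, ?_, ?_⟩
    · have := norm_add_le p (ρ • (‖x' - y'‖⁻¹ • (x' - y')))
      rw [norm_smul ρ, he, mul_one, Real.norm_of_nonneg hρ0.le] at this
      linarith
    · intro x hx y hy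
      rw [mem_ball_zero_iff] at hx hy
      have hcs : c * s ≤ 1 * s := by gcongr; linarith
      refine a2 x y ((norm_sub_le _ _).trans (by linarith)) ((norm_add_le _ _).trans (by linarith))

end STD


section STE
variable {N : ℕ}
local notation "EE" => EuclideanSpace ℝ (Fin N)

set_option maxHeartbeats 1000000 in
lemma E0 {v u : EE → ℝ} {Λ H₀ : ℝ} (hG : Good (ball (0:EE) 4) v u Λ H₀) (hΛ : 0 ≤ Λ)
    (hH1 : H₀ ≤ 1) {p y1 : EE} {ρ C1 Γ γ w : ℝ} (hρ : 0 < ρ) (hp : ‖p‖ ≤ C1)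
    (hflat : Flat 4 v u p ρ) (hΓ : Γ = 1 + (C1 + 2) ^ 2) (hγ : γ = (N + 2) * Γ)
    (hw : w = Real.exp (-(γ * 2 ^ 2)) - Real.exp (-(γ * 4 ^ 2))) (hρ1 : 100 * N * Γ * ρ ^ 2 ≤ w)
    (hρ2 : 2 * ρ + 2 * (ρ ^ 2 / w) ≤ 1) (hΛ1 : Λ * Γ ^ 2 ≤ ρ ^ 2 / w * γ ^ 2 * Real.exp (-(γ * 4 ^ 2)))
    (hy1 : ‖y1‖ = 1) (hc : u y1 ≤ v y1) (hlt : ∀ x : EE, ‖x‖ < 1 → v x < u x) : False := by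
  have hn : (0:ℝ) ≤ N := N.cast_nonneg
  have hC0 : 0 ≤ C1 := (norm_nonneg p).trans hp
  have hΓ1 : 1 ≤ Γ := by rw [hΓ]; linarith [sq_nonneg (C1 + 2)]
  have hγ0 : 0 < γ := by rw [hγ]; positivity
  have hw0 : 0 < w := by
    rw [hw, sub_pos]; apply Real.exp_lt_exp.2; linarith
  have hUin : ∀ x y : EE, ‖x - y‖ ≤ 1 → ‖x + y‖ ≤ 4 → x ∈ ball (0:EE) 4 ∧ y ∈ ball (0:EE) 4 :=
    fun x y h1 h2 => mem_of_sz h1 h2 (by norm_num)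
  obtain ⟨r0, hr0, hr01, M', hM', hst⟩ := usc_strip hG (isCompact_closedBall (0:EE) 1) (r := 1) one_pos
    (fun x y h1 h2 => hUin x y h1 (by
      have : ‖x + y‖ ≤ 1 := by simpa using h2
      linarith)) (M := 0) (by
      intro x hx
      have hxx : ‖x + x‖ ≤ 1 := by simpa using hx
      have := (mem_of_sz (x := x) (y := x) (a := 0) (c := 1) (by simp) hxx (by norm_num)).1
      rw [mem_ball_zero_iff] at this
      linarith [hlt x this])
  obtain ⟨r, hr, hrr0, hrM⟩ := (ev_pos.and ((ev_small 1 hr0).and (ev_small C1 (show 0 < -M' / 2 by linarith)))).exists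
  rw [one_mul] at hrr0
  obtain ⟨a, ha, h1, h2, h3, h4, h5, h6⟩ := (ev_pos.and ((ev_small (ρ ^ 2 / w) one_pos).and ((ev_small (2 * ρ + 2) one_pos).and
    ((ev_small (ρ ^ 2 / w) (show 0 < -M' / 2 by linarith)).and ((ev_small (2 * (ρ + 1)) hr).and
    ((ev_small (8 * γ * (ρ ^ 2 / w)) one_pos).and (ev_small (ρ ^ 2 / w) hr))))))).exists
  obtain ⟨α, hα⟩ : ∃ α, α = a⁻¹ := ⟨_, rfl⟩
  have hα0 : 0 < α := by rw [hα]; positivity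
  have hαa : α * a = 1 := by rw [hα]; field_simp
  obtain ⟨ε, hε⟩ : ∃ ε, ε = ρ ^ 2 / w * a := ⟨_, rfl⟩
  have hε0 : 0 < ε := by rw [hε]; positivity
  have hαε : α * ε = ρ ^ 2 / w := by
    rw [hε]; calc α * (ρ ^ 2 / w * a) = ρ ^ 2 / w * (α * a) := by ring
      _ = _ := by rw [hαa, mul_one]
  rw [← hε] at h1 h3 h6
  have h2' : 2 * ρ + 2 ≤ α := by
    have := mul_le_mul_of_nonneg_left h2 hα0.le
    calc 2 * ρ + 2 = (2 * ρ + 2) * (α * a) := by rw [hαa, mul_one]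
      _ = α * ((2 * ρ + 2) * a) := by ring
      _ ≤ α * 1 := this
      _ = α := mul_one _
  have h4' : 2 * (ρ + 1) ≤ α * r := by
    have := mul_le_mul_of_nonneg_left h4 hα0.le
    calc 2 * (ρ + 1) = 2 * (ρ + 1) * (α * a) := by rw [hαa, mul_one]
      _ = α * (2 * (ρ + 1) * a) := by ring
      _ ≤ α * r := this
  have hexp : ∀ s : ℝ, Real.exp (-(γ * s ^ 2)) ≤ 1 := fun s => Real.exp_le_one_iff.2 (by
    simp; positivity)
  obtain ⟨E, hEd⟩ : ∃ E, E = Real.exp (-(γ * 4 ^ 2)) := ⟨_, rfl⟩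
  have hE : 0 < E := by rw [hEd]; exact Real.exp_pos _
  rw [← hEd] at hΛ1
  have hb0 : 0 ≤ ε * E + ρ ^ 2 / 2 * a := by positivity
  have hquad : ∀ t : ℝ, ρ * t - α / 2 * t ^ 2 ≤ ρ ^ 2 / 2 * a := by
    intro t
    have : ρ ^ 2 / 2 * a - (ρ * t - α / 2 * t ^ 2) = α / 2 * (ρ * a - t) ^ 2 := by
      have e1 : α / 2 * (ρ * a - t) ^ 2 = ρ ^ 2 / 2 * a * (α * a) - ρ * t * (α * a) + α / 2 * t ^ 2 := by ring
      rw [e1, hαa]; ring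
    have h0 : 0 ≤ α / 2 * (ρ * a - t) ^ 2 := by positivity
    linarith
  have hV : ∀ x y : EE, ‖x - y‖ ≤ 1 → ‖x + y‖ ≤ 4 →
      v x - u y ≤ inner ℝ p (x - y) + ρ * ‖x - y‖ := fun x y g1 g2 =>
    hflat x (hUin x y g1 g2).1 y (hUin x y g1 g2).2
  have hεe : ∀ s : ℝ, ε * Real.exp (-(γ * s ^ 2)) ≤ ε := fun s => by
    have := mul_le_mul_of_nonneg_left (hexp s) hε0.le
    linarith
  have key := IC_max hG hΛ (isCompact_closedBall (0:EE) 1) (s1 := 1) (s2 := 4) (ε := ε) (γ := γ)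
    (α := α) (Γ := Γ) (G := C1 + 1) (b := ε * E + ρ ^ 2 / 2 * a)
    one_pos (by norm_num) hε0 hγ0 hα0.le (by linarith) (fun x y g1 g2 => hUin x y (by simpa using g1) g2)
    (F := fun z => inner ℝ p z + α / 2 * ‖z - 0‖ ^ 2) (by fun_prop)
    (by
      rw [hΓ]
      have e0 : 0 ≤ 2 * ε * γ * 4 := by positivity
      have : 2 * ε * γ * 4 ≤ 1 := by rw [hε]; linarith
      have : C1 + 1 + 2 * ε * γ * 4 ≤ C1 + 2 := by linarith
      gcongr)
    (by rw [hγ]; linarith)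
    (by
      calc 100 * N * Γ * α * ε = 100 * N * Γ * (α * ε) := by ring
        _ = (100 * N * Γ * ρ ^ 2) / w := by rw [hαε]; ring
        _ ≤ 1 := by rw [div_le_one hw0]; exact hρ1)
    (by
      rw [hγ]
      have e1 : 2 * Γ * H₀ ≤ 2 * Γ * 1 := by gcongr
      have : 0 ≤ N * Γ := by positivity
      linarith)
    (by
      intro x y hz hs hor
      have hz' : ‖x - y‖ ≤ 1 := by simpa using hz
      have hf := hV x y hz' hs
      simp only [sub_zero]
      rcases hor with h | h | h
      · have : ‖x - y‖ = 1 := by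
          rw [interior_closedBall _ one_ne_zero, mem_ball_zero_iff, not_lt] at h
          exact le_antisymm hz' h
        rw [this] at hf ⊢
        linarith [hεe ‖x + y‖]
      · rcases le_total ‖x - y‖ r with hzr | hzr
        · have g1 := hst x y (hzr.trans hrr0) (by simpa using h)
          have g2 : -(C1 * r) ≤ inner ℝ p (x - y) := by
            have g3 := (abs_le.1 (abs_real_inner_le_norm p (x - y))).1
            have g4 : ‖p‖ * ‖x - y‖ ≤ C1 * r := by gcongr
            linarith
          have g5 : 0 ≤ α / 2 * ‖x - y‖ ^ 2 := by positivity
          linarith [hεe ‖x + y‖]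
        · have g1 : α / 2 * r * ‖x - y‖ ≤ α / 2 * ‖x - y‖ ^ 2 := by
            rw [sq, ← mul_assoc]; gcongr
          have g2 : (ρ + 1) * ‖x - y‖ ≤ α / 2 * r * ‖x - y‖ := by gcongr; linarith
          linarith [hεe ‖x + y‖]
      · have := hquad ‖x - y‖
        rw [h, ← hEd]
        linarith)
    (by
      intro x y hz _ hs2 hbig
      have hz' : ‖x - y‖ ≤ 1 := by simpa using interior_subset hz
      have hf := hV x y hz' hs2.le
      simp only [sub_zero] at hbig
      have g1 : α / 2 * ‖x - y‖ ^ 2 < ρ * ‖x - y‖ + ε := by linarith [hεe ‖x + y‖]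
      have g2 : α * ‖x - y‖ ≤ 1 := by
        by_contra! hcon
        obtain ⟨t, ht⟩ : ∃ t, t = α * ‖x - y‖ := ⟨_, rfl⟩
        have g3 : t ^ 2 / 2 < ρ * t + ρ ^ 2 / w := by
          have := mul_lt_mul_of_pos_left g1 hα0
          rw [← hαε, ht]
          have e : (α * ‖x - y‖) ^ 2 / 2 = α * (α / 2 * ‖x - y‖ ^ 2) := by ring
          rw [e]; refine this.trans_eq ?_; ring
        rw [← ht] at hcon
        have g4 : ρ ^ 2 / w ≤ ρ ^ 2 / w * t := le_mul_of_one_le_right (by positivity) hcon.le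
        have g5 := mul_le_mul_of_nonneg_right hρ2 (show 0 ≤ t by linarith)
        have g6 : 1 * t ≤ t * t := by gcongr
        rw [add_mul, one_mul, mul_assoc, mul_assoc] at g5
        rw [sq] at g3
        linarith
      refine ⟨⟨_, 0, _, _, UT_quad p 0 (x - y) 0 (α / 2), ?_, ?_⟩, ?_⟩
      · intro δ
        rw [inner_zero_left]; apply le_of_eq; ring
      · refine (norm_add_le _ _).trans ?_
        rw [norm_smul, sub_zero, Real.norm_of_nonneg (by positivity)]
        linarith
      · have g3 : ‖x - y‖ ≤ a := by
          have := mul_le_mul_of_nonneg_right g2 ha.le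
          calc ‖x - y‖ = ‖x - y‖ * (α * a) := by rw [hαa, mul_one]
            _ = α * ‖x - y‖ * a := by ring
            _ ≤ _ := by linarith
        calc Λ * ‖x - y‖ * Γ ^ 2 ≤ Λ * a * Γ ^ 2 := by gcongr
          _ = (Λ * Γ ^ 2) * a := by ring
          _ ≤ (ρ ^ 2 / w * γ ^ 2 * E) * a := by gcongr
          _ = _ := by rw [hε, hEd]; ring)
  have hfin := key y1 y1 (by simp) (by
    have := norm_add_le y1 y1
    rw [hy1] at this; linarith)
  have e2 : ‖y1 + y1‖ = 2 := by
    rw [← two_smul ℝ, norm_smul, hy1]; norm_num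
  simp only [sub_self, inner_zero_right, norm_zero, e2] at hfin
  have e3 : ε * w = ρ ^ 2 * a := by rw [hε]; field_simp
  have e4 : 0 < ρ ^ 2 * a := by positivity
  rw [hw, mul_sub, ← hEd] at e3
  rw [show (0:ℝ) + α / 2 * 0 ^ 2 = 0 by ring] at hfin
  generalize ε * Real.exp (-(γ * 2 ^ 2)) = X at hfin e3
  linarith
end STE


section FIN
variable {N : ℕ}
local notation "EE" => EuclideanSpace ℝ (Fin N)

lemma Flat.scale {R0 r R ρ : ℝ} {v u : EE → ℝ} {p c : EE} (hR : 0 < R) (hf : Flat R0 v u p ρ)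
    (hUU : ∀ x ∈ ball (0:EE) r, c + R • x ∈ ball (0:EE) R0) :
    Flat r (fun x => v (c + R • x) / R) (fun x => u (c + R • x) / R) p ρ := by
  intro x hx y hy
  have h := hf _ (hUU x hx) _ (hUU y hy)
  rw [show c + R • x - (c + R • y) = R • (x - y) by rw [smul_sub]; abel,
        norm_smul, Real.norm_of_nonneg hR.le, inner_smul_right] at h
  show v (c + R • x) / R - u (c + R • y) / R ≤ _
  rw [← sub_div, div_le_iff₀ hR]
  linarith

lemma Flat.unscale {r R ρ : ℝ} {v u : EE → ℝ} {p : EE} (hR : 0 < R)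
    (hf : Flat r (fun x => v (0 + R • x) / R) (fun x => u (0 + R • x) / R) p ρ) :
    Flat (R * r) v u p ρ := by
  have hin : ∀ x ∈ ball (0:EE) (R * r), R⁻¹ • x ∈ ball (0:EE) r := by
    intro x hx
    rw [mem_ball_zero_iff] at hx ⊢
    rw [norm_smul, Real.norm_of_nonneg (by positivity), inv_mul_lt_iff₀ hR]
    exact hx
  intro x hx y hy
  have h := hf _ (hin x hx) _ (hin y hy)
  simp only [zero_add, smul_inv_smul₀ hR.ne'] at h
  rw [← smul_sub, norm_smul, Real.norm_of_nonneg (by positivity), inner_smul_right, ← sub_div,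
    div_le_iff₀ hR] at h
  refine h.trans (le_of_eq ?_)
  field_simp

lemma Flat.mono {R R' ρ ρ' : ℝ} {v u : EE → ℝ} {p : EE} (hf : Flat R v u p ρ) (hR : R' ≤ R) (hρ : ρ ≤ ρ') :
    Flat R' v u p ρ' := by
  intro x hx y hy
  have h := hf x (ball_subset_ball hR hx) y (ball_subset_ball hR hy)
  have : ρ * ‖x - y‖ ≤ ρ' * ‖x - y‖ := by gcongr
  linarith

lemma ball_scale {R r s : ℝ} (hR : 0 < R) (h : R * r ≤ s) : ∀ x ∈ ball (0:EE) r, (0:EE) + R • x ∈ ball (0:EE) s := by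
  intro x hx
  rw [mem_ball_zero_iff] at hx ⊢
  rw [zero_add, norm_smul, Real.norm_of_nonneg hR.le]
  have := mul_lt_mul_of_pos_left hx hR
  linarith

lemma iterD (N : ℕ) {C1 ρm : ℝ} (hC1 : 0 ≤ C1) (hρm : 0 < ρm) : ∃ κ : ℝ, 0 < κ ∧
    ∀ (v u : EuclideanSpace ℝ (Fin N) → ℝ) (Λ H₀ : ℝ), Good (ball 0 1) v u Λ H₀ → 0 ≤ Λ → Λ ≤ κ → 0 ≤ H₀ → H₀ ≤ κ →
    ∀ p ρ, 0 < ρ → ‖p‖ + 2 * ρ ≤ C1 → Flat 1 v u p ρ →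
    ∃ R p', 0 < R ∧ R ≤ 1 ∧ ‖p'‖ ≤ C1 ∧ Flat R v u p' ρm := by
  obtain ⟨μ, δ, κ, hμ, hμ1, hδ, hδ1, hκ, hstep⟩ := stepD N hC1 hρm
  refine ⟨κ, hκ, ?_⟩
  have main : ∀ n : ℕ, ∀ (v u : EuclideanSpace ℝ (Fin N) → ℝ) (Λ H₀ : ℝ), Good (ball 0 1) v u Λ H₀ → 0 ≤ Λ → Λ ≤ κ → 0 ≤ H₀ → H₀ ≤ κ →
    ∀ p ρ, 0 < ρ → ‖p‖ + 2 * ρ ≤ C1 → (1 - δ) ^ n * ρ ≤ ρm → Flat 1 v u p ρ →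
    ∃ R p', 0 < R ∧ R ≤ 1 ∧ ‖p'‖ ≤ C1 ∧ Flat R v u p' ρm := by
    intro n
    induction n with
    | zero =>
      intro v u Λ H₀ _ _ _ _ _ p ρ hρ hp hn hf
      rw [pow_zero, one_mul] at hn
      exact ⟨1, p, one_pos, le_rfl, by linarith, hf.mono le_rfl hn⟩
    | succ n ih =>
      intro v u Λ H₀ hG hΛ hΛ1 hH hH1 p ρ hρ hp hn hf
      rcases le_total ρ ρm with h | h
      · exact ⟨1, p, one_pos, le_rfl, by linarith, hf.mono le_rfl h⟩
      obtain ⟨p', ρ', h1, h2, h3, h4⟩ := hstep v u Λ H₀ hG hΛ hΛ1 hH hH1 p ρ h hp hf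
      have hμ2 : μ ^ 2 ≤ 1 := pow_le_one₀ hμ.le hμ1.le
      obtain ⟨R, q, hR, hR1, hq, hfl⟩ := ih _ _ _ _ (hG.scale hμ 0 (U' := ball 0 1) (ball_scale hμ (by linarith)))
        (by positivity) ((mul_le_of_le_one_left hΛ hμ2).trans hΛ1) (by positivity)
        ((mul_le_of_le_one_left hH hμ1.le).trans hH1) p' ρ' h1 (h3.trans hp) (by
          rw [pow_succ, mul_assoc] at hn
          refine le_trans ?_ hn
          have : 0 ≤ 1 - δ := by linarith
          gcongr) (h4.scale hμ (ball_scale hμ (by linarith)))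
      exact ⟨μ * R, q, by positivity, mul_le_one₀ hμ1.le hR.le hR1, hq, hfl.unscale hμ⟩
  intro v u Λ H₀ hG hΛ hΛ1 hH hH1 p ρ hρ hp hf
  obtain ⟨n, hn⟩ := exists_pow_lt_of_lt_one (show 0 < ρm / ρ by positivity) (show 1 - δ < 1 by linarith)
  refine main n v u Λ H₀ hG hΛ hΛ1 hH hH1 p ρ hρ hp ?_ hf
  rw [lt_div_iff₀ hρ] at hn
  exact hn.le

lemma stepE (N : ℕ) {C1 : ℝ} (hC1 : 0 ≤ C1) : ∃ ρ κ : ℝ, 0 < ρ ∧ 0 < κ ∧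
    ∀ (v u : EuclideanSpace ℝ (Fin N) → ℝ) (Λ H₀ : ℝ), Good (ball 0 1) v u Λ H₀ → 0 ≤ Λ → Λ ≤ κ → 0 ≤ H₀ → H₀ ≤ κ →
    ∀ p, ‖p‖ ≤ C1 → Flat 1 v u p ρ → v 0 = u 0 → ∀ x ∈ ball (0:EuclideanSpace ℝ (Fin N)) (1 / 10), v x = u x := by
  obtain ⟨Γ, hΓ⟩ : ∃ Γ : ℝ, Γ = 1 + (C1 + 2) ^ 2 := ⟨_, rfl⟩
  have hΓ0 : 0 < Γ := by rw [hΓ]; positivity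
  obtain ⟨γ, hγ⟩ : ∃ γ : ℝ, γ = (N + 2) * Γ := ⟨_, rfl⟩
  have hγ0 : 0 < γ := by rw [hγ]; positivity
  obtain ⟨w, hw⟩ : ∃ w : ℝ, w = Real.exp (-(γ * 2 ^ 2)) - Real.exp (-(γ * 4 ^ 2)) := ⟨_, rfl⟩
  have hw0 : 0 < w := by
    rw [hw, sub_pos]; apply Real.exp_lt_exp.2; linarith
  obtain ⟨ρ, hρ, h1, h2, h3⟩ := (ev_pos.and ((ev_small (100 * N * Γ) hw0).and
    ((ev_small (2 + 2 / w) one_pos).and (ev_small 1 one_pos)))).exists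
  rw [one_mul] at h3
  have hρ2 : ρ ^ 2 ≤ ρ := by rw [sq]; exact mul_le_of_le_one_left hρ.le h3
  obtain ⟨κ, hκ, k1, k2⟩ := (ev_pos.and ((ev_small 1 one_pos).and (ev_small (Γ ^ 2)
    (show 0 < ρ ^ 2 / w * γ ^ 2 * Real.exp (-(γ * 4 ^ 2)) by positivity)))).exists
  rw [one_mul] at k1
  refine ⟨ρ, κ, hρ, hκ, ?_⟩
  intro v u Λ H₀ hG hΛ hΛ1 hH hH1 p hp hf h0 c hc
  by_contra hne
  rw [mem_ball_zero_iff] at hc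
  have hcb : ∀ x, x ∈ closedBall c ‖c‖ → x ∈ ball (0:EuclideanSpace ℝ (Fin N)) 1 := by
    intro x hx
    rw [mem_closedBall, dist_eq_norm] at hx
    rw [mem_ball_zero_iff]
    have := norm_add_le (x - c) c
    rw [sub_add_cancel] at this
    linarith
  have hc1 : c ∈ ball (0:EuclideanSpace ℝ (Fin N)) 1 := hcb c (mem_closedBall_self (norm_nonneg _))
  have hclt : v c < u c := lt_of_le_of_ne (hG.le c hc1) hne
  have husc : UpperSemicontinuousOn (fun x => v x - u x) (closedBall c ‖c‖) := by
    have a1 : UpperSemicontinuousOn v (closedBall c ‖c‖) := hG.usc.mono hcb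
    have a2 : UpperSemicontinuousOn (fun x => - u x) (closedBall c ‖c‖) := by
      intro x hx t ht
      filter_upwards [(hG.lsc.mono hcb) x hx (-t) (by linarith)] with z hz
      linarith
    simpa only [sub_eq_add_neg] using a1.add a2
  have hcomp := husc.isCompact_inter_preimage_Ici (isCompact_closedBall c ‖c‖) 0
  have h0m : (0:EuclideanSpace ℝ (Fin N)) ∈ closedBall c ‖c‖ ∩ (fun x => v x - u x) ⁻¹' Ici 0 := by
    refine ⟨by simp, ?_⟩
    simp [h0]
  obtain ⟨y, ⟨hyb, hyz⟩, hmin⟩ := hcomp.exists_isMinOn ⟨0, h0m⟩ (f := fun x => ‖x - c‖) (by fun_prop)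
  rw [isMinOn_iff] at hmin
  have hyz' : u y ≤ v y := by simpa using hyz
  obtain ⟨R, hR⟩ : ∃ R, R = ‖y - c‖ := ⟨_, rfl⟩
  have hRc : R ≤ ‖c‖ := by
    have := hmin 0 h0m
    simp only [zero_sub, norm_neg] at this
    rw [hR]; exact this
  have hR0 : 0 < R := by
    rw [hR, norm_pos_iff, sub_ne_zero]
    rintro rfl
    linarith
  have hR1 : R ≤ 1 := by linarith
  have hUU : ∀ x ∈ ball (0:EuclideanSpace ℝ (Fin N)) 4, c + R • x ∈ ball (0:EuclideanSpace ℝ (Fin N)) 1 := by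
    intro x hx
    rw [mem_ball_zero_iff] at hx ⊢
    have a1 := norm_add_le c (R • x)
    rw [norm_smul, Real.norm_of_nonneg hR0.le] at a1
    have a2 : R * ‖x‖ ≤ 1 / 10 * 4 := by gcongr; linarith
    linarith
  have hR2 : R ^ 2 ≤ 1 := pow_le_one₀ hR0.le hR1
  have hk : R ^ 2 * Λ ≤ κ := (mul_le_of_le_one_left hΛ hR2).trans hΛ1
  have hcy : c + R • R⁻¹ • (y - c) = y := by rw [smul_inv_smul₀ hR0.ne']; abel
  refine E0 (hG.scale hR0 c hUU) (by positivity) (((mul_le_of_le_one_left hH hR1).trans hH1).trans k1) hρ hp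
    (hf.scale hR0 hUU) hΓ hγ hw ?_ ?_ ?_ (y1 := R⁻¹ • (y - c)) ?_ ?_ ?_
  · refine le_trans ?_ h1
    gcongr
  · refine le_trans (le_of_eq ?_) (le_trans (add_le_add_right (mul_le_mul_of_nonneg_left hρ2 (show 0 ≤ 2 / w by positivity)) (2 * ρ)) (le_trans (le_of_eq ?_) h2))
    · ring
    · ring
  · refine le_trans ?_ k2
    rw [mul_comm]
    gcongr
  · rw [norm_smul, ← hR, Real.norm_of_nonneg (by positivity), inv_mul_cancel₀ hR0.ne']
  · simp only [hcy]
    gcongr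
  · intro x hx
    have hn : ‖c + R • x - c‖ < R := by
      rw [add_sub_cancel_left, norm_smul, Real.norm_of_nonneg hR0.le]
      have := mul_lt_mul_of_pos_left hx hR0
      linarith
    have : v (c + R • x) < u (c + R • x) := by
      by_contra! hcon
      have := hmin (c + R • x) ⟨by rw [mem_closedBall, dist_eq_norm]; linarith, by simpa using hcon⟩
      linarith
    show v (c + R • x) / R < u (c + R • x) / R
    gcongr
end FIN


section FINB
variable {N : ℕ}
local notation "EE" => EuclideanSpace ℝ (Fin N)

lemma eq_unscale {r R : ℝ} {v u : EE → ℝ} {c : EE} (hR : 0 < R)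
    (h : ∀ x ∈ ball (0:EE) r, v (c + R • x) / R = u (c + R • x) / R) :
    ∀ x ∈ ball c (R * r), v x = u x := by
  intro x hx
  have := h (R⁻¹ • (x - c)) (by
    rw [mem_ball, dist_eq_norm] at hx
    rw [mem_ball_zero_iff, norm_smul, Real.norm_of_nonneg (by positivity), inv_mul_lt_iff₀ hR]
    exact hx)
  rw [show c + R • R⁻¹ • (x - c) = x by rw [smul_inv_smul₀ hR.ne']; abel] at this
  exact (div_left_inj' hR.ne').1 this

lemma ev_sq (a : ℝ) {b : ℝ} (hb : 0 < b) (ha : 0 ≤ a) : ∀ᶠ ε in 𝓝[>] (0:ℝ), ε ^ 2 * a ≤ b := by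
  filter_upwards [ev_pos, ev_small a hb, ev_small 1 one_pos] with ε h0 h1 h2
  rw [one_mul] at h2
  have : ε ^ 2 ≤ ε := by rw [sq]; exact mul_le_of_le_one_left h0.le h2
  have := mul_le_mul_of_nonneg_right this ha
  linarith

lemma local_one {v u : EE → ℝ} {Λ H₀ : ℝ} (hG : Good (ball (0:EE) 1) v u Λ H₀) (hΛ : 0 ≤ Λ) (hΛ1 : Λ ≤ 1)
    (hH : 0 ≤ H₀) (hH1 : H₀ ≤ 1) (h0 : v 0 = u 0) : ∃ r > 0, ∀ x ∈ ball (0:EE) r, v x = u x := by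
  obtain ⟨A, hA, r1, hr1, hr12, hlip⟩ := lip_local hG hΛ hΛ1 hH hH1
  have hC1 : 0 ≤ 2 * (A + 1) := by positivity
  obtain ⟨ρE, κE, hρE, hκE, hE⟩ := stepE N hC1
  obtain ⟨κ, hκ, hD⟩ := iterD N hC1 hρE
  have hflat0 : Flat (r1 / 4) v u 0 (A + 1) := by
    intro x hx y hy
    rw [mem_ball_zero_iff] at hx hy
    have a1 := norm_sub_le x y
    have a2 := norm_add_le x y
    have := hlip x y (by linarith) (by linarith)
    rw [inner_zero_left]
    linarith [norm_nonneg (x - y)]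
  obtain ⟨t, ht, t1, t2, t3, t4⟩ := (ev_pos.and ((ev_small 1 (show 0 < r1 / 4 by positivity)).and
    ((ev_sq Λ hκ hΛ).and ((ev_small H₀ hκ).and (ev_small 1 one_pos))))).exists
  rw [one_mul] at t1 t4
  have hG2 := hG.scale ht 0 (U' := ball 0 1) (ball_scale ht (by linarith))
  obtain ⟨R, p, hR, hR1, hp, hfl⟩ := hD _ _ _ _ hG2 (by positivity) t2 (by positivity) (by linarith) 0 (A + 1)
    (by positivity) (by rw [norm_zero]; linarith) (hflat0.scale ht (ball_scale ht (by linarith)))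
  obtain ⟨s, hs, s1, s2, s3⟩ := (ev_pos.and ((ev_small 1 hR).and
    ((ev_sq (t ^ 2 * Λ) hκE (by positivity)).and (ev_small (t * H₀) hκE)))).exists
  rw [one_mul] at s1
  have hG3 := hG2.scale hs 0 (U' := ball 0 1) (ball_scale hs (by linarith))
  have hfin := hE _ _ _ _ hG3 (by positivity) s2 (by positivity) (by linarith) p hp
    (hfl.scale hs (ball_scale hs (by linarith))) (by simp [h0])
  have h1 := eq_unscale (c := (0:EE)) (v := fun x => v (0 + t • x) / t) (u := fun x => u (0 + t • x) / t) hs hfin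
  have h2 := eq_unscale (c := (0:EE)) ht h1
  exact ⟨_, by positivity, h2⟩

lemma local_eq {Ω : Set EE} (hΩ : IsOpen Ω) {H u v : EE → ℝ} (hH : LocLipschitzOn Ω H)
    (hu_lsc : LowerSemicontinuousOn u Ω) (hu : IsViscositySupersol Ω H u)
    (hv_usc : UpperSemicontinuousOn v Ω) (hv : IsViscositySubsol Ω H v)
    (huv : ∀ x ∈ Ω, v x ≤ u x) {x0 : EE} (hx : x0 ∈ Ω) (h0 : v x0 = u x0) :
    ∃ r > 0, ∀ x ∈ ball x0 r, v x = u x := by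
  obtain ⟨K, T, hT, hL⟩ := hH x0 hx
  rw [hΩ.nhdsWithin_eq hx] at hT
  obtain ⟨r, hr, hrs⟩ := Metric.mem_nhds_iff.1 (Filter.inter_mem hT (hΩ.mem_nhds hx))
  have hK : 0 ≤ (K:ℝ) := K.2
  have hn : (0:ℝ) ≤ N := N.cast_nonneg
  have hlip : ∀ x ∈ ball x0 r, ∀ y ∈ ball x0 r, |H x - H y| ≤ K * ‖x - y‖ := by
    intro x hx y hy
    have := hL.dist_le_mul x (hrs hx).1 y (hrs hy).1
    rwa [Real.dist_eq, dist_eq_norm] at this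
  have hG : Good (ball x0 r) v u (N * K) (N * (|H x0| + K * r)) := by
    refine good_of_visc isOpen_ball (fun x hx => (hrs hx).2) hu_lsc hu hv_usc hv huv (by positivity) ?_ ?_
    · intro x hx
      have h1 := hlip x hx x0 (mem_ball_self hr)
      have h2 : ‖x - x0‖ ≤ r := by rw [mem_ball, dist_eq_norm] at hx; exact hx.le
      have h3 : |H x| ≤ |H x - H x0| + |H x0| := by
        have := abs_add_le (H x - H x0) (H x0)
        rwa [sub_add_cancel] at this
      have h4 : K * ‖x - x0‖ ≤ K * r := by gcongr
      rw [abs_mul, abs_of_nonneg hn]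
      gcongr
      linarith
    · intro x hx y hy
      rw [← mul_sub, abs_mul, abs_of_nonneg hn, mul_assoc]
      gcongr
      exact hlip x hx y hy
  obtain ⟨t, ht, t1, t2, t3⟩ := (ev_pos.and ((ev_small 1 hr).and
    ((ev_sq (N * K) one_pos (by positivity)).and (ev_small (N * (|H x0| + K * r)) one_pos)))).exists
  rw [one_mul] at t1
  have hG2 := hG.scale ht x0 (U' := ball 0 1) (by
    intro x hx
    rw [mem_ball_zero_iff] at hx
    rw [mem_ball, dist_eq_norm, add_sub_cancel_left, norm_smul, Real.norm_of_nonneg ht.le]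
    have := mul_lt_mul_of_pos_left hx ht
    linarith)
  obtain ⟨r', hr', h⟩ := local_one hG2 (by positivity) t2 (by positivity) (by linarith) (by simp [h0])
  exact ⟨_, by positivity, eq_unscale ht h⟩
end FINB

/-- **Strong comparison principle** for semicontinuous viscosity solutions of
the prescribed mean curvature equation `M(u) = N H` on a domain Ω ⊆ ℝᴺ. -/
theorem strong_comparison_principle {N : ℕ} (hN : 2 ≤ N)
    (Ω : Set (EuclideanSpace ℝ (Fin N))) (hΩo : IsOpen Ω) (hΩc : IsConnected Ω)
    (H : EuclideanSpace ℝ (Fin N) → ℝ) (hH : LocLipschitzOn Ω H)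
    (u v : EuclideanSpace ℝ (Fin N) → ℝ)
    (hu_lsc : LowerSemicontinuousOn u Ω) (hu : IsViscositySupersol Ω H u)
    (hv_usc : UpperSemicontinuousOn v Ω) (hv : IsViscositySubsol Ω H v)
    (huv : ∀ x ∈ Ω, v x ≤ u x)
    (x₀ : EuclideanSpace ℝ (Fin N)) (hx₀ : x₀ ∈ Ω) (htouch : u x₀ = v x₀) :
    ∀ x ∈ Ω, u x = v x := by
  have hA : IsOpen {x | ∃ r > 0, ∀ z ∈ ball x r, v z = u z} := by
    rw [Metric.isOpen_iff]
    rintro x ⟨r, hr, h⟩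
    refine ⟨r / 2, by positivity, fun y hy => ⟨r / 2, by positivity, fun z hz => h z ?_⟩⟩
    rw [mem_ball] at hy hz ⊢
    linarith [dist_triangle z y x]
  have hB : IsOpen {x | x ∈ Ω ∧ v x < u x} := by
    rw [isOpen_iff_mem_nhds]
    rintro x ⟨hx, hlt⟩
    obtain ⟨m, hm1, hm2⟩ := exists_between hlt
    have h1 := hv_usc x hx m hm1
    have h2 := hu_lsc x hx m hm2
    rw [hΩo.nhdsWithin_eq hx] at h1 h2
    filter_upwards [h1, h2, hΩo.mem_nhds hx] with z a1 a2 a3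
    exact ⟨a3, lt_trans a1 a2⟩
  have hloc : ∀ x ∈ Ω, v x = u x → x ∈ {x | ∃ r > 0, ∀ z ∈ ball x r, v z = u z} := fun x hx h =>
    local_eq hΩo hH hu_lsc hu hv_usc hv huv hx h
  intro x hx
  by_contra hne
  obtain ⟨z, hz, ⟨r, hr, h1⟩, h2⟩ := hΩc.isPreconnected _ _ hA hB (by
    intro y hy
    rcases (huv y hy).eq_or_lt with h | h
    · exact Or.inl (hloc y hy h)
    · exact Or.inr ⟨hy, h⟩) ⟨x₀, hx₀, hloc x₀ hx₀ htouch.symm⟩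
    ⟨x, hx, hx, lt_of_le_of_ne (huv x hx) (fun h => hne h.symm)⟩
  have := h1 z (mem_ball_self hr)
  linarith [h2.2]
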